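/- arXiv:1511.02941 — 5 statements merged into one kernel-verified Lean document; each statement's English description precedes it below -/
import Mathlib

section
/- Each of the following number fields has class number 1: (a) ℚ(√2, √−3); (b) the cyclotomic field ℚ(ζ₅); (c) ℚ(√5, √−3); (d) ℚ(cos(π/8), √−3), where ℚ(cos(π/8)) is the real subfield of ℂ generated by cos(π/8) (equivalently, by ζ₁₆ + ζ₁₆⁻¹); (e) ℚ(√2, ζ₅). -/
set_option synthInstance.maxHeartbeats 400000

/-!
Statement 1: each of the number fields ℚ(√2, √−3), ℚ(ζ₅), ℚ(√5, √−3),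
ℚ(cos(π/8), √−3), ℚ(√2, ζ₅) — realized as subfields of ℂ — has class number 1.
-/

open IntermediateField NumberField Real

noncomputable def zeta5 : ℂ := Complex.exp (2 * Real.pi * Complex.I / 5)

section Residue

variable {K : Type*} [Field K] [NumberField K]

theorem le_inertiaDeg_of_residueField {p : ℕ} (hp : p.Prime) (k : ℕ)
    (h : ∀ f, 0 < f → f < k → ∀ (P : Ideal (𝓞 K)) [P.IsMaximal] [CharP (𝓞 K ⧸ P) p]
      [Finite (𝓞 K ⧸ P)], Nat.card (𝓞 K ⧸ P) = p ^ f → False)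
    (P : Ideal (𝓞 K)) (hP : P ∈ Ideal.primesOver (Ideal.span {(p : ℤ)}) (𝓞 K)) :
    k ≤ P.inertiaDeg ℤ := by
  obtain ⟨hP1, hP2⟩ := hP
  have hcard := Ideal.pow_inertiaDeg p P
  have hpZ : Prime (p : ℤ) := Nat.prime_iff_prime_int.mp hp
  have hP0 : P ≠ ⊥ := Ideal.ne_bot_of_mem_primesOver (p := Ideal.span {(p : ℤ)})
    (by simpa using hp.ne_zero) ⟨hP1, hP2⟩
  have hmax : P.IsMaximal := hP1.isMaximal hP0
  by_contra! hlt
  have hfin : Finite (𝓞 K ⧸ P) := Ideal.finiteQuotientOfFreeOfNeBot P hP0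
  have hmem : (p : 𝓞 K) ∈ P := by
    have := (Ideal.liesOver_span_iff hP1.ne_top hpZ).mp hP2
    simpa using this
  have hchar : CharP (𝓞 K ⧸ P) p := by
    have : Fact p.Prime := ⟨hp⟩
    have : Nontrivial (𝓞 K ⧸ P) := Ideal.Quotient.nontrivial_iff.mpr hP1.ne_top
    refine (CharP.charP_iff_prime_eq_zero hp).mpr ?_
    rw [← map_natCast (Ideal.Quotient.mk P), Ideal.Quotient.eq_zero_iff_mem]
    exact hmem
  rw [Ideal.absNorm_apply, Submodule.cardQuot_apply] at hcard
  refine h _ ?_ hlt P hcard.symm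
  by_contra! h0
  have h1 : P.inertiaDeg ℤ = 0 := by omega
  rw [h1, pow_zero] at hcard
  have : Nontrivial (𝓞 K ⧸ P) := Ideal.Quotient.nontrivial_iff.mpr hP1.ne_top
  have := Finite.one_lt_card (α := 𝓞 K ⧸ P)
  exact this.ne hcard

theorem exists_natCast_eq_of_card_eq_prime {F : Type*} [Field F] {p : ℕ} [CharP F p] [Finite F]
    (hp : p.Prime) (hF : Nat.card F = p) (x : F) : ∃ n < p, (n : F) = x := by
  have : NeZero p := ⟨hp.ne_zero⟩
  have := Fintype.ofFinite F
  obtain ⟨y, rfl⟩ := (ZMod.castHom_bijective F (n := p) (by rw [← hF, Nat.card_eq_fintype_card])).2 x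
  exact ⟨y.val, y.val_lt, by simp⟩

theorem FiniteField.pow_natCard {F : Type*} [Field F] [Finite F] (x : F) :
    x ^ Nat.card F = x := by
  have := Fintype.ofFinite F
  rw [Nat.card_eq_fintype_card, FiniteField.pow_card]

theorem exists_isPrincipal_of_natAbs_norm_eq_pow {p k : ℕ} (hp : p.Prime) (hk : k ≠ 0)
    (hdeg : ∀ P ∈ Ideal.primesOver (Ideal.span {(p : ℤ)}) (𝓞 K), k ≤ P.inertiaDeg ℤ)
    (α : 𝓞 K) (hα : (Algebra.norm ℤ α).natAbs = p ^ k) :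
    ∃ P ∈ Ideal.primesOver (Ideal.span {(p : ℤ)}) (𝓞 K), Submodule.IsPrincipal P := by
  have hpZ : Prime (p : ℤ) := Nat.prime_iff_prime_int.mp hp
  have hN : Ideal.absNorm (Ideal.span {α}) = p ^ k := by
    rw [Ideal.absNorm_span_singleton, hα]
  have hne : Ideal.span {α} ≠ ⊤ := by
    intro h
    rw [h, Ideal.absNorm_top] at hN
    exact (Nat.one_lt_pow hk hp.one_lt).ne hN
  obtain ⟨P, hmax, hle⟩ := Ideal.exists_le_maximal _ hne
  have hprime := hmax.isPrime
  have hmem : (p : 𝓞 K) ∈ P := by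
    have := hle (Ideal.absNorm_mem (Ideal.span {α}))
    rw [hN, Nat.cast_pow] at this
    exact hprime.mem_of_pow_mem _ this
  have hlies : P.LiesOver (Ideal.span {(p : ℤ)}) :=
    (Ideal.liesOver_span_iff hprime.ne_top hpZ).mpr (by simpa using hmem)
  refine ⟨P, ⟨hprime, hlies⟩, ?_⟩
  suffices P = Ideal.span {α} from ⟨α, this⟩
  have hcard := Ideal.pow_inertiaDeg p P
  have hdvd : p ^ k ∣ Ideal.absNorm P := hcard ▸ pow_dvd_pow p (hdeg P ⟨hprime, hlies⟩)
  have hdvd' : Ideal.absNorm P ∣ Ideal.absNorm (Ideal.span {α}) :=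
    Ideal.absNorm_dvd_absNorm_of_le hle
  obtain ⟨J, hJ⟩ := Ideal.dvd_iff_le.mpr hle
  have heq : Ideal.absNorm P = p ^ k := Nat.dvd_antisymm (hN ▸ hdvd') hdvd
  rw [hJ, map_mul, heq] at hN
  have hJ1 : Ideal.absNorm J = 1 := by
    have : 0 < p ^ k := pow_pos hp.pos k
    exact Nat.eq_of_mul_eq_mul_left this (by rw [hN, mul_one])
  rw [Ideal.absNorm_eq_one_iff.mp hJ1, Ideal.mul_top] at hJ
  exact hJ.symm

open InfinitePlace Module Nat in
theorem card_classGroup_eq_one_of_minkowski [IsGalois ℚ K] [IsTotallyComplex K] {n : ℕ}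
    (hn : finrank ℚ K = 2 * n) {D B : ℕ} (hD : (discr K).natAbs ≤ D ^ 2)
    (hB : (4 / 3.1415 : ℝ) ^ n * ((2 * n)! / (2 * n : ℝ) ^ (2 * n) * D) < B + 1)
    (h : ∀ p ≤ B, p.Prime → ∃ k,
      (∀ P ∈ Ideal.primesOver (Ideal.span {(p : ℤ)}) (𝓞 K), k ≤ P.inertiaDeg ℤ) ∧
      (B < p ^ k ∨ k ≠ 0 ∧ ∃ α : 𝓞 K, (Algebra.norm ℤ α).natAbs = p ^ k)) :
    Nat.card (ClassGroup (𝓞 K)) = 1 := by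
  have hpl : nrComplexPlaces K = n := by
    have := IsTotallyComplex.finrank K
    omega
  have hle : ⌊(4 / π) ^ nrComplexPlaces K *
      ((finrank ℚ K)! / (finrank ℚ K) ^ (finrank ℚ K) * √|discr K|)⌋₊ ≤ B := by
    refine Nat.lt_succ_iff.mp ((Nat.floor_lt (by positivity)).mpr (lt_of_le_of_lt ?_
      (by exact_mod_cast hB)))
    rw [hpl, hn]
    push_cast
    have h1 : (4 / π) ≤ 4 / 3.1415 := by
      gcongr
      linarith [Real.pi_gt_d4]
    have h2 : √|(discr K : ℝ)| ≤ D := by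
      rw [Real.sqrt_le_left (by positivity), ← Int.cast_abs, Int.abs_eq_natAbs]
      exact_mod_cast hD
    gcongr
  have : IsPrincipalIdealRing (𝓞 K) := by
    refine RingOfIntegers.isPrincipalIdealRing_of_isPrincipal_of_lt_or_isPrincipal_of_mem_primesOver_of_mem_Icc
      fun p hp hpp ↦ ?_
    obtain ⟨k, hk, hk'⟩ := h p ((Finset.mem_Icc.mp hp).2.trans hle) hpp
    rcases hk' with hlt | ⟨hk0, α, hα⟩
    · have hpZ : Prime (p : ℤ) := Nat.prime_iff_prime_int.mp hpp
      have : (Ideal.span {(p : ℤ)}).IsPrime := (Ideal.span_singleton_prime hpZ.ne_zero).mpr hpZ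
      obtain ⟨P, hP⟩ : (Ideal.primesOver (Ideal.span {(p : ℤ)}) (𝓞 K)).Nonempty :=
        Set.nonempty_coe_sort.mp inferInstance
      exact ⟨P, hP, Or.inl (hle.trans_lt (hlt.trans_le
        (Nat.pow_le_pow_right hpp.pos (hk P hP))))⟩
    · obtain ⟨P, hP, hP'⟩ := exists_isPrincipal_of_natAbs_norm_eq_pow hpp hk0 hk α hα
      exact ⟨P, hP, Or.inr hP'⟩
  rw [Nat.card_eq_fintype_card]
  exact classNumber_eq_one_iff.mpr this

end Residue

section Embeddings

open Module Kronecker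

variable {K : Type*} [Field K] [NumberField K]

theorem NumberField.natAbs_discr_le_of_discr_ne_zero {ι : Type*} [Fintype ι] [DecidableEq ι]
    (b : ι → 𝓞 K) (hι : Fintype.card ι = finrank ℚ K)
    (hb : Algebra.discr ℚ (fun i ↦ (b i : K)) ≠ 0) :
    ((discr K).natAbs : ℚ) ≤ |Algebra.discr ℚ (fun i ↦ (b i : K))| := by
  classical
  have hcard : Fintype.card (Free.ChooseBasisIndex ℤ (𝓞 K)) = Fintype.card ι := by
    rw [hι, ← RingOfIntegers.rank, finrank_eq_card_chooseBasisIndex]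
  let c : Basis ι ℤ (𝓞 K) := (RingOfIntegers.basis K).reindex (Fintype.equivOfCardEq hcard)
  have hZ : Algebra.discr ℤ b = (c.toMatrix b).det ^ 2 * discr K := by
    rw [← discr_eq_discr K c, ← Algebra.discr_of_matrix_vecMul, Basis.toMatrix_map_vecMul]
  have hloc : Algebra.discr ℚ (fun i ↦ (b i : K)) = (Algebra.discr ℤ b : ℤ) := by
    rw [Algebra.discr_def, Algebra.discr_def, ← eq_intCast (algebraMap ℤ ℚ), RingHom.map_det]
    congr 1
    ext i j
    simp only [Algebra.traceMatrix_apply, Algebra.traceForm_apply, RingHom.mapMatrix_apply,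
      Matrix.map_apply, ← map_mul]
    exact Algebra.trace_localization ℤ (nonZeroDivisors ℤ) _
  rw [hloc] at hb ⊢
  rw [hZ] at hb ⊢
  have hdet : (c.toMatrix b).det ≠ 0 := by
    rintro h
    simp [h] at hb
  have h1 : 1 ≤ |(c.toMatrix b).det ^ 2| := Int.one_le_abs (pow_ne_zero 2 hdet)
  rw [← Int.cast_abs, abs_mul, ← Int.cast_natCast, Int.natCast_natAbs]
  exact_mod_cast le_mul_of_one_le_left (abs_nonneg _) h1

variable {m n : ℕ} {r : Fin m → ℂ} {s : Fin n → ℂ} {a w : 𝓞 K}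

theorem NumberField.exists_equiv_algHom_of_le_finrank
    (hext : ∀ σ τ : K →ₐ[ℚ] ℂ, σ a = τ a → σ w = τ w → σ = τ)
    (hr : ∀ σ : K →ₐ[ℚ] ℂ, ∃ i, σ a = r i) (hs : ∀ σ : K →ₐ[ℚ] ℂ, ∃ j, σ w = s j)
    (hrank : m * n ≤ finrank ℚ K) :
    ∃ e : Fin m × Fin n ≃ (K →ₐ[ℚ] ℂ), ∀ x, e x a = r x.1 ∧ e x w = s x.2 := by
  choose f hf using hr
  choose g hg using hs
  have hinj : Function.Injective (fun σ : K →ₐ[ℚ] ℂ ↦ (f σ, g σ)) := by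
    intro σ τ h
    rw [Prod.mk.injEq] at h
    exact hext σ τ (by rw [hf, hf, h.1]) (by rw [hg, hg, h.2])
  have hbij := (Fintype.bijective_iff_injective_and_card _).mpr ⟨hinj, le_antisymm
    (Fintype.card_le_of_injective _ hinj) (by
      rw [AlgHom.card, Fintype.card_prod, Fintype.card_fin, Fintype.card_fin]; exact hrank)⟩
  refine ⟨(Equiv.ofBijective _ hbij).symm, fun x ↦ ?_⟩
  have hx := Equiv.ofBijective_apply_symm_apply _ hbij x
  exact ⟨by rw [hf, ← congr_arg Prod.fst hx], by rw [hg, ← congr_arg Prod.snd hx]⟩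

theorem NumberField.finrank_eq_of_equiv_algHom (e : Fin m × Fin n ≃ (K →ₐ[ℚ] ℂ)) :
    finrank ℚ K = m * n := by
  rw [← AlgHom.card ℚ K ℂ, ← Fintype.card_congr e, Fintype.card_prod, Fintype.card_fin,
    Fintype.card_fin]

theorem NumberField.natAbs_norm_eq_of_prod_eq (e : Fin m × Fin n ≃ (K →ₐ[ℚ] ℂ)) {α : 𝓞 K} {N : ℕ}
    (h : ∏ i, ∏ j, e (i, j) α = N) : (Algebra.norm ℤ α).natAbs = N := by
  have h1 := Algebra.norm_eq_prod_embeddings ℚ ℂ (α : K)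
  rw [← e.prod_comp, Fintype.prod_prod_type, h, ← Algebra.coe_norm_int] at h1
  have h2 : Algebra.norm ℤ α = (N : ℤ) := by
    have : ((Algebra.norm ℤ α : ℤ) : ℂ) = ((N : ℤ) : ℂ) := by simpa using h1
    exact_mod_cast this
  rw [h2, Int.natAbs_natCast]

theorem NumberField.natAbs_discr_le_sq (e : Fin m × Fin n ≃ (K →ₐ[ℚ] ℂ))
    (he : ∀ x, e x a = r x.1 ∧ e x w = s x.2) {D : ℕ}
    (hD0 : D ≠ 0)
    (hD : ((Matrix.vandermonde r).det ^ n * (Matrix.vandermonde s).det ^ m) ^ 2 = D ^ 2) :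
    (discr K).natAbs ≤ D ^ 2 := by
  let b : Fin m × Fin n → 𝓞 K := fun x ↦ a ^ (x.1 : ℕ) * w ^ (x.2 : ℕ)
  have hM : Algebra.embeddingsMatrixReindex ℚ ℂ (fun i ↦ (b i : K)) e =
      ((Matrix.vandermonde r) ⊗ₖ (Matrix.vandermonde s)).transpose := by
    ext x y
    simp [Algebra.embeddingsMatrixReindex, Algebra.embeddingsMatrix, b, he,
      Matrix.vandermonde_apply]
  have h1 := Algebra.discr_eq_det_embeddingsMatrixReindex_pow_two ℚ ℂ (fun i ↦ (b i : K)) e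
  rw [hM, Matrix.det_transpose, Matrix.det_kronecker, Fintype.card_fin, Fintype.card_fin, hD] at h1
  have h2 : Algebra.discr ℚ (fun i ↦ (b i : K)) = (D ^ 2 : ℕ) := by
    apply (algebraMap ℚ ℂ).injective
    rw [h1]
    simp
  have h3 := natAbs_discr_le_of_discr_ne_zero b (by
    rw [finrank_eq_of_equiv_algHom e, Fintype.card_prod, Fintype.card_fin, Fintype.card_fin])
    (by rw [h2]; exact_mod_cast pow_ne_zero 2 hD0)
  rw [h2, abs_of_nonneg (by positivity)] at h3
  exact_mod_cast h3

theorem NumberField.isGalois_of_forall_mem_fieldRange (φ : K →ₐ[ℚ] ℂ)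
    (h : ∀ (σ : K →ₐ[ℚ] ℂ) (c : K), σ c ∈ φ.range) : IsGalois ℚ K := by
  let f : (K →ₐ[ℚ] ℂ) → (K →ₐ[ℚ] K) := fun σ ↦
    ((AlgEquiv.ofInjectiveField φ).symm : φ.range →ₐ[ℚ] K).comp (σ.codRestrict φ.range (h σ))
  have hf : Function.Injective f := by
    intro σ τ hστ
    ext c
    have := (AlgEquiv.ofInjectiveField φ).symm.injective (DFunLike.congr_fun hστ c)
    exact congr_arg Subtype.val this
  refine IsGalois.of_card_aut_eq_finrank _ _ (le_antisymm ?_ ?_)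
  · rw [Nat.card_eq_fintype_card]
    exact AlgEquiv.card_le
  · rw [Nat.card_congr (Algebra.IsAlgebraic.algEquivEquivAlgHom ℚ K).toEquiv,
      ← AlgHom.card ℚ K ℂ, ← Nat.card_eq_fintype_card]
    exact Nat.card_le_card_of_injective f hf

end Embeddings

section Adjoin

open Module Polynomial

theorem IntermediateField.totient_le_two_mul_finrank (K : IntermediateField ℚ ℂ)
    [FiniteDimensional ℚ K] {N : ℕ} (hN : 0 < N) {z θ : ℂ} (hz : IsPrimitiveRoot z N) {u v : ℂ}
    (hu : u ∈ K) (hv : v ∈ K) (hθ : θ ^ 2 = u * θ + v) (hmem : z ∈ IntermediateField.adjoin K {θ}) :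
    N.totient ≤ 2 * finrank ℚ K := by
  let q : K[X] := X ^ 2 - C ⟨u, hu⟩ * X - C ⟨v, hv⟩
  have hq : q.natDegree = 2 := by
    simp only [q]
    compute_degree!
  have hqm : q.Monic := by
    simp only [q]
    monicity!
  have hq0 : aeval θ q = 0 := by
    simp [q, hθ]
  have hint : IsIntegral K θ := ⟨q, hqm, hq0⟩
  have hfin : FiniteDimensional K (IntermediateField.adjoin K {θ}) :=
    IntermediateField.adjoin.finiteDimensional hint
  have h2 : finrank K (IntermediateField.adjoin K {θ}) ≤ 2 := by
    rw [IntermediateField.adjoin.finrank hint, ← hq]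
    exact natDegree_le_of_dvd (minpoly.dvd _ _ hq0) hqm.ne_zero
  have : FiniteDimensional ℚ (IntermediateField.adjoin K {θ}) := FiniteDimensional.trans ℚ K _
  have h3 : finrank ℚ K * finrank K (IntermediateField.adjoin K {θ}) =
    finrank ℚ (IntermediateField.adjoin K {θ}) := finrank_mul_finrank _ _ _
  let z' : IntermediateField.adjoin K {θ} := ⟨z, hmem⟩
  have hz' : IsPrimitiveRoot z' N :=
    IsPrimitiveRoot.of_map_of_injective (f := (IntermediateField.adjoin K {θ}).val)
      (by exact hz) (RingHom.injective _)
  have h4 : (minpoly ℚ z').natDegree = N.totient := by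
    rw [← cyclotomic_eq_minpoly_rat hz' hN, natDegree_cyclotomic]
  have h5 := minpoly.natDegree_le (A := ℚ) z'
  nlinarith

theorem card_classGroup_adjoin_pair_eq_one {x y : ℂ} {m n : ℕ} {r : Fin m → ℂ} {s : Fin n → ℂ}
    {p q : ℤ[X]} (hp : p.Monic) (hq : q.Monic) (hx : aeval x p = 0) (hy : aeval y q = 0)
    (hpr : ∀ c : ℂ, aeval c p = 0 → ∃ i, c = r i) (hqs : ∀ c : ℂ, aeval c q = 0 → ∃ j, c = s j)
    (hr : ∀ i, r i ∈ IntermediateField.adjoin ℚ {x, y})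
    (hs : ∀ j, s j ∈ IntermediateField.adjoin ℚ {x, y})
    (him : ∀ j, (s j).im ≠ 0)
    {N h : ℕ} (hN : N.totient = 2 * (m * n)) (hN0 : 0 < N) {z θ u v : ℂ} (hz : IsPrimitiveRoot z N)
    (hu : u ∈ IntermediateField.adjoin ℚ {x, y}) (hv : v ∈ IntermediateField.adjoin ℚ {x, y})
    (hθ : θ ^ 2 = u * θ + v)
    (hmem : z ∈ IntermediateField.adjoin (IntermediateField.adjoin ℚ {x, y}) {θ})
    (hmn : m * n = 2 * h) {D B : ℕ} (hD0 : D ≠ 0)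
    (hD : ((Matrix.vandermonde r).det ^ n * (Matrix.vandermonde s).det ^ m) ^ 2 = D ^ 2)
    (hB : (4 / 3.1415 : ℝ) ^ h * ((2 * h).factorial / (2 * h : ℝ) ^ (2 * h) * D) < B + 1)
    (hprimes : ∀ l ≤ B, l.Prime → ∃ k,
      (∀ f, 0 < f → f < k → ∀ (F : Type) [Field F] [Finite F] [CharP F l], Nat.card F = l ^ f →
        ∀ a w : F, aeval a p = 0 → aeval w q = 0 → False) ∧
      (B < l ^ k ∨ k ≠ 0 ∧ ∃ α : MvPolynomial (Fin 2) ℤ,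
        ∏ i, ∏ j, MvPolynomial.aeval ![r i, s j] α = (l : ℂ) ^ k)) :
    Nat.card (ClassGroup (𝓞 (IntermediateField.adjoin ℚ {x, y}))) = 1 := by
  set K := IntermediateField.adjoin ℚ {x, y} with hK
  have hxi : IsIntegral ℤ x := ⟨p, hp, hx⟩
  have hyi : IsIntegral ℤ y := ⟨q, hq, hy⟩
  have hfin : FiniteDimensional ℚ K := by
    refine IntermediateField.finiteDimensional_adjoin ?_
    rintro c (rfl | rfl)
    · exact hxi.tower_top
    · exact hyi.tower_top
  have : NumberField K := ⟨⟩
  have hxK : x ∈ K := IntermediateField.subset_adjoin _ _ (by simp)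
  have hyK : y ∈ K := IntermediateField.subset_adjoin _ _ (by simp)
  have hinj : Function.Injective (algebraMap K ℂ) := (algebraMap K ℂ).injective
  let a : 𝓞 K := ⟨⟨x, hxK⟩, (isIntegral_algebraMap_iff hinj).mp hxi⟩
  let w : 𝓞 K := ⟨⟨y, hyK⟩, (isIntegral_algebraMap_iff hinj).mp hyi⟩
  have hap : aeval a p = 0 := by
    apply RingOfIntegers.coe_injective
    apply hinj
    rw [← aeval_algebraMap_apply, ← aeval_algebraMap_apply, map_zero, map_zero]
    exact hx
  have hwq : aeval w q = 0 := by
    apply RingOfIntegers.coe_injective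
    apply hinj
    rw [← aeval_algebraMap_apply, ← aeval_algebraMap_apply, map_zero, map_zero]
    exact hy
  have hra : ∀ σ : K →ₐ[ℚ] ℂ, ∃ i, σ a = r i := by
    intro σ
    apply hpr
    have : aeval (((σ : K →+* ℂ).comp (algebraMap (𝓞 K) K)).toIntAlgHom a) p = 0 := by
      rw [aeval_algHom_apply, hap, map_zero]
    exact this
  have hsw : ∀ σ : K →ₐ[ℚ] ℂ, ∃ j, σ w = s j := by
    intro σ
    apply hqs
    have : aeval (((σ : K →+* ℂ).comp (algebraMap (𝓞 K) K)).toIntAlgHom w) q = 0 := by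
      rw [aeval_algHom_apply, hwq, map_zero]
    exact this
  have hext : ∀ σ τ : K →ₐ[ℚ] ℂ, σ a = τ a → σ w = τ w → σ = τ := by
    intro σ τ h1 h2
    refine IntermediateField.algHom_ext_of_eq_adjoin ℚ hK ?_
    rintro c (rfl | rfl)
    · exact h1
    · exact h2
  have hrank : m * n ≤ finrank ℚ K := by
    have := K.totient_le_two_mul_finrank hN0 hz hu hv hθ hmem
    omega
  obtain ⟨e, he⟩ := exists_equiv_algHom_of_le_finrank hext hra hsw hrank
  have hgal : IsGalois ℚ K := by
    refine isGalois_of_forall_mem_fieldRange (algebraMap K ℂ).toRatAlgHom fun σ ↦ ?_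
    have key : ∀ c (hc : c ∈ K), σ ⟨c, hc⟩ ∈ K := by
      intro c hc
      induction hc using IntermediateField.adjoin_induction with
      | mem c hc =>
        rcases hc with rfl | rfl
        · obtain ⟨i, hi⟩ := hra σ
          exact hi ▸ hr i
        · obtain ⟨j, hj⟩ := hsw σ
          exact hj ▸ hs j
      | algebraMap c => exact (σ.commutes c).symm ▸ K.algebraMap_mem c
      | add c d hc hd h1 h2 => exact (map_add σ ⟨c, hc⟩ ⟨d, hd⟩) ▸ add_mem h1 h2
      | inv c hc h1 => exact (map_inv₀ σ ⟨c, hc⟩) ▸ inv_mem h1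
      | mul c d hc hd h1 h2 => exact (map_mul σ ⟨c, hc⟩ ⟨d, hd⟩) ▸ mul_mem h1 h2
    exact fun c ↦ ⟨⟨_, key c c.2⟩, rfl⟩
  have hcpx : IsTotallyComplex K := by
    refine ⟨fun v ↦ InfinitePlace.not_isReal_iff_isComplex.mp fun hv ↦ ?_⟩
    obtain ⟨φ, hφ, -⟩ := hv
    obtain ⟨j, hj⟩ := hsw (φ.toRatAlgHom)
    apply him j
    rw [← hj, ← Complex.conj_eq_iff_im]
    exact RingHom.congr_fun hφ w
  have hfr := finrank_eq_of_equiv_algHom e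
  refine card_classGroup_eq_one_of_minkowski (hfr.trans hmn) (natAbs_discr_le_sq e he hD0 hD) hB ?_
  intro l hl hlp
  obtain ⟨k, hk, hk'⟩ := hprimes l hl hlp
  refine ⟨k, le_inertiaDeg_of_residueField hlp k ?_, hk'.imp_right ?_⟩
  · intro f hf0 hf P _ _ _ hcard
    let _ := Ideal.Quotient.field P
    refine hk f hf0 hf (𝓞 K ⧸ P) hcard (Ideal.Quotient.mk P a) (Ideal.Quotient.mk P w) ?_ ?_
    · have : aeval ((Ideal.Quotient.mk P).toIntAlgHom a) p = 0 := by
        rw [aeval_algHom_apply, hap, map_zero]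
      exact this
    · have : aeval ((Ideal.Quotient.mk P).toIntAlgHom w) q = 0 := by
        rw [aeval_algHom_apply, hwq, map_zero]
      exact this
  · rintro ⟨hk0, α, hα⟩
    refine ⟨hk0, MvPolynomial.aeval ![a, w] α, natAbs_norm_eq_of_prod_eq e ?_⟩
    rw [Nat.cast_pow, ← hα]
    refine Finset.prod_congr rfl fun i _ ↦ Finset.prod_congr rfl fun j _ ↦ ?_
    have : ((e (i, j) : K →+* ℂ).comp (algebraMap (𝓞 K) K)).toIntAlgHom
        (MvPolynomial.aeval ![a, w] α) = MvPolynomial.aeval ![r i, s j] α := by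
      rw [MvPolynomial.comp_aeval_apply]
      congr 2
      ext c
      fin_cases c
      · exact (he (i, j)).1
      · exact (he (i, j)).2
    exact this

end Adjoin

section Auxiliary

theorem IsPrimitiveRoot.mul_of_coprime {M : Type*} [CommMonoid M] {a b : ℕ} {x y : M}
    (hx : IsPrimitiveRoot x a) (hy : IsPrimitiveRoot y b) (h : a.Coprime b) :
    IsPrimitiveRoot (x * y) (a * b) := by
  rw [hx.eq_orderOf, hy.eq_orderOf] at h ⊢
  rw [← (Commute.all x y).orderOf_mul_eq_mul_orderOf_of_coprime h]
  exact IsPrimitiveRoot.orderOf _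

theorem isPrimitiveRoot_prime_pow {M : Type*} [CommMonoid M] {p k : ℕ} [Fact p.Prime] {x : M}
    (h : x ^ p ^ k ≠ 1) (h' : x ^ p ^ (k + 1) = 1) : IsPrimitiveRoot x (p ^ (k + 1)) := by
  rw [← orderOf_eq_prime_pow h h']
  exact IsPrimitiveRoot.orderOf x

theorem adjoin_pair_eq_of_affine {a b c d : ℂ} {k l k' l' : ℚ} (hk : k ≠ 0) (hk' : k' ≠ 0)
    (hc : c = k * a + l) (hd : d = k' * b + l') :
    IntermediateField.adjoin ℚ {a, b} = IntermediateField.adjoin ℚ {c, d} := by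
  have key : ∀ {a c : ℂ} {k l : ℚ} {L : IntermediateField ℚ ℂ}, c = k * a + l → a ∈ L → c ∈ L := by
    rintro a c k l L rfl ha
    exact add_mem (mul_mem (SubfieldClass.ratCast_mem L k) ha) (SubfieldClass.ratCast_mem L l)
  apply le_antisymm <;> rw [IntermediateField.adjoin_le_iff]
  · rintro t (rfl | rfl)
    · refine key (k := k⁻¹) (l := -(l / k)) ?_
        (IntermediateField.subset_adjoin ℚ {c, d} (by simp : c ∈ _))
      rw [hc]
      push_cast
      have : (k : ℂ) ≠ 0 := by exact_mod_cast hk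
      field_simp
      ring
    · refine key (k := k'⁻¹) (l := -(l' / k')) ?_
        (IntermediateField.subset_adjoin ℚ {c, d} (by simp : d ∈ _))
      rw [hd]
      push_cast
      have : (k' : ℂ) ≠ 0 := by exact_mod_cast hk'
      field_simp
      ring
  · rintro t (rfl | rfl)
    · exact key hc (IntermediateField.subset_adjoin _ _ (by simp))
    · exact key hd (IntermediateField.subset_adjoin _ _ (by simp))

theorem Matrix.det_vandermonde_fin_two {R : Type*} [CommRing R] (a b : R) :
    (Matrix.vandermonde ![a, b]).det = b - a := by
  simp [Matrix.det_fin_two, Matrix.vandermonde_apply]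

theorem Matrix.det_vandermonde_fin_four {R : Type*} [CommRing R] (a b c d : R) :
    (Matrix.vandermonde ![a, b, c, d]).det =
      (b - a) * (c - a) * (d - a) * (c - b) * (d - b) * (d - c) := by
  have h0 : Finset.Ioi (0 : Fin 4) = {1, 2, 3} := by decide
  have h1 : Finset.Ioi (1 : Fin 4) = {2, 3} := by decide
  have h2 : Finset.Ioi (2 : Fin 4) = {3} := by decide
  have h3 : Finset.Ioi (3 : Fin 4) = ∅ := by decide
  rw [Matrix.det_vandermonde, Fin.prod_univ_four, h0, h1, h2, h3]
  simp
  ring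

variable {F : Type*} [Field F] [Finite F] {l : ℕ} [CharP F l]

theorem sq_ne_two_of_card_eq_prime (hl : l.Prime) (h : ∀ n < l, n ^ 2 % l ≠ 2 % l)
    (hF : Nat.card F = l) (a : F) : a ^ 2 ≠ 2 := by
  obtain ⟨n, hn, rfl⟩ := exists_natCast_eq_of_card_eq_prime hl hF a
  intro ha
  exact h n hn ((CharP.natCast_eq_natCast F l).mp (by exact_mod_cast ha))

theorem sq_add_self_add_one_ne_zero_of_card_eq_prime (hl : l.Prime)
    (h : ∀ n < l, (n ^ 2 + n + 1) % l ≠ 0) (hF : Nat.card F = l) (w : F) : w ^ 2 + w + 1 ≠ 0 := by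
  obtain ⟨n, hn, rfl⟩ := exists_natCast_eq_of_card_eq_prime hl hF w
  intro hw
  exact h n hn (Nat.mod_eq_zero_of_dvd ((CharP.cast_eq_zero_iff F l _).mp (by exact_mod_cast hw)))

theorem quartic_ne_zero_of_card_eq_prime (hl : l.Prime)
    (h : ∀ n < l, (n ^ 4 + 2) % l ≠ 4 * n ^ 2 % l) (hF : Nat.card F = l) (a : F) :
    a ^ 4 - 4 * a ^ 2 + 2 ≠ 0 := by
  obtain ⟨n, hn, rfl⟩ := exists_natCast_eq_of_card_eq_prime hl hF a
  intro ha
  refine h n hn ((CharP.natCast_eq_natCast F l).mp ?_)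
  push_cast
  linear_combination ha

theorem cyclotomic_five_ne_zero_of_card (h5 : ¬ l ∣ 5) (hF : Nat.card F % 5 ≠ 1) (w : F) :
    w ^ 4 + w ^ 3 + w ^ 2 + w + 1 ≠ 0 := by
  intro hw
  have h1 : w ^ 5 = 1 := by linear_combination (w - 1) * hw
  have hne : w ≠ 1 := by
    rintro rfl
    refine h5 ((CharP.cast_eq_zero_iff F l 5).mp ?_)
    push_cast
    linear_combination hw
  have : Fact (Nat.Prime 5) := ⟨Nat.prime_five⟩
  have h2 : w ^ Nat.card F = w ^ 1 := by rw [FiniteField.pow_natCard, pow_one]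
  have hord : orderOf w = 5 := orderOf_eq_prime h1 hne
  have h3 : Nat.card F ≡ 1 [MOD orderOf w] := by
    have hfin : IsOfFinOrder w := isOfFinOrder_iff_pow_eq_one.mpr ⟨5, by norm_num, h1⟩
    exact hfin.pow_eq_pow_iff_modEq.mp h2
  rw [hord] at h3
  exact hF h3

end Auxiliary

section Fields

open Polynomial Complex

noncomputable def omega : ℂ := (-1 + I * √3) / 2

theorem omega_sq_add_self_add_one : omega ^ 2 + omega + 1 = 0 := by
  have h3 : ((√3 : ℝ) : ℂ) ^ 2 = 3 := by
    exact_mod_cast Real.sq_sqrt (show (0 : ℝ) ≤ 3 by norm_num)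
  rw [omega]
  linear_combination (I ^ 2 * h3 + 3 * I_sq) / 4

theorem isPrimitiveRoot_omega : IsPrimitiveRoot omega 3 := by
  have h := omega_sq_add_self_add_one
  refine isPrimitiveRoot_prime_pow (p := 3) (k := 0) ?_ ?_
  · intro h1
    norm_num at h1
    norm_num [h1] at h
  · linear_combination (omega - 1) * h

theorem omega_im_ne_zero : omega.im ≠ 0 := by
  simp [omega]

theorem card_classGroup_adjoin_omega_eq_one {x : ℂ} {m : ℕ} {r : Fin m → ℂ}
    {p : ℤ[X]} (hp : p.Monic) (hx : aeval x p = 0)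
    (hpr : ∀ c : ℂ, aeval c p = 0 → ∃ i, c = r i)
    (hr : ∀ i, r i ∈ IntermediateField.adjoin ℚ {x, omega})
    {N : ℕ} (hN : (N * 3).totient = 4 * m) (hN0 : 0 < N) (hN3 : N.Coprime 3) {z θ u v : ℂ}
    (hz : IsPrimitiveRoot z N)
    (hu : u ∈ IntermediateField.adjoin ℚ {x, omega})
    (hv : v ∈ IntermediateField.adjoin ℚ {x, omega})
    (hθ : θ ^ 2 = u * θ + v)
    (hmem : z ∈ IntermediateField.adjoin (IntermediateField.adjoin ℚ {x, omega}) {θ})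
    {D B : ℕ} (hD0 : D ≠ 0) (hD : (Matrix.vandermonde r).det ^ 4 * (-3) ^ m = D ^ 2)
    (hB : (4 / 3.1415 : ℝ) ^ m * ((2 * m).factorial / (2 * m : ℝ) ^ (2 * m) * D) < B + 1)
    (hprimes : ∀ l ≤ B, l.Prime → ∃ k,
      (∀ f, 0 < f → f < k → ∀ (F : Type) [Field F] [Finite F] [CharP F l], Nat.card F = l ^ f →
        ∀ a w : F, aeval a p = 0 → w ^ 2 + w + 1 = 0 → False) ∧
      (B < l ^ k ∨ k ≠ 0 ∧ ∃ α : MvPolynomial (Fin 2) ℤ,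
        ∏ i, (MvPolynomial.aeval ![r i, omega] α * MvPolynomial.aeval ![r i, -1 - omega] α) =
          (l : ℂ) ^ k)) :
    Nat.card (ClassGroup (𝓞 (IntermediateField.adjoin ℚ {x, omega}))) = 1 := by
  have hω := omega_sq_add_self_add_one
  have hωK : omega ∈ IntermediateField.adjoin ℚ {x, omega} :=
    IntermediateField.subset_adjoin _ _ (by simp)
  refine card_classGroup_adjoin_pair_eq_one (q := X ^ 2 + X + 1) (s := ![omega, -1 - omega])
    (h := m) (z := z * omega) (N := N * 3) hp (by monicity!) hx
    (by simpa using hω) hpr ?_ hr ?_ ?_ ?_ (by omega)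
    (hz.mul_of_coprime isPrimitiveRoot_omega hN3) hu hv hθ
    (mul_mem hmem (IntermediateField.algebraMap_mem _
      (⟨omega, hωK⟩ : IntermediateField.adjoin ℚ {x, omega})))
    (by ring) hD0 ?_ hB ?_
  · intro c hc
    simp only [map_add, map_pow, aeval_X, map_one] at hc
    have : (c - omega) * (c - (-1 - omega)) = 0 := by linear_combination hc - hω
    rcases mul_eq_zero.mp this with h | h
    · exact ⟨0, sub_eq_zero.mp h⟩
    · exact ⟨1, sub_eq_zero.mp h⟩
  · intro j
    fin_cases j
    · exact hωK
    · exact sub_mem (neg_mem (one_mem _)) hωK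
  · intro j
    fin_cases j
    · exact omega_im_ne_zero
    · simpa using omega_im_ne_zero
  · rw [hN]
    ring
  · rw [Matrix.det_vandermonde_fin_two, ← hD, mul_pow, ← pow_mul, ← pow_mul, mul_comm m 2,
      pow_mul (_ - _) 2 m]
    congr 2
    linear_combination 4 * hω
  · simpa [Fin.prod_univ_two] using hprimes

theorem ofReal_sqrt_two_sq : (√2 : ℂ) ^ 2 = 2 := by
  exact_mod_cast Real.sq_sqrt (show (0 : ℝ) ≤ 2 by norm_num)

theorem isPrimitiveRoot_eight : IsPrimitiveRoot ((1 + I) * (√2 / 2)) 8 := by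
  have h2 : ((1 + I) * (√2 / 2)) ^ 2 = I := by
    linear_combination (1 + I) ^ 2 / 4 * ofReal_sqrt_two_sq + I_sq / 2
  have h4 : ((1 + I) * (√2 / 2)) ^ 4 = -1 := by
    linear_combination (((1 + I) * (√2 / 2)) ^ 2 + I) * h2 + I_sq
  refine isPrimitiveRoot_prime_pow (p := 2) (k := 2) ?_ ?_
  · norm_num [h4]
  · linear_combination (((1 + I) * (√2 / 2)) ^ 4 - 1) * h4

theorem one_add_I_mul_mem_adjoin_I {K : IntermediateField ℚ ℂ} (hK : (√2 : ℂ) ∈ K) :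
    (1 + I) * (√2 / 2) ∈ IntermediateField.adjoin K {I} :=
  mul_mem (add_mem (one_mem _) (IntermediateField.mem_adjoin_simple_self _ _))
    (IntermediateField.algebraMap_mem _ (⟨_, div_mem hK (ofNat_mem _ 2)⟩ : K))

theorem aeval_sq_sub_two {R : Type*} [CommRing R] (c : R) :
    aeval c (X ^ 2 - C 2 : ℤ[X]) = c ^ 2 - 2 := by
  rw [map_sub, map_pow, aeval_X, aeval_C, map_ofNat]

theorem exists_eq_of_aeval_sq_sub_two (c : ℂ) (hc : aeval c (X ^ 2 - C 2 : ℤ[X]) = 0) :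
    ∃ i, c = ![(√2 : ℂ), -√2] i := by
  rw [aeval_sq_sub_two] at hc
  have : (c - √2) * (c - -√2) = 0 := by linear_combination hc - ofReal_sqrt_two_sq
  rcases mul_eq_zero.mp this with h | h
  · exact ⟨0, sub_eq_zero.mp h⟩
  · exact ⟨1, sub_eq_zero.mp h⟩

theorem card_classGroup_adjoin_sqrt_two_omega :
    Nat.card (ClassGroup (𝓞 (IntermediateField.adjoin ℚ {(√2 : ℂ), omega}))) = 1 := by
  have h2 := ofReal_sqrt_two_sq
  have hK : (√2 : ℂ) ∈ IntermediateField.adjoin ℚ {(√2 : ℂ), omega} :=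
    IntermediateField.subset_adjoin _ _ (by simp)
  refine card_classGroup_adjoin_omega_eq_one (p := X ^ 2 - C 2) (r := ![(√2 : ℂ), -√2])
    (N := 8) (z := (1 + I) * (√2 / 2)) (θ := I) (u := 0) (v := -1) (D := 24) (B := 3)
    (by monicity!) (by rw [aeval_sq_sub_two, h2, sub_self]) exists_eq_of_aeval_sq_sub_two ?_
    (by decide +kernel) (by norm_num) (by norm_num) isPrimitiveRoot_eight (zero_mem _) (neg_mem (one_mem _)) (by simp)
    (one_add_I_mul_mem_adjoin_I hK) (by norm_num) ?_ (by norm_num [Nat.factorial]) ?_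
  · intro i
    fin_cases i
    · exact hK
    · exact neg_mem hK
  · rw [Matrix.det_vandermonde_fin_two]
    norm_num
    grind
  · intro l hl hlp
    refine ⟨2, fun f hf0 hf F _ _ _ hF a w ha hw ↦ ?_, Or.inl ?_⟩
    · obtain rfl : f = 1 := by omega
      rw [pow_one] at hF
      interval_cases l
      · norm_num at hlp
      · norm_num at hlp
      · exact sq_add_self_add_one_ne_zero_of_card_eq_prime hlp (by decide) hF w hw
      · exact sq_ne_two_of_card_eq_prime hlp (by decide) hF a (sub_eq_zero.mp (aeval_sq_sub_two a ▸ ha))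
    · have := hlp.two_le
      nlinarith

theorem isPrimitiveRoot_five : IsPrimitiveRoot zeta5 5 := by
  simpa [zeta5] using Complex.isPrimitiveRoot_exp 5 (by norm_num)

theorem cyclotomic_five_zeta5 : zeta5 ^ 4 + zeta5 ^ 3 + zeta5 ^ 2 + zeta5 + 1 = 0 := by
  have h := isPrimitiveRoot_five.isRoot_cyclotomic (by norm_num)
  have h5 : Fact (Nat.Prime 5) := ⟨Nat.prime_five⟩
  simp [cyclotomic_prime, Finset.sum_range_succ, IsRoot] at h
  linear_combination h

theorem zeta5_sq : zeta5 ^ 2 = ((1 + √5) / 2 - 1) * zeta5 + -1 := by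
  have h5 : (√5 : ℂ) ^ 2 = 5 := by
    exact_mod_cast Real.sq_sqrt (show (0 : ℝ) ≤ 5 by norm_num)
  have h1 : zeta5 = Complex.exp ((2 * (π / 5) : ℝ) * I) := by
    rw [zeta5]
    congr 1
    push_cast
    ring
  have h2 : zeta5 * Complex.exp (-(2 * (π / 5) : ℝ) * I) = 1 := by
    rw [h1, ← Complex.exp_add]
    simp
  have h3 := Complex.two_cos ((2 * (π / 5) : ℝ) : ℂ)
  rw [← h1, ← Complex.ofReal_cos, Real.cos_two_mul, Real.cos_pi_div_five] at h3
  push_cast at h2 h3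
  linear_combination -zeta5 * h3 - h2 + zeta5 * h5 / 4

theorem card_classGroup_adjoin_zeta5 : Nat.card (ClassGroup (𝓞 ℚ⟮zeta5⟯)) = 1 := by
  have : IsCyclotomicExtension {5} ℚ ℚ⟮zeta5⟯ := by
    change IsCyclotomicExtension {5} ℚ ℚ⟮zeta5⟯.toSubalgebra
    rw [IntermediateField.adjoin_simple_toSubalgebra_of_isAlgebraic
      (isPrimitiveRoot_five.isIntegral (by norm_num)).tower_top.isAlgebraic]
    exact isPrimitiveRoot_five.adjoin_isCyclotomicExtension ℚ
  have : NumberField ℚ⟮zeta5⟯ := IsCyclotomicExtension.numberField {5} ℚ _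
  rw [Nat.card_eq_fintype_card]
  exact classNumber_eq_one_iff.mpr (IsCyclotomicExtension.Rat.five_pid _)

theorem card_classGroup_adjoin_golden_omega :
    Nat.card (ClassGroup (𝓞 (IntermediateField.adjoin ℚ {((1 + √5) / 2 : ℂ), omega}))) = 1 := by
  have h5 : (√5 : ℂ) ^ 2 = 5 := by
    exact_mod_cast Real.sq_sqrt (show (0 : ℝ) ≤ 5 by norm_num)
  set φ : ℂ := (1 + √5) / 2 with hφ
  have hφ2 : φ ^ 2 - φ - 1 = 0 := by
    rw [hφ]
    linear_combination h5 / 4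
  have hK : φ ∈ IntermediateField.adjoin ℚ {φ, omega} :=
    IntermediateField.subset_adjoin _ _ (by simp)
  refine card_classGroup_adjoin_omega_eq_one (p := X ^ 2 - X - 1) (r := ![φ, 1 - φ])
    (N := 5) (z := zeta5) (θ := zeta5) (u := φ - 1) (v := -1) (D := 15) (B := 2)
    (by monicity!) (by simpa using hφ2) ?_ ?_ (by decide +kernel) (by norm_num)
    (by norm_num) isPrimitiveRoot_five (sub_mem hK (one_mem _)) (neg_mem (one_mem _)) zeta5_sq
    (IntermediateField.mem_adjoin_simple_self _ _) (by norm_num) ?_ (by norm_num [Nat.factorial]) ?_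
  · intro c hc
    simp at hc
    have : (c - φ) * (c - (1 - φ)) = 0 := by linear_combination hc - hφ2
    rcases mul_eq_zero.mp this with h | h
    · exact ⟨0, sub_eq_zero.mp h⟩
    · exact ⟨1, sub_eq_zero.mp h⟩
  · intro i
    fin_cases i
    · exact hK
    · exact sub_mem (one_mem _) hK
  · rw [Matrix.det_vandermonde_fin_two]
    norm_num
    grind
  · intro l hl hlp
    obtain rfl := le_antisymm hl hlp.two_le
    refine ⟨2, fun f hf0 hf F _ _ _ hF a w ha hw ↦ ?_, Or.inl (by norm_num)⟩
    obtain rfl : f = 1 := by omega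
    rw [pow_one] at hF
    exact sq_add_self_add_one_ne_zero_of_card_eq_prime hlp (by decide) hF w hw

theorem aeval_quartic {R : Type*} [CommRing R] (c : R) :
    aeval c (X ^ 4 - C 4 * X ^ 2 + C 2 : ℤ[X]) = c ^ 4 - 4 * c ^ 2 + 2 := by
  simp only [map_add, map_sub, map_mul, map_pow, aeval_X, map_ofNat]

theorem quartic_eq_zero_two_mul_cos :
    (2 * (Real.cos (π / 8) : ℂ)) ^ 4 - 4 * (2 * (Real.cos (π / 8) : ℂ)) ^ 2 + 2 = 0 := by
  have h2 := ofReal_sqrt_two_sq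
  have h1 : (Real.cos (π / 4) : ℂ) = 2 * (Real.cos (π / 8) : ℂ) ^ 2 - 1 := by
    rw [show π / 4 = 2 * (π / 8) by ring, Real.cos_two_mul]
    push_cast
    ring
  rw [Real.cos_pi_div_four] at h1
  push_cast at h1 ⊢
  linear_combination h2 - (4 * (2 * Complex.cos (π / 8) ^ 2 - 1) + 2 * √2) * h1

theorem false_of_quartic_of_card_eq_three_pow {F : Type*} [Field F] [Finite F] [CharP F 3] {f : ℕ}
    (hf0 : 0 < f) (hf : f < 4) (hF : Nat.card F = 3 ^ f) (a : F)
    (ha : a ^ 4 - 4 * a ^ 2 + 2 = 0) : False := by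
  have h3 : (3 : F) = 0 := by exact_mod_cast CharP.cast_eq_zero F 3
  have ha0 : a ≠ 0 := by
    rintro rfl
    exact one_ne_zero (α := F) (by linear_combination h3 - ha)
  have h8 : a ^ 8 = -1 := by grind
  have hpow := FiniteField.pow_natCard a
  rw [hF] at hpow
  interval_cases f
  · norm_num at hpow
    grind
  · norm_num at hpow
    grind
  · norm_num at hpow
    grind

theorem false_of_quartic_of_card_eq_five_pow {F : Type*} [Field F] [Finite F] [CharP F 5] {f : ℕ}
    (hf0 : 0 < f) (hf : f < 3) (hF : Nat.card F = 5 ^ f) (a : F)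
    (ha : a ^ 4 - 4 * a ^ 2 + 2 = 0) : False := by
  have h5 : (5 : F) = 0 := by exact_mod_cast CharP.cast_eq_zero F 5
  have hpow := FiniteField.pow_natCard a
  rw [hF] at hpow
  interval_cases f
  · norm_num at hpow
    grind
  · norm_num at hpow
    grind

theorem card_classGroup_adjoin_two_mul_cos_omega :
    Nat.card (ClassGroup (𝓞 (IntermediateField.adjoin ℚ
      {(2 * (Real.cos (π / 8) : ℂ)), omega}))) = 1 := by
  have hR := quartic_eq_zero_two_mul_cos
  have hω := omega_sq_add_self_add_one
  have hθ : (Complex.exp (2 * π * I / (16 : ℕ))) ^ 2 =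
      2 * (Real.cos (π / 8) : ℂ) * Complex.exp (2 * π * I / (16 : ℕ)) + -1 := by
    have h1 : Complex.exp (2 * π * I / (16 : ℕ)) = Complex.exp ((π / 8 : ℝ) * I) := by
      congr 1
      push_cast
      ring
    have h2 : Complex.exp (2 * π * I / (16 : ℕ)) * Complex.exp (-(π / 8 : ℝ) * I) = 1 := by
      rw [h1, ← Complex.exp_add]
      simp
    have h3 := Complex.two_cos ((π / 8 : ℝ) : ℂ)
    rw [← h1, ← Complex.ofReal_cos] at h3
    linear_combination -Complex.exp (2 * π * I / (16 : ℕ)) * h3 - h2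
  set R : ℂ := 2 * (Real.cos (π / 8) : ℂ) with hRdef
  have hK : R ∈ IntermediateField.adjoin ℚ {R, omega} :=
    IntermediateField.subset_adjoin _ _ (by simp)
  have hS : R ^ 3 - 3 * R ∈ IntermediateField.adjoin ℚ {R, omega} :=
    sub_mem (pow_mem hK 3) (mul_mem (ofNat_mem _ 3) hK)
  refine card_classGroup_adjoin_omega_eq_one (p := X ^ 4 - C 4 * X ^ 2 + C 2)
    (r := ![R, -R, R ^ 3 - 3 * R, -(R ^ 3 - 3 * R)])
    (N := 16) (z := Complex.exp (2 * π * I / (16 : ℕ))) (θ := Complex.exp (2 * π * I / (16 : ℕ)))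
    (u := R) (v := -1) (D := 18432) (B := 116)
    (by monicity!) (by rw [aeval_quartic, hR]) ?_ ?_ (by decide +kernel) (by norm_num)
    (by norm_num) (Complex.isPrimitiveRoot_exp 16 (by norm_num)) hK (neg_mem (one_mem _)) hθ
    (IntermediateField.mem_adjoin_simple_self _ _) (by norm_num) ?_ (by norm_num [Nat.factorial]) ?_
  · intro c hc
    rw [aeval_quartic] at hc
    have : (c - R) * (c - -R) * (c - (R ^ 3 - 3 * R)) * (c - -(R ^ 3 - 3 * R)) = 0 := by
      grind
    simp only [mul_eq_zero, sub_eq_zero] at this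
    rcases this with ((h | h) | h) | h
    · exact ⟨0, h⟩
    · exact ⟨1, h⟩
    · exact ⟨2, h⟩
    · exact ⟨3, h⟩
  · intro i
    fin_cases i
    · exact hK
    · exact neg_mem hK
    · exact hS
    · exact neg_mem hS
  · have : (Matrix.vandermonde ![R, -R, R ^ 3 - 3 * R, -(R ^ 3 - 3 * R)]).det ^ 2 = 2048 := by
      rw [Matrix.det_vandermonde_fin_four]
      grind
    rw [show 4 = 2 * 2 by rfl, pow_mul, this]
    norm_num
  · intro l hl hlp
    have key : ∀ l ≤ 116, l.Prime → l ∈ [2, 3, 5, 7, 31, 79, 97] ∨ 116 < l ^ 2 ∧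
        ((∀ n < l, (n ^ 2 + n + 1) % l ≠ 0) ∨ ∀ n < l, (n ^ 4 + 2) % l ≠ 4 * n ^ 2 % l) := by
      decide +kernel
    rcases key l hl hlp with h | ⟨h1, h2⟩
    · simp only [List.mem_cons, List.not_mem_nil, or_false] at h
      rcases h with rfl | rfl | rfl | rfl | rfl | rfl | rfl
      · refine ⟨2, fun f hf0 hf F _ _ _ hF a w ha hw ↦ ?_, Or.inr ⟨by norm_num, .X 0, ?_⟩⟩
        · obtain rfl : f = 1 := by omega
          rw [pow_one] at hF
          exact sq_add_self_add_one_ne_zero_of_card_eq_prime hlp (by decide) hF w hw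
        · simp [Fin.prod_univ_four]
          grind
      · refine ⟨4, fun f hf0 hf F _ _ _ hF a w ha hw ↦ ?_, Or.inr ⟨by norm_num, 2 * .X 1 + 1, ?_⟩⟩
        · exact false_of_quartic_of_card_eq_three_pow hf0 hf hF a (aeval_quartic a ▸ ha)
        · simp
          grind
      · refine ⟨3, fun f hf0 hf F _ _ _ hF a w ha hw ↦ ?_, Or.inl (by norm_num)⟩
        exact false_of_quartic_of_card_eq_five_pow hf0 hf hF a (aeval_quartic a ▸ ha)
      · refine ⟨2, fun f hf0 hf F _ _ _ hF a w ha hw ↦ ?_,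
          Or.inr ⟨by norm_num, 1 + .X 0 ^ 2 * .X 1, ?_⟩⟩
        · obtain rfl : f = 1 := by omega
          rw [pow_one] at hF
          exact quartic_ne_zero_of_card_eq_prime hlp (by decide) hF a (aeval_quartic a ▸ ha)
        · simp [Fin.prod_univ_four]
          grind
      · refine ⟨1, by omega, Or.inr ⟨by norm_num, 1 + .X 0 * .X 1, ?_⟩⟩
        simp [Fin.prod_univ_four]
        grind
      · refine ⟨1, by omega, Or.inr ⟨by norm_num, 1 - .X 1 + .X 0, ?_⟩⟩
        simp [Fin.prod_univ_four]
        grind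
      · refine ⟨1, by omega, Or.inr ⟨by norm_num, 1 + .X 0 + .X 0 ^ 2 * .X 1, ?_⟩⟩
        simp [Fin.prod_univ_four]
        grind
    · refine ⟨2, fun f hf0 hf F _ _ _ hF a w ha hw ↦ ?_, Or.inl h1⟩
      obtain rfl : f = 1 := by omega
      rw [pow_one] at hF
      rcases h2 with h2 | h2
      · exact sq_add_self_add_one_ne_zero_of_card_eq_prime hlp h2 hF w hw
      · exact quartic_ne_zero_of_card_eq_prime hlp h2 hF a (aeval_quartic a ▸ ha)

theorem zeta5_pow_im_ne_zero {k : ℕ} (hk : ¬ 5 ∣ k) : (zeta5 ^ k).im ≠ 0 := by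
  intro h
  obtain ⟨x, hx⟩ := Complex.conj_eq_iff_real.mp (Complex.conj_eq_iff_im.mpr h)
  have h5 : (zeta5 ^ k) ^ 5 = 1 := by
    rw [← pow_mul, mul_comm, pow_mul, isPrimitiveRoot_five.pow_eq_one, one_pow]
  have hx5 : x ^ 5 = 1 := by
    rw [hx] at h5
    exact_mod_cast h5
  have hx1 : x = 1 := (Odd.strictMono_pow (by decide)).injective (hx5.trans (one_pow 5).symm)
  rw [hx1, Complex.ofReal_one] at hx
  exact hk (isPrimitiveRoot_five.dvd_of_pow_eq_one k hx)

theorem aeval_cyclotomic_five {R : Type*} [CommRing R] (c : R) :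
    aeval c (X ^ 4 + X ^ 3 + X ^ 2 + X + 1 : ℤ[X]) = c ^ 4 + c ^ 3 + c ^ 2 + c + 1 := by
  simp only [map_add, map_pow, aeval_X, map_one]

theorem card_classGroup_adjoin_sqrt_two_zeta5 :
    Nat.card (ClassGroup (𝓞 (IntermediateField.adjoin ℚ {(√2 : ℂ), zeta5}))) = 1 := by
  have h2 := ofReal_sqrt_two_sq
  have hζ := cyclotomic_five_zeta5
  have hK : (√2 : ℂ) ∈ IntermediateField.adjoin ℚ {(√2 : ℂ), zeta5} :=
    IntermediateField.subset_adjoin _ _ (by simp)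
  have hζK : zeta5 ∈ IntermediateField.adjoin ℚ {(√2 : ℂ), zeta5} :=
    IntermediateField.subset_adjoin _ _ (by simp)
  have hr : (Matrix.vandermonde ![(√2 : ℂ), -√2]).det ^ 8 = 4096 := by
    rw [Matrix.det_vandermonde_fin_two]
    grind
  have hs : (Matrix.vandermonde ![zeta5, zeta5 ^ 2, zeta5 ^ 3, zeta5 ^ 4]).det ^ 2 = 125 := by
    rw [Matrix.det_vandermonde_fin_four]
    grind
  refine card_classGroup_adjoin_pair_eq_one (p := X ^ 2 - C 2)
    (q := X ^ 4 + X ^ 3 + X ^ 2 + X + 1) (r := ![(√2 : ℂ), -√2])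
    (s := ![zeta5, zeta5 ^ 2, zeta5 ^ 3, zeta5 ^ 4]) (N := 8 * 5) (h := 4)
    (z := (1 + I) * (√2 / 2) * zeta5) (θ := I) (u := 0) (v := -1) (D := 8000) (B := 50)
    (by monicity!) (by monicity!) (by rw [aeval_sq_sub_two, h2, sub_self])
    (by rw [aeval_cyclotomic_five, hζ]) exists_eq_of_aeval_sq_sub_two ?_ ?_ ?_ ?_
    (by decide +kernel) (by norm_num)
    (isPrimitiveRoot_eight.mul_of_coprime isPrimitiveRoot_five (by norm_num)) (zero_mem _)
    (neg_mem (one_mem _)) (by simp) (mul_mem (one_add_I_mul_mem_adjoin_I hK)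
      (IntermediateField.algebraMap_mem _
      (⟨zeta5, hζK⟩ : IntermediateField.adjoin ℚ {(√2 : ℂ), zeta5}))) (by norm_num) (by norm_num)
    ?_ (by norm_num [Nat.factorial]) ?_
  · intro c hc
    rw [aeval_cyclotomic_five] at hc
    have : (c - zeta5) * (c - zeta5 ^ 2) * (c - zeta5 ^ 3) * (c - zeta5 ^ 4) = 0 := by
      grind
    simp only [mul_eq_zero, sub_eq_zero] at this
    rcases this with ((h | h) | h) | h
    · exact ⟨0, h⟩
    · exact ⟨1, h⟩
    · exact ⟨2, h⟩
    · exact ⟨3, h⟩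
  · intro i
    fin_cases i
    · exact hK
    · exact neg_mem hK
  · intro j
    fin_cases j
    · exact hζK
    · exact pow_mem hζK 2
    · exact pow_mem hζK 3
    · exact pow_mem hζK 4
  · intro j
    fin_cases j
    · simpa using zeta5_pow_im_ne_zero (k := 1) (by norm_num)
    · exact zeta5_pow_im_ne_zero (by norm_num)
    · exact zeta5_pow_im_ne_zero (by norm_num)
    · exact zeta5_pow_im_ne_zero (by norm_num)
  · rw [mul_pow, ← pow_mul, ← pow_mul, mul_comm 2 2, pow_mul _ 2 2, hr, hs]
    norm_num
  · intro l hl hlp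
    have key : ∀ l ≤ 50, l.Prime → l ∈ [2, 3, 5, 7, 31, 41] ∨ 50 < l ^ 2 ∧
        ((¬ l ∣ 5 ∧ l % 5 ≠ 1) ∨ ∀ n < l, n ^ 2 % l ≠ 2 % l) := by
      decide +kernel
    rcases key l hl hlp with h | ⟨h1, h3⟩
    · simp only [List.mem_cons, List.not_mem_nil, or_false] at h
      rcases h with rfl | rfl | rfl | rfl | rfl | rfl
      · refine ⟨4, fun f hf0 hf F _ _ _ hF a w ha hw ↦ ?_, Or.inr ⟨by norm_num, .X 0, ?_⟩⟩
        · exact cyclotomic_five_ne_zero_of_card (by norm_num : ¬ 2 ∣ 5)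
            (by rw [hF]; interval_cases f <;> norm_num) w (aeval_cyclotomic_five w ▸ hw)
        · simp
          grind
      · refine ⟨4, fun f hf0 hf F _ _ _ hF a w ha hw ↦ ?_, Or.inl (by norm_num)⟩
        exact cyclotomic_five_ne_zero_of_card (by norm_num : ¬ 3 ∣ 5)
          (by rw [hF]; interval_cases f <;> norm_num) w (aeval_cyclotomic_five w ▸ hw)
      · refine ⟨2, fun f hf0 hf F _ _ _ hF a w ha hw ↦ ?_, Or.inr ⟨by norm_num, 1 - .X 1, ?_⟩⟩
        · obtain rfl : f = 1 := by omega
          rw [pow_one] at hF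
          exact sq_ne_two_of_card_eq_prime hlp (by decide) hF a
            (sub_eq_zero.mp (aeval_sq_sub_two a ▸ ha))
        · simp [Fin.prod_univ_four]
          grind
      · refine ⟨3, fun f hf0 hf F _ _ _ hF a w ha hw ↦ ?_, Or.inl (by norm_num)⟩
        exact cyclotomic_five_ne_zero_of_card (by norm_num : ¬ 7 ∣ 5)
          (by rw [hF]; interval_cases f <;> norm_num) w (aeval_cyclotomic_five w ▸ hw)
      · refine ⟨1, by omega, Or.inr ⟨by norm_num, 1 + .X 0 * .X 1, ?_⟩⟩
        simp [Fin.prod_univ_four]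
        grind
      · refine ⟨1, by omega, Or.inr ⟨by norm_num, 1 + .X 1 + .X 0, ?_⟩⟩
        simp [Fin.prod_univ_four]
        grind
    · refine ⟨2, fun f hf0 hf F _ _ _ hF a w ha hw ↦ ?_, Or.inl h1⟩
      obtain rfl : f = 1 := by omega
      rw [pow_one] at hF
      rcases h3 with ⟨h3, h4⟩ | h3
      · exact cyclotomic_five_ne_zero_of_card h3 (hF ▸ h4) w (aeval_cyclotomic_five w ▸ hw)
      · exact sq_ne_two_of_card_eq_prime hlp h3 hF a (sub_eq_zero.mp (aeval_sq_sub_two a ▸ ha))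

end Fields

theorem class_number_one_of_five_CM_fields :
    Nat.card (ClassGroup
      (𝓞 (IntermediateField.adjoin ℚ {(Real.sqrt 2 : ℂ), Complex.I * Real.sqrt 3}))) = 1 ∧
    Nat.card (ClassGroup (𝓞 (ℚ⟮zeta5⟯))) = 1 ∧
    Nat.card (ClassGroup
      (𝓞 (IntermediateField.adjoin ℚ {(Real.sqrt 5 : ℂ), Complex.I * Real.sqrt 3}))) = 1 ∧
    Nat.card (ClassGroup
      (𝓞 (IntermediateField.adjoin ℚ
        {(Real.cos (Real.pi / 8) : ℂ), Complex.I * Real.sqrt 3}))) = 1 ∧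
    Nat.card (ClassGroup
      (𝓞 (IntermediateField.adjoin ℚ {(Real.sqrt 2 : ℂ), zeta5}))) = 1 := by
  have hω : omega = ((1 / 2 : ℚ) : ℂ) * (Complex.I * √3) + ((-1 / 2 : ℚ) : ℂ) := by
    rw [omega]
    push_cast
    ring
  refine ⟨?_, card_classGroup_adjoin_zeta5, ?_, ?_, card_classGroup_adjoin_sqrt_two_zeta5⟩
  · rw [adjoin_pair_eq_of_affine (a := √2) (c := √2) (k := 1) (l := 0) (by norm_num)
      (by norm_num) (by simp) hω]
    exact card_classGroup_adjoin_sqrt_two_omega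
  · rw [adjoin_pair_eq_of_affine (a := √5) (c := (1 + √5) / 2) (k := 1 / 2) (l := 1 / 2)
      (by norm_num) (by norm_num) (by push_cast; ring) hω]
    exact card_classGroup_adjoin_golden_omega
  · rw [adjoin_pair_eq_of_affine (a := Real.cos (π / 8)) (c := 2 * Real.cos (π / 8)) (k := 2)
      (l := 0) (by norm_num) (by norm_num) (by simp) hω]
    exact card_classGroup_adjoin_two_mul_cos_omega
end

section
/- In SL₂(ℤ), let A = [[1,2],[0,1]] and B = [[1,0],[2,1]], and let Γ(2) denote the principal congruence subgroup of level 2 (the kernel of the reduction map SL₂(ℤ) → SL₂(ℤ/2ℤ)). Then the image in PSL₂(ℤ) = SL₂(ℤ)/{±I} of the subgroup generated by A and B equals the image of Γ(2) in PSL₂(ℤ). Equivalently, Γ(2) is generated by A, B, and −I. -/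
set_option synthInstance.maxHeartbeats 400000

/-!
Statement 8: in PSL₂(ℤ), the image of the subgroup of SL₂(ℤ) generated by
A = [[1,2],[0,1]] and B = [[1,0],[2,1]] equals the image of the principal
congruence subgroup Γ(2); equivalently, Γ(2) is generated by A, B and −I.
-/

open Matrix MatrixGroups CongruenceSubgroup

instance : Fact (Even (Fintype.card (Fin 2))) := ⟨⟨1, rfl⟩⟩

/-- A = [[1,2],[0,1]] in SL₂(ℤ). -/
def Amat : SL(2, ℤ) := ⟨!![1, 2; 0, 1], by norm_num [Matrix.det_fin_two_of]⟩

/-- B = [[1,0],[2,1]] in SL₂(ℤ). -/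
def Bmat : SL(2, ℤ) := ⟨!![1, 0; 2, 1], by norm_num [Matrix.det_fin_two_of]⟩

/-- The projection SL₂(ℤ) → PSL₂(ℤ) = SL₂(ℤ)/{±I}. -/
def toPSL : SL(2, ℤ) →* SL(2, ℤ) ⧸ Subgroup.center SL(2, ℤ) :=
  QuotientGroup.mk' (Subgroup.center SL(2, ℤ))

lemma Amat_mem_Gamma_two : Amat ∈ Gamma 2 := by
  rw [Gamma_mem]
  simp [Amat]
  decide

lemma Bmat_mem_Gamma_two : Bmat ∈ Gamma 2 := by
  rw [Gamma_mem]
  simp [Bmat]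
  decide

lemma neg_one_mem_Gamma_two : (-1 : SL(2, ℤ)) ∈ Gamma 2 := by
  rw [Gamma_mem]
  simp

lemma Amat_eq_T_sq : Amat = ModularGroup.T ^ (2 : ℤ) := by
  ext i j
  rw [ModularGroup.coe_T_zpow]
  fin_cases i <;> fin_cases j <;> rfl

lemma Amat_mul_apply_zero (g : SL(2, ℤ)) : (Amat * g) 0 0 = g 0 0 + 2 * g 1 0 := by
  rw [Matrix.SpecialLinearGroup.coe_mul, Matrix.mul_apply, Fin.sum_univ_two]
  simp [Amat]

lemma Amat_mul_apply_one (g : SL(2, ℤ)) : (Amat * g) 1 0 = g 1 0 := by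
  rw [Matrix.SpecialLinearGroup.coe_mul, Matrix.mul_apply, Fin.sum_univ_two]
  simp [Amat]

lemma Bmat_mul_apply_zero (g : SL(2, ℤ)) : (Bmat * g) 0 0 = g 0 0 := by
  rw [Matrix.SpecialLinearGroup.coe_mul, Matrix.mul_apply, Fin.sum_univ_two]
  simp [Bmat]

lemma Bmat_mul_apply_one (g : SL(2, ℤ)) : (Bmat * g) 1 0 = 2 * g 0 0 + g 1 0 := by
  rw [Matrix.SpecialLinearGroup.coe_mul, Matrix.mul_apply, Fin.sum_univ_two]
  simp [Bmat]

lemma Amat_inv_mul_apply_zero (g : SL(2, ℤ)) :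
    (Amat⁻¹ * g) 0 0 = g 0 0 - 2 * g 1 0 := by
  have h₀ := Amat_mul_apply_zero (Amat⁻¹ * g)
  have h₁ := Amat_mul_apply_one (Amat⁻¹ * g)
  rw [mul_inv_cancel_left] at h₀ h₁
  linarith

lemma Amat_inv_mul_apply_one (g : SL(2, ℤ)) : (Amat⁻¹ * g) 1 0 = g 1 0 := by
  have h := Amat_mul_apply_one (Amat⁻¹ * g)
  rw [mul_inv_cancel_left] at h
  exact h.symm

lemma Bmat_inv_mul_apply_zero (g : SL(2, ℤ)) : (Bmat⁻¹ * g) 0 0 = g 0 0 := by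
  have h := Bmat_mul_apply_zero (Bmat⁻¹ * g)
  rw [mul_inv_cancel_left] at h
  exact h.symm

lemma Bmat_inv_mul_apply_one (g : SL(2, ℤ)) :
    (Bmat⁻¹ * g) 1 0 = g 1 0 - 2 * g 0 0 := by
  have h₀ := Bmat_mul_apply_zero (Bmat⁻¹ * g)
  have h₁ := Bmat_mul_apply_one (Bmat⁻¹ * g)
  rw [mul_inv_cancel_left] at h₀ h₁
  linarith

lemma even_odd_of_mem_Gamma_two {g : SL(2, ℤ)} (hg : g ∈ Gamma 2) :
    Odd (g 0 0) ∧ Even (g 0 1) ∧ Even (g 1 0) := by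
  obtain ⟨ha, hb, hc, -⟩ := Gamma_mem.1 hg
  exact ⟨(ZMod.intCast_eq_one_iff_odd).1 ha, (ZMod.intCast_eq_zero_iff_even).1 hb,
    (ZMod.intCast_eq_zero_iff_even).1 hc⟩

/-- An upper triangular element of Γ(2) is `±A ^ k`. -/
lemma mem_of_mem_Gamma_two_of_apply_eq_zero {K : Subgroup SL(2, ℤ)} (hA : Amat ∈ K)
    (hneg : -1 ∈ K) {g : SL(2, ℤ)} (hg : g ∈ Gamma 2) (hc : g 1 0 = 0) : g ∈ K := by
  obtain ⟨k, hk⟩ := (even_odd_of_mem_Gamma_two hg).2.1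
  have hdet : g 0 0 * g 1 1 = 1 := by
    have := g.det_coe
    rw [Matrix.det_fin_two, hc] at this
    linarith
  have hpow (n : ℤ) : ((Amat ^ n : SL(2, ℤ)) : Matrix (Fin 2) (Fin 2) ℤ) =
      !![1, 2 * n; 0, 1] := by
    rw [Amat_eq_T_sq, ← _root_.zpow_mul, ModularGroup.coe_T_zpow]
  rcases Int.mul_eq_one_iff_eq_one_or_neg_one.1 hdet with ⟨ha, hd⟩ | ⟨ha, hd⟩
  · have : g = Amat ^ k := by
      ext i j
      rw [hpow]
      fin_cases i <;> fin_cases j <;> simp [ha, hc, hd, hk, two_mul]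
    exact this ▸ K.zpow_mem hA k
  · have : g = -1 * Amat ^ (-k) := by
      ext i j
      rw [neg_one_mul, Matrix.SpecialLinearGroup.coe_neg, hpow]
      fin_cases i <;> fin_cases j <;> simp [ha, hc, hd, hk, two_mul]
    exact this ▸ K.mul_mem hneg (K.zpow_mem hA _)

/-- Euclidean descent on the first column. -/
lemma Gamma_two_le {K : Subgroup SL(2, ℤ)} (hA : Amat ∈ K) (hB : Bmat ∈ K) (hneg : -1 ∈ K) :
    Gamma 2 ≤ K := by
  intro g hg
  induction hn : (g 0 0).natAbs + (g 1 0).natAbs using Nat.strong_induction_on generalizing g with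
  | _ n ih =>
    obtain ⟨⟨x, hx⟩, -, ⟨y, hy⟩⟩ := even_odd_of_mem_Gamma_two hg
    by_cases hc : g 1 0 = 0
    · exact mem_of_mem_Gamma_two_of_apply_eq_zero hA hneg hg hc
    have descend {h : SL(2, ℤ)} (hK : h ∈ K) (hΓ : h ∈ Gamma 2)
        (hlt : ((h * g) 0 0).natAbs + ((h * g) 1 0).natAbs < n) : g ∈ K :=
      (K.mul_mem_cancel_left hK).1 (ih _ hlt (mul_mem hΓ hg) rfl)
    have hA' := Amat_mem_Gamma_two
    have hB' := Bmat_mem_Gamma_two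
    have hsign : 0 < g 0 0 ∧ 0 < g 1 0 ∨ g 0 0 < 0 ∧ g 1 0 < 0 ∨
        0 < g 0 0 ∧ g 1 0 < 0 ∨ g 0 0 < 0 ∧ 0 < g 1 0 := by omega
    rcases lt_or_ge (g 1 0).natAbs (g 0 0).natAbs with hlt | hge
    · rcases or_assoc.2 hsign with hs | hs
      · refine descend (inv_mem hA) (inv_mem hA') ?_
        rw [Amat_inv_mul_apply_zero, Amat_inv_mul_apply_one]
        omega
      · refine descend hA hA' ?_
        rw [Amat_mul_apply_zero, Amat_mul_apply_one]
        omega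
    · rcases or_assoc.2 hsign with hs | hs
      · refine descend (inv_mem hB) (inv_mem hB') ?_
        rw [Bmat_inv_mul_apply_zero, Bmat_inv_mul_apply_one]
        omega
      · refine descend hB hB' ?_
        rw [Bmat_mul_apply_zero, Bmat_mul_apply_one]
        omega

lemma closure_Amat_Bmat_neg_one : Subgroup.closure {Amat, Bmat, -1} = Gamma 2 := by
  refine le_antisymm ((Subgroup.closure_le _).2 ?_) (Gamma_two_le ?_ ?_ ?_)
  · rintro _ (rfl | rfl | rfl)
    exacts [Amat_mem_Gamma_two, Bmat_mem_Gamma_two, neg_one_mem_Gamma_two]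
  all_goals exact Subgroup.subset_closure (by simp)

lemma toPSL_neg_one : toPSL (-1) = 1 := by
  refine (QuotientGroup.eq_one_iff _).2 (Subgroup.mem_center_iff.2 fun g => ?_)
  rw [mul_neg_one, neg_one_mul]

theorem gamma_two_generated_by_A_B :
    Subgroup.map toPSL (Subgroup.closure {Amat, Bmat}) =
      Subgroup.map toPSL (Gamma 2) ∧
    Subgroup.closure {Amat, Bmat, -1} = Gamma 2 := by
  refine ⟨le_antisymm (Subgroup.map_mono ?_) ?_, closure_Amat_Bmat_neg_one⟩
  · rw [Subgroup.closure_le]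
    rintro _ (rfl | rfl)
    exacts [Amat_mem_Gamma_two, Bmat_mem_Gamma_two]
  · rw [Subgroup.map_le_iff_le_comap]
    refine Gamma_two_le ?_ ?_ ?_
    · exact Subgroup.mem_map_of_mem _ (Subgroup.subset_closure (by simp))
    · exact Subgroup.mem_map_of_mem _ (Subgroup.subset_closure (by simp))
    · rw [Subgroup.mem_comap, toPSL_neg_one]
      exact one_mem _
end

section
/- The biquadratic CM field ℚ(√5, √−7), generated inside ℂ by √5 and i√7, has class number 1. -/
set_option synthInstance.maxHeartbeats 400000

/-!
Statement 16: the biquadratic CM field ℚ(√5, √−7) has class number 1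
(the class number being the cardinality of the ideal class group).
-/

open IntermediateField NumberField

/-- The discriminant of a number field is bounded by the discriminant of any `ℚ`-basis consisting
of algebraic integers. -/
theorem abs_discr_le_of_integral_basis {K ι : Type*} [Field K] [NumberField K] [Fintype ι]
    [DecidableEq ι] (b : Module.Basis ι ℚ K) (hb : ∀ i, IsIntegral ℤ (b i)) {d : ℤ}
    (hd : Algebra.discr ℚ b = d) : |discr K| ≤ |d| := by
  let e : Module.Free.ChooseBasisIndex ℤ (𝓞 K) ≃ ι := (integralBasis K).indexEquiv b
  let B : Module.Basis ι ℚ K := (integralBasis K).reindex e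
  let P : Matrix ι ι ℤ := fun i j =>
    (RingOfIntegers.basis K).repr (⟨b j, hb j⟩ : 𝓞 K) (e.symm i)
  have hP : B.toMatrix b = P.map (Int.castRingHom ℚ) := by
    ext i j
    have := integralBasis_repr_apply K (⟨b j, hb j⟩ : 𝓞 K) (e.symm i)
    rw [Module.Basis.toMatrix_apply, Module.Basis.repr_reindex_apply]
    exact this
  have hB : Algebra.discr ℚ B = discr K := by
    rw [coe_discr, ← Algebra.discr_reindex ℚ (integralBasis K) e, Module.Basis.coe_reindex]
  have h := Algebra.discr_of_matrix_vecMul (A := ℚ) B (B.toMatrix b)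
  rw [Module.Basis.toMatrix_map_vecMul, hd, hB, hP] at h
  have hdet : (P.map (Int.castRingHom ℚ)).det = (P.det : ℚ) := ((Int.castRingHom ℚ).map_det P).symm
  rw [hdet] at h
  have h' : d = P.det ^ 2 * discr K := by exact_mod_cast h
  have hd0 : d ≠ 0 := by
    rintro rfl
    exact Algebra.discr_not_zero_of_basis ℚ b (by simpa using hd)
  exact Int.le_of_dvd (abs_pos.mpr hd0) ((abs_dvd_abs _ _).mpr ⟨_, h'.trans (mul_comm _ _)⟩)

section Biquadratic

variable {K : Type*} [Field K] [NumberField K] {φ α : K}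

theorem leftMulMatrix_phi (b : Module.Basis (Fin 4) ℚ K) (hb : ⇑b = ![1, φ, α, φ * α])
    (hφ : φ ^ 2 = φ + 1) :
    Algebra.leftMulMatrix b φ = !![0, 1, 0, 0; 1, 1, 0, 0; 0, 0, 0, 1; 0, 0, 1, 1] := by
  refine (Matrix.toLin b b).injective (b.ext fun i => ?_)
  rw [Algebra.leftMulMatrix_apply, Matrix.toLin_toMatrix, Matrix.toLin_self]
  fin_cases i <;> simp [Fin.sum_univ_four, hb]
  · linear_combination hφ
  · linear_combination α * hφ

theorem leftMulMatrix_alpha (b : Module.Basis (Fin 4) ℚ K) (hb : ⇑b = ![1, φ, α, φ * α])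
    (hα : α ^ 2 = α - 2) :
    Algebra.leftMulMatrix b α = !![0, 0, -2, 0; 0, 0, 0, -2; 1, 0, 1, 0; 0, 1, 0, 1] := by
  refine (Matrix.toLin b b).injective (b.ext fun i => ?_)
  rw [Algebra.leftMulMatrix_apply, Matrix.toLin_toMatrix, Matrix.toLin_self]
  fin_cases i <;> simp [Fin.sum_univ_four, hb, Algebra.smul_def]
  · ring
  · linear_combination hα
  · linear_combination φ * hα

theorem norm_alpha (b : Module.Basis (Fin 4) ℚ K) (hb : ⇑b = ![1, φ, α, φ * α])
    (hα : α ^ 2 = α - 2) : Algebra.norm ℚ α = 4 := by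
  rw [Algebra.norm_eq_matrix_det b, leftMulMatrix_alpha b hb hα]
  simp [Matrix.det_succ_row_zero, Fin.sum_univ_succ, Fin.succAbove]
  norm_num

theorem discr_one_phi_alpha (b : Module.Basis (Fin 4) ℚ K) (hb : ⇑b = ![1, φ, α, φ * α])
    (hφ : φ ^ 2 = φ + 1) (hα : α ^ 2 = α - 2) : Algebra.discr ℚ b = 1225 := by
  have h : Algebra.traceMatrix ℚ b =
      !![4, 2, 2, 1; 2, 6, 1, 3; 2, 1, -6, -3; 1, 3, -3, -9] := by
    ext i j
    rw [Algebra.traceMatrix_apply, Algebra.traceForm_apply, Algebra.trace_eq_matrix_trace b,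
      map_mul, hb]
    fin_cases i <;> fin_cases j <;>
      simp [leftMulMatrix_phi b hb hφ, leftMulMatrix_alpha b hb hα, Matrix.trace,
        Fin.sum_univ_four] <;> norm_num
  rw [Algebra.discr_def, h]
  simp [Matrix.det_succ_row_zero, Fin.sum_univ_succ, Fin.succAbove]
  norm_num

/-- The Minkowski bound for a quartic field of discriminant at most `1225`. -/
theorem minkowskiBound_lt_six (hK : Module.finrank ℚ K = 4) (hd : |discr K| ≤ 1225) :
    (4 / Real.pi) ^ InfinitePlace.nrComplexPlaces K *
      ((Module.finrank ℚ K).factorial / (Module.finrank ℚ K) ^ (Module.finrank ℚ K) *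
        √|(discr K : ℝ)|) < 6 := by
  have hr : InfinitePlace.nrComplexPlaces K ≤ 2 := by
    have := InfinitePlace.card_add_two_mul_card_eq_rank K
    omega
  have hpi := Real.pi_gt_d2
  have h1 : 1 ≤ 4 / Real.pi := (one_le_div Real.pi_pos).mpr Real.pi_le_four
  have h2 : 4 / Real.pi ≤ 1.28 := by
    rw [div_le_iff₀ Real.pi_pos]
    linarith
  have h3 : (4 / Real.pi) ^ InfinitePlace.nrComplexPlaces K ≤ 1.28 ^ 2 :=
    (pow_le_pow_right₀ h1 hr).trans (by gcongr)
  have h4 : √|(discr K : ℝ)| ≤ 35 := by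
    rw [Real.sqrt_le_left (by norm_num)]
    have : ((|discr K| : ℤ) : ℝ) ≤ (1225 : ℤ) := by exact_mod_cast hd
    push_cast at this
    linarith
  rw [hK]
  calc _ ≤ (1.28 : ℝ) ^ 2 * ((Nat.factorial 4 : ℕ) / ((4 : ℕ) : ℝ) ^ 4 * 35) := by gcongr
    _ < 6 := by norm_num [Nat.factorial]

end Biquadratic

section DedekindDomain

variable {R : Type*} [CommRing R] [IsDedekindDomain R] [Module.Free ℤ R]

theorem nonempty_zmod_ringEquiv_quotient {P : Ideal R} {p : ℕ} (hp : p.Prime)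
    (hP : Ideal.absNorm P = p) : Nonempty (R ⧸ P ≃+* ZMod p) := by
  have hc : Nat.card (R ⧸ P) = p := by
    rw [← hP, Ideal.absNorm_apply, Submodule.cardQuot_apply]
  have : Finite (R ⧸ P) := Nat.finite_of_card_ne_zero (hc ▸ hp.ne_zero)
  have := Fintype.ofFinite (R ⧸ P)
  exact ⟨(ZMod.ringEquivOfPrime (R ⧸ P) hp (Nat.card_eq_fintype_card.symm.trans hc)).symm⟩

theorem isPrincipal_of_mem_of_absNorm_eq {P : Ideal R} {a : R} (ha : a ∈ P)
    (hP : Ideal.absNorm P ≠ 0) (h : Ideal.absNorm (Ideal.span {a}) = Ideal.absNorm P) :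
    Submodule.IsPrincipal P := by
  obtain ⟨Q, hQ⟩ := Ideal.dvd_iff_le.mpr ((Ideal.span_singleton_le_iff_mem P).mpr ha)
  rw [hQ, map_mul, mul_eq_left₀ hP, Ideal.absNorm_eq_one_iff] at h
  rw [h, Ideal.mul_top] at hQ
  exact ⟨a, hQ.symm⟩

/-- If the polynomials `X ^ 2 - X - 1` and `X ^ 2 - X + 2` both have roots in `R`, a prime of norm
at most `5` has norm `4`. -/
theorem absNorm_eq_four {P : Ideal R} [hPp : P.IsPrime] (hP : Ideal.absNorm P ≠ 0)
    (hP5 : Ideal.absNorm P ≤ 5) {φ α : R} (hφ : φ ^ 2 = φ + 1) (hα : α ^ 2 = α - 2) :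
    Ideal.absNorm P = 4 := by
  have h1 : Ideal.absNorm P ≠ 1 := mt Ideal.absNorm_eq_one_iff.mp hPp.ne_top
  have root {p : ℕ} (hp : p.Prime) (h : Ideal.absNorm P = p) :
      (∃ x : ZMod p, x ^ 2 = x + 1) ∧ ∃ x : ZMod p, x ^ 2 = x - 2 := by
    obtain ⟨e⟩ := nonempty_zmod_ringEquiv_quotient hp h
    let f : R →+* ZMod p := e.toRingHom.comp (Ideal.Quotient.mk P)
    exact ⟨⟨f φ, by simpa using congrArg f hφ⟩,
      ⟨f α, by simpa [map_ofNat f 2] using congrArg f hα⟩⟩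
  have h2 : Ideal.absNorm P ≠ 2 := fun h =>
    absurd (root Nat.prime_two h).1 (by decide)
  have h3 : Ideal.absNorm P ≠ 3 := fun h =>
    absurd (root Nat.prime_three h).1 (by decide)
  have h5 : Ideal.absNorm P ≠ 5 := fun h =>
    absurd (root Nat.prime_five h).2 (by decide)
  omega

end DedekindDomain

theorem isPrincipalIdealRing_of_phi_alpha {K : Type*} [Field K] [NumberField K] {φ α : K}
    (hφ : φ ^ 2 = φ + 1) (hα : α ^ 2 = α - 2)
    (hli : LinearIndependent ℚ ![1, φ, α, φ * α]) (hK : Module.finrank ℚ K ≤ 4) :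
    IsPrincipalIdealRing (𝓞 K) := by
  have hK4 : Module.finrank ℚ K = 4 := le_antisymm hK (by simpa using hli.fintype_card_le_finrank)
  let b := basisOfLinearIndependentOfCardEqFinrank hli (by simp [hK4])
  have hb : ⇑b = ![1, φ, α, φ * α] := coe_basisOfLinearIndependentOfCardEqFinrank hli _
  have hφi : IsIntegral ℤ φ := ⟨.X ^ 2 - .X - 1, by monicity!, by simp [hφ]⟩
  have hαi : IsIntegral ℤ α := ⟨.X ^ 2 - .X + 2, by monicity!, by simp [hα]⟩
  have hd : |discr K| ≤ 1225 := by
    refine abs_discr_le_of_integral_basis b (fun i => ?_) (d := 1225)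
      (by simpa using discr_one_phi_alpha b hb hφ hα)
    rw [hb]
    fin_cases i
    exacts [isIntegral_one, hφi, hαi, hφi.mul hαi]
  let φ' : 𝓞 K := ⟨φ, hφi⟩
  let α' : 𝓞 K := ⟨α, hαi⟩
  have hφ' : φ' ^ 2 = φ' + 1 := RingOfIntegers.ext hφ
  have hα' : α' ^ 2 = α' - 2 := RingOfIntegers.ext hα
  have hN : Algebra.norm ℤ α' = 4 := by
    have := (Algebra.coe_norm_int α').trans (norm_alpha b hb hα)
    exact_mod_cast this
  have hprod : α' * (1 - α') = 2 := by linear_combination -hα'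
  have hN' : Algebra.norm ℤ (1 - α') = 4 := by
    have h := congrArg (Algebra.norm ℤ) hprod
    have h2 := Algebra.norm_algebraMap_of_basis (RingOfIntegers.basis K) (2 : ℤ)
    rw [← Module.finrank_eq_card_basis (RingOfIntegers.basis K), RingOfIntegers.rank, hK4,
      map_ofNat] at h2
    rw [map_mul, hN, h2] at h
    linarith
  refine RingOfIntegers.isPrincipalIdealRing_of_isPrincipal_of_norm_le_of_isPrime
    fun I hI hle => ?_
  have hI0 : Ideal.absNorm (I : Ideal (𝓞 K)) ≠ 0 := Ideal.absNorm_ne_zero_of_nonZeroDivisors I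
  have hI5 : Ideal.absNorm (I : Ideal (𝓞 K)) < 6 := by
    exact_mod_cast hle.trans_lt (minkowskiBound_lt_six hK4 hd)
  have hI4 := absNorm_eq_four hI0 (Nat.lt_succ_iff.mp hI5) hφ' hα'
  have h4 : (2 : 𝓞 K) * 2 ∈ (I : Ideal (𝓞 K)) := by
    have := Ideal.absNorm_mem (I : Ideal (𝓞 K))
    rw [hI4] at this
    convert this using 1
    norm_num
  have h2 : α' * (1 - α') ∈ (I : Ideal (𝓞 K)) :=
    hprod ▸ (hI.mem_or_mem h4).elim id id
  rcases hI.mem_or_mem h2 with h | h <;>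
    exact isPrincipal_of_mem_of_absNorm_eq h hI0
      (by simp [Ideal.absNorm_span_singleton, hN, hN', hI4])

theorem linearIndependent_phi_alpha {L : IntermediateField ℚ ℂ} {φ α : L}
    (hφ : (φ : ℂ) = (1 + √5) / 2) (hα : (α : ℂ) = (1 + Complex.I * √7) / 2) :
    LinearIndependent ℚ ![1, φ, α, φ * α] := by
  have h5 : Irrational √5 := by exact_mod_cast Nat.prime_five.irrational_sqrt
  have h7 : √7 ≠ 0 := by positivity
  have eq_zero {p q : ℚ} (h : (p : ℝ) + q * ((1 + √5) / 2) = 0) : p = 0 ∧ q = 0 := by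
    have hq : q = 0 := by
      by_contra hq
      refine h5 ⟨-2 * p / q - 1, ?_⟩
      have : (q : ℝ) ≠ 0 := by exact_mod_cast hq
      push_cast
      field_simp
      linarith
    subst hq
    simpa using h
  rw [Fintype.linearIndependent_iff]
  intro g hg
  have h := congrArg (algebraMap L ℂ) hg
  simp only [Fin.sum_univ_four, Algebra.smul_def, map_add, map_mul, map_zero,
    ← IsScalarTower.algebraMap_apply ℚ L ℂ] at h
  simp [IntermediateField.algebraMap_apply, hφ, hα] at h
  have hre := congrArg Complex.re h
  have him := congrArg Complex.im h
  simp at hre him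
  have him' : (g 2 : ℝ) + g 3 * ((1 + √5) / 2) = 0 := by
    refine (mul_eq_zero.mp ?_).resolve_right h7
    linear_combination 2 * him
  obtain ⟨h2, h3⟩ := eq_zero him'
  have hre' : (g 0 : ℝ) + g 1 * ((1 + √5) / 2) = 0 := by
    simp [h2, h3] at hre
    linear_combination hre
  obtain ⟨h0, h1⟩ := eq_zero hre'
  intro i
  fin_cases i <;> assumption

theorem finrank_adjoin_pair_le_four {F E : Type*} [Field F] [Field E] [Algebra F E] {x y : E}
    {a c : F} (hx : x ^ 2 = algebraMap F E a) (hy : y ^ 2 = algebraMap F E c) :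
    FiniteDimensional F F⟮x, y⟯ ∧ Module.finrank F F⟮x, y⟯ ≤ 4 := by
  have key {z : E} {d : F} (hz : z ^ 2 = algebraMap F E d) :
      IsIntegral F z ∧ Module.finrank F F⟮z⟯ ≤ 2 := by
    have hmonic : (.X ^ 2 - .C d : Polynomial F).Monic := by monicity!
    have hroot : Polynomial.aeval z (.X ^ 2 - .C d : Polynomial F) = 0 := by simp [hz]
    have hint : IsIntegral F z := ⟨_, hmonic, hroot⟩
    refine ⟨hint, ?_⟩
    rw [IntermediateField.adjoin.finrank hint]
    exact (Polynomial.natDegree_le_of_dvd (minpoly.dvd F z hroot) hmonic.ne_zero).trans_eq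
      (Polynomial.natDegree_X_pow_sub_C)
  obtain ⟨hxi, hx2⟩ := key hx
  obtain ⟨hyi, hy2⟩ := key hy
  have := IntermediateField.adjoin.finiteDimensional hxi
  have := IntermediateField.adjoin.finiteDimensional hyi
  have h : F⟮x, y⟯ = F⟮x⟯ ⊔ F⟮y⟯ := by
    rw [← IntermediateField.adjoin_union, Set.singleton_union]
  rw [h]
  exact ⟨inferInstance, (IntermediateField.finrank_sup_le _ _).trans (Nat.mul_le_mul hx2 hy2)⟩

theorem classNumber_Q_sqrt5_sqrtNeg7 :
    Nat.card (ClassGroup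
      (𝓞 (IntermediateField.adjoin ℚ {(Real.sqrt 5 : ℂ), Complex.I * Real.sqrt 7}))) = 1 := by
  have h5 : ((√5 : ℝ) : ℂ) ^ 2 = 5 := by
    norm_cast
    simp
  have h7 : (Complex.I * (√7 : ℝ)) ^ 2 = -7 := by
    rw [mul_pow, Complex.I_sq]
    norm_cast
    simp
  obtain ⟨hfin, hrank⟩ := finrank_adjoin_pair_le_four (F := ℚ) (a := 5) (c := -7)
    (by rw [h5, map_ofNat]) (by rw [h7, map_neg, map_ofNat])
  set L := IntermediateField.adjoin ℚ {(Real.sqrt 5 : ℂ), Complex.I * Real.sqrt 7}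
  have : NumberField L := { to_charZero := inferInstance, to_finiteDimensional := hfin }
  let x : L := ⟨(√5 : ℝ), subset_adjoin ℚ _ (by simp)⟩
  let y : L := ⟨Complex.I * (√7 : ℝ), subset_adjoin ℚ _ (by simp)⟩
  have h2 : ((2 : L) : ℂ) = 2 := rfl
  have hx : x ^ 2 = 5 := Subtype.ext h5
  have hy : y ^ 2 = -7 := Subtype.ext h7
  have := isPrincipalIdealRing_of_phi_alpha (φ := (1 + x) / 2) (α := (1 + y) / 2)
    (by linear_combination hx / 4) (by linear_combination hy / 4)
    (linearIndependent_phi_alpha (by simp [x, h2]) (by simp [y, h2])) hrank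
  rw [Nat.card_eq_fintype_card]
  exact classNumber_eq_one_iff.mpr this
end

section
/- The imaginary quadratic field ℚ(√−23) has class number 3, and the biquadratic CM field ℚ(√5, √−23), generated inside ℂ by √5 and i√23, also has class number 3. -/
set_option synthInstance.maxHeartbeats 400000

/-!
Statement 17: ℚ(√−23) has class number 3, and the biquadratic CM field
ℚ(√5, √−23) also has class number 3.
-/

open IntermediateField NumberField

open Ideal Module InfinitePlace
open scoped nonZeroDivisors Nat

section IdealIdentities

variable {R : Type*} [CommRing R] {w : R}

lemma span_two_mul_self (hw : w ^ 2 = w - 6) :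
    (span {2, w} * span {2, w} : Ideal R) = span {4, w - 2} := by
  rw [span_pair_mul_span_pair]
  apply le_antisymm
  · simp only [span_le, Set.insert_subset_iff, Set.singleton_subset_iff, SetLike.mem_coe,
      mem_span_pair]
    exact ⟨⟨1, 0, by ring⟩, ⟨1, 2, by ring⟩, ⟨1, 2, by ring⟩,
      ⟨-1, 1, by linear_combination -hw⟩⟩
  · simp only [span_le, Set.insert_subset_iff, Set.singleton_subset_iff, SetLike.mem_coe]
    have h4 : (2 * 2 : R) ∈ span {2 * 2, 2 * w, w * 2, w * w} := subset_span (by simp)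
    refine ⟨by convert! h4 using 1; norm_num, ?_⟩
    have h1 : w * w + 2 * 2 ∈ span {2 * 2, 2 * w, w * 2, w * w} :=
      add_mem (subset_span (by simp)) h4
    convert! h1 using 1
    linear_combination -hw

lemma span_two_pow_three (hw : w ^ 2 = w - 6) :
    (span {2, w} : Ideal R) ^ 3 = span {w - 2} := by
  rw [pow_succ, pow_two, span_two_mul_self hw, span_pair_mul_span_pair]
  apply le_antisymm
  · simp only [span_le, Set.insert_subset_iff, Set.singleton_subset_iff, SetLike.mem_coe,
      mem_span_singleton']
    exact ⟨⟨-1 - w, by linear_combination -hw⟩, ⟨3 - w, by linear_combination -hw⟩,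
      ⟨2, by ring⟩, ⟨w, by ring⟩⟩
  · rw [span_singleton_le_iff_mem]
    have h1 : (w - 2) * 2 + (w - 2) * w + 4 * 2 ∈
        span {4 * 2, 4 * w, (w - 2) * 2, (w - 2) * w} :=
      add_mem (add_mem (subset_span (by simp)) (subset_span (by simp))) (subset_span (by simp))
    convert! h1 using 1
    linear_combination -hw

lemma span_two_mul_span_two (hw : w ^ 2 = w - 6) :
    (span {2, w} * span {2, w - 1} : Ideal R) = span {2} := by
  rw [span_pair_mul_span_pair]
  apply le_antisymm
  · simp only [span_le, Set.insert_subset_iff, Set.singleton_subset_iff, SetLike.mem_coe,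
      mem_span_singleton']
    exact ⟨⟨2, by ring⟩, ⟨w - 1, by ring⟩, ⟨w, by ring⟩, ⟨-3, by linear_combination -hw⟩⟩
  · rw [span_singleton_le_iff_mem]
    have h1 : w * 2 - 2 * (w - 1) ∈ span {2 * 2, 2 * (w - 1), w * 2, w * (w - 1)} :=
      sub_mem (subset_span (by simp)) (subset_span (by simp))
    convert! h1 using 1
    ring

lemma span_three_mul_span_three (hw : w ^ 2 = w - 6) :
    (span {3, w} * span {3, w - 1} : Ideal R) = span {3} := by
  rw [span_pair_mul_span_pair]
  apply le_antisymm
  · simp only [span_le, Set.insert_subset_iff, Set.singleton_subset_iff, SetLike.mem_coe,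
      mem_span_singleton']
    exact ⟨⟨3, by ring⟩, ⟨w - 1, by ring⟩, ⟨w, by ring⟩, ⟨-2, by linear_combination -hw⟩⟩
  · rw [span_singleton_le_iff_mem]
    have h1 : w * 3 - 3 * (w - 1) ∈ span {3 * 3, 3 * (w - 1), w * 3, w * (w - 1)} :=
      sub_mem (subset_span (by simp)) (subset_span (by simp))
    convert! h1 using 1
    ring

lemma span_two_mul_span_three (hw : w ^ 2 = w - 6) :
    (span {2, w} * span {3, w} : Ideal R) = span {w} := by
  rw [span_pair_mul_span_pair]
  apply le_antisymm
  · simp only [span_le, Set.insert_subset_iff, Set.singleton_subset_iff, SetLike.mem_coe,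
      mem_span_singleton']
    exact ⟨⟨1 - w, by linear_combination -hw⟩, ⟨2, by ring⟩, ⟨3, by ring⟩, ⟨w, by ring⟩⟩
  · rw [span_singleton_le_iff_mem]
    have h1 : w * 3 - 2 * w ∈ span {2 * 3, 2 * w, w * 3, w * w} :=
      sub_mem (subset_span (by simp)) (subset_span (by simp))
    convert! h1 using 1
    ring

end IdealIdentities

section Quadratic

variable {F E : Type*} [Field F] [Field E] [Algebra F E]

lemma exists_basis_one_of_finrank_eq_two (h2 : finrank F E = 2) {x : E}
    (hx : x ∉ (algebraMap F E).range) : ∃ b : Basis (Fin 2) F E, ⇑b = ![1, x] := by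
  have hli : LinearIndependent F ![1, x] := by
    rw [LinearIndependent.pair_iff' one_ne_zero]
    intro a ha
    exact hx ⟨a, by rw [← ha, Algebra.smul_def, mul_one]⟩
  exact ⟨basisOfLinearIndependentOfCardEqFinrank hli (by simp [h2]), by simp⟩

lemma trace_norm_of_finrank_eq_two (h2 : finrank F E = 2) {x : E}
    (hx : x ∉ (algebraMap F E).range) {s n : F} (h : x ^ 2 = s • x - n • (1 : E)) :
    Algebra.trace F E x = s ∧ Algebra.norm F x = n := by
  obtain ⟨b, hb⟩ := exists_basis_one_of_finrank_eq_two h2 hx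
  have hb0 : b 0 = 1 := by simp [hb]
  have hb1 : b 1 = x := by simp [hb]
  have hm : Algebra.leftMulMatrix b x = !![0, -n; 1, s] := by
    ext i j
    rw [Algebra.leftMulMatrix_eq_repr_mul]
    fin_cases j
    · have : x * b 0 = b 1 := by rw [hb0, hb1, mul_one]
      fin_cases i <;> simp [this]
    · have : x * b 1 = s • b 1 - n • b 0 := by rw [hb0, hb1, ← sq, h]
      fin_cases i <;> simp [this]
  constructor
  · rw [Algebra.trace_eq_matrix_trace b, hm]; simp [Matrix.trace]
  · rw [Algebra.norm_eq_matrix_det b, hm]; simp [Matrix.det_fin_two]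

lemma trace_of_sq_eq_add_one (h2 : finrank F E = 2) {u : E} (hu : u ^ 2 = u + 1)
    (huF : u ∉ (algebraMap F E).range) : Algebra.trace F E u = 1 :=
  (trace_norm_of_finrank_eq_two h2 huF (s := 1) (n := -1) (by rw [hu]; simp)).1

lemma coe_sq_eq {w : 𝓞 F} (hw : w ^ 2 = w - 6) : (w : F) ^ 2 = w - 6 := by
  have := congrArg (algebraMap (𝓞 F) F) hw
  rwa [map_pow, map_sub, map_ofNat] at this

end Quadratic

section ClassNumberThree

variable {F : Type*} [Field F] [NumberField F]

lemma eq_of_le_of_absNorm_eq {I J : Ideal (𝓞 F)} (h : I ≤ J) (h0 : absNorm I ≠ 0)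
    (hN : absNorm I = absNorm J) : I = J := by
  obtain ⟨Q, rfl⟩ := dvd_iff_le.mpr h
  rw [map_mul] at hN h0
  have hQ : absNorm Q = 1 := by
    apply Nat.eq_of_mul_eq_mul_left (Nat.pos_of_ne_zero (left_ne_zero_of_mul h0))
    rw [hN, mul_one]
  rw [absNorm_eq_one_iff.mp hQ, mul_top]

lemma mk0_mem_of_forall_prime (H : Subgroup (ClassGroup (𝓞 F))) (B : ℝ)
    (hP : ∀ (P : Ideal (𝓞 F)) (hP0 : P ∈ (Ideal (𝓞 F))⁰), P.IsPrime → (absNorm P : ℝ) ≤ B →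
      ClassGroup.mk0 ⟨P, hP0⟩ ∈ H) (I : Ideal (𝓞 F)) :
    ∀ hI : I ∈ (Ideal (𝓞 F))⁰, (absNorm I : ℝ) ≤ B → ClassGroup.mk0 ⟨I, hI⟩ ∈ H := by
  induction I using UniqueFactorizationMonoid.induction_on_prime with
  | h₁ => intro hI; simp at hI
  | h₂ x hx =>
    intro hI _
    rw [isUnit_iff] at hx
    subst hx
    convert H.one_mem
    exact (ClassGroup.mk0_eq_one_iff hI).mpr top_isPrincipal
  | h₃ a p ha hp ih =>
    intro hI hB
    have hp0 : p ∈ (Ideal (𝓞 F))⁰ := mem_nonZeroDivisors_of_ne_zero hp.ne_zero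
    have ha0 : a ∈ (Ideal (𝓞 F))⁰ := mem_nonZeroDivisors_of_ne_zero ha
    have hpos : 0 < absNorm (p * a) := absNorm_pos_iff_mem_nonZeroDivisors.mpr hI
    have hmul : ClassGroup.mk0 ⟨p * a, hI⟩ = ClassGroup.mk0 ⟨p, hp0⟩ * ClassGroup.mk0 ⟨a, ha0⟩ := by
      rw [← map_mul]; rfl
    rw [hmul]
    refine H.mul_mem (hP p hp0 (isPrime_of_prime hp) ?_) (ih ha0 ?_)
    · refine le_trans ?_ hB
      exact_mod_cast Nat.le_of_dvd hpos ⟨absNorm a, map_mul _ _ _⟩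
    · refine le_trans ?_ hB
      exact_mod_cast Nat.le_of_dvd hpos ⟨absNorm p, by rw [mul_comm, map_mul]⟩

lemma nrComplexPlaces_mul_two_le : 2 * nrComplexPlaces F ≤ finrank ℚ F := by
  have := card_add_two_mul_card_eq_rank F
  omega

lemma natCard_classGroup_eq_three {w : 𝓞 F} (hw : w ^ 2 = w - 6) {m : ℕ}
    (hd : finrank ℚ F = 2 * m)
    (h6 : absNorm (span {w}) = 6 ^ m) (h8 : absNorm (span {w - 2}) = 8 ^ m)
    (hnp : ¬ (span {2, w} : Ideal (𝓞 F)).IsPrincipal) (B : ℝ)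
    (hB : ∀ C : ClassGroup (𝓞 F), ∃ I : (Ideal (𝓞 F))⁰, ClassGroup.mk0 I = C ∧
      (absNorm (I : Ideal (𝓞 F)) : ℝ) ≤ B)
    (hP : ∀ P : Ideal (𝓞 F), P.IsPrime → P ≠ ⊥ → (absNorm P : ℝ) ≤ B →
      ∃ p : ℕ, (p = 2 ∨ p = 3) ∧ (p : 𝓞 F) ∈ P ∧ p ^ m ≤ absNorm P) :
    Nat.card (ClassGroup (𝓞 F)) = 3 := by
  have hnat (n : ℕ) : absNorm (span {(n : 𝓞 F)}) = (n ^ m) * n ^ m := by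
    rw [absNorm_span_natCast, RingOfIntegers.rank, hd]; ring
  have n2 : absNorm (span {2, w}) = 2 ^ m := by
    rw [← span_two_pow_three hw, map_pow, show 8 = 2 ^ 3 by norm_num, ← pow_mul, mul_comm,
      pow_mul] at h8
    exact Nat.pow_left_injective (n := 3) (by norm_num) h8
  have n3 : absNorm (span {3, w}) = 3 ^ m := by
    rw [← span_two_mul_span_three hw, map_mul, n2, show 6 = 2 * 3 by norm_num, mul_pow] at h6
    exact Nat.eq_of_mul_eq_mul_left (by positivity) h6
  have n2' : absNorm (span {2, w - 1}) = 2 ^ m := by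
    have := hnat 2
    rw [Nat.cast_ofNat, ← span_two_mul_span_two hw, map_mul, n2] at this
    exact Nat.eq_of_mul_eq_mul_left (by positivity) this
  have n3' : absNorm (span {3, w - 1}) = 3 ^ m := by
    have := hnat 3
    rw [Nat.cast_ofNat, ← span_three_mul_span_three hw, map_mul, n3] at this
    exact Nat.eq_of_mul_eq_mul_left (by positivity) this
  have mem0 {p : ℕ} (hp : p ≠ 0) (x : 𝓞 F) : (span {(p : 𝓞 F), x}) ∈ (Ideal (𝓞 F))⁰ := by
    apply mem_nonZeroDivisors_of_ne_zero
    intro h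
    have : (p : 𝓞 F) ∈ span {(p : 𝓞 F), x} := subset_span (by simp)
    rw [h] at this
    simp [hp] at this
  have m2 := mem0 two_ne_zero w
  have m2' := mem0 two_ne_zero (w - 1)
  have m3 := mem0 three_ne_zero w
  have m3' := mem0 three_ne_zero (w - 1)
  push_cast at m2 m2' m3 m3'
  set c := ClassGroup.mk0 ⟨_, m2⟩ with hc
  have hprod {I J : Ideal (𝓞 F)} (hI : I ∈ (Ideal (𝓞 F))⁰) (hJ : J ∈ (Ideal (𝓞 F))⁰) {x : 𝓞 F}
      (h : I * J = span {x}) : ClassGroup.mk0 ⟨I, hI⟩ * ClassGroup.mk0 ⟨J, hJ⟩ = 1 := by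
    rw [← map_mul]
    refine (ClassGroup.mk0_eq_one_iff (mul_mem hI hJ)).mpr ?_
    rw [h]
    exact ⟨x, rfl⟩
  have c2' := hprod m2 m2' (span_two_mul_span_two hw)
  have c3 := hprod m2 m3 (span_two_mul_span_three hw)
  have c3' := hprod m3 m3' (span_three_mul_span_three hw)
  rw [← hc] at c2' c3
  have hc3 : c ^ 3 = 1 := by
    rw [hc, ← map_pow]
    refine (ClassGroup.mk0_eq_one_iff (pow_mem m2 3)).mpr ?_
    rw [span_two_pow_three hw]
    exact ⟨_, rfl⟩
  have hc1 : c ≠ 1 := fun h ↦ hnp ((ClassGroup.mk0_eq_one_iff m2).mp h)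
  have htop : Subgroup.zpowers c = ⊤ := by
    rw [eq_top_iff]
    rintro C -
    obtain ⟨I, rfl, hI⟩ := hB C
    refine mk0_mem_of_forall_prime _ B (fun P hP0 hprime hPB ↦ ?_) I.1 I.2 hI
    have hcm := Subgroup.mem_zpowers c
    obtain ⟨p, hp, hpP, hle⟩ := hP P hprime (nonZeroDivisors.ne_zero hP0) hPB
    have hwP : w ∈ P ∨ w - 1 ∈ P := by
      apply hprime.mem_or_mem
      have : w * (w - 1) = -6 := by linear_combination hw
      rw [this]
      rcases hp with rfl | rfl
      · convert P.mul_mem_left (-3) hpP using 1; norm_num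
      · convert P.mul_mem_left (-2) hpP using 1; norm_num
    have heq {x : 𝓞 F} (hx : x ∈ P) (hN : absNorm (span {(p : 𝓞 F), x}) = p ^ m) :
        span {(p : 𝓞 F), x} = P := by
      have hsub : span {(p : 𝓞 F), x} ≤ P := by
        simp [span_le, Set.insert_subset_iff, hpP, hx]
      have hp0 : p ^ m ≠ 0 := pow_ne_zero _ (by omega)
      refine eq_of_le_of_absNorm_eq hsub (hN ▸ hp0) (le_antisymm (hN ▸ hle) ?_)
      exact Nat.le_of_dvd (Nat.pos_of_ne_zero (hN ▸ hp0)) (absNorm_dvd_absNorm_of_le hsub)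
    rcases hp with rfl | rfl <;> rcases hwP with hx | hx <;> push_cast at heq
    · obtain rfl := heq hx n2
      exact hcm
    · obtain rfl := heq hx n2'
      rw [eq_inv_of_mul_eq_one_right c2']
      exact inv_mem hcm
    · obtain rfl := heq hx n3
      rw [eq_inv_of_mul_eq_one_right c3]
      exact inv_mem hcm
    · obtain rfl := heq hx n3'
      rw [eq_inv_of_mul_eq_one_right c3', eq_inv_of_mul_eq_one_right c3, inv_inv]
      exact hcm
  rw [← Subgroup.card_top, ← htop, Nat.card_zpowers]
  exact orderOf_eq_prime hc3 hc1

lemma abs_discr_le_abs_discr {ι : Type*} [Fintype ι] [DecidableEq ι] (b : ι → 𝓞 F)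
    (hcard : Fintype.card ι = finrank ℚ F) (hb : Algebra.discr ℤ b ≠ 0) :
    |discr F| ≤ |Algebra.discr ℤ b| := by
  let B : Basis ι ℤ (𝓞 F) := (RingOfIntegers.basis F).reindex
    (Fintype.equivOfCardEq (by rw [hcard, ← finrank_eq_card_chooseBasisIndex, RingOfIntegers.rank]))
  have h := Algebra.discr_of_matrix_vecMul (A := ℤ) B (B.toMatrix b)
  have hv : Matrix.vecMul (⇑B) ((B.toMatrix b).map (algebraMap ℤ (𝓞 F))) = b := by
    ext j
    rw [← B.sum_toMatrix_smul_self b j]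
    simp [Matrix.vecMul, dotProduct, mul_comm]
  rw [hv, discr_eq_discr] at h
  rw [h, abs_mul]
  apply le_mul_of_one_le_left (abs_nonneg _)
  by_contra! hlt
  have h0 := Int.abs_lt_one_iff.mp hlt
  rw [h0, zero_mul] at h
  exact hb h

end ClassNumberThree

section Imaginary

variable {K L : Type*} [Field K] [NumberField K] [Field L] [NumberField L] [Algebra K L]

lemma exists_prime_pow_eq_absNorm (P : Ideal (𝓞 L)) (hP : P.IsPrime) (h0 : P ≠ ⊥) :
    ∃ p k : ℕ, p.Prime ∧ k ≠ 0 ∧ absNorm P = p ^ k ∧ (p : 𝓞 L) ∈ P := by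
  have : P.IsMaximal := hP.isMaximal h0
  let := Ideal.Quotient.field P
  have : Finite (𝓞 L ⧸ P) := (absNorm_ne_zero_iff P).mp (by simpa [absNorm_eq_zero_iff] using h0)
  have := Fintype.ofFinite (𝓞 L ⧸ P)
  obtain ⟨p, k, hp, hk, h⟩ := FiniteField.isPrimePow_card (𝓞 L ⧸ P)
  have hN : absNorm P = p ^ k := by
    rw [h, absNorm_apply, Submodule.cardQuot_apply, Nat.card_eq_fintype_card]
  refine ⟨p, k, hp.nat_prime, hk.ne', hN, hP.mem_of_pow_mem k ?_⟩
  have := absNorm_mem P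
  rw [hN] at this
  exact_mod_cast this

lemma exists_roots_zmod_of_absNorm_eq_prime {P : Ideal (𝓞 L)} {p : ℕ} (hp : p.Prime)
    (hN : absNorm P = p) {w u : 𝓞 L} (hw : w ^ 2 = w - 6) (hu : u ^ 2 = u + 1) :
    ∃ a b : ZMod p, a ^ 2 = a - 6 ∧ b ^ 2 = b + 1 := by
  have : Finite (𝓞 L ⧸ P) := (absNorm_ne_zero_iff P).mp (hN ▸ hp.ne_zero)
  have := Fintype.ofFinite (𝓞 L ⧸ P)
  have hcard : Fintype.card (𝓞 L ⧸ P) = p := by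
    rw [← hN, absNorm_apply, Submodule.cardQuot_apply, Nat.card_eq_fintype_card]
  let f : 𝓞 L →+* ZMod p :=
    (ZMod.ringEquivOfPrime (𝓞 L ⧸ P) hp hcard).symm.toRingHom.comp (Ideal.Quotient.mk P)
  exact ⟨f w, f u, by rw [← map_pow, hw, map_sub, map_ofNat],
    by rw [← map_pow, hu, map_add, map_one]⟩

lemma notMem_range_of_sq_eq_sub_six {w : K} (hw : w ^ 2 = w - 6) :
    w ∉ (algebraMap ℚ K).range := by
  rintro ⟨q, rfl⟩
  have : q ^ 2 = q - 6 := by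
    apply (algebraMap ℚ K).injective
    rw [map_pow, hw, map_sub, map_ofNat]
  nlinarith [sq_nonneg (q - 1)]

lemma trace_norm_of_sq_eq_sub_six (hK : finrank ℚ K = 2) {w : K} (hw : w ^ 2 = w - 6) :
    Algebra.trace ℚ K w = 1 ∧ Algebra.norm ℚ w = 6 :=
  trace_norm_of_finrank_eq_two hK (notMem_range_of_sq_eq_sub_six hw)
    (by rw [hw, one_smul, ofNat_smul_eq_nsmul, nsmul_one, Nat.cast_ofNat])

lemma norm_sub_two_of_sq_eq_sub_six (hK : finrank ℚ K = 2) {w : K} (hw : w ^ 2 = w - 6) :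
    Algebra.norm ℚ (w - 2) = 8 := by
  refine (trace_norm_of_finrank_eq_two hK (s := -3) ?_ ?_).2
  · intro h
    apply notMem_range_of_sq_eq_sub_six hw
    convert add_mem h (ofNat_mem _ 2) using 1
    ring
  · simp only [neg_smul, ofNat_smul_eq_nsmul, nsmul_eq_mul]
    push_cast
    linear_combination hw

lemma absNorm_span_of_norm_eq {x : 𝓞 K} {n : ℕ} (h : Algebra.norm ℚ (x : K) = n) :
    absNorm (span {x}) = n := by
  rw [absNorm_span_singleton]
  have : Algebra.norm ℤ x = n := by
    have := Algebra.coe_norm_int x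
    rw [h] at this
    exact_mod_cast this
  rw [this, Int.natAbs_natCast]

lemma absNorm_span_eq_six (hK : finrank ℚ K = 2) {w : 𝓞 K} (hw : w ^ 2 = w - 6) :
    absNorm (span {w}) = 6 :=
  absNorm_span_of_norm_eq (trace_norm_of_sq_eq_sub_six hK (coe_sq_eq hw)).2

lemma absNorm_span_sub_two_eq_eight (hK : finrank ℚ K = 2) {w : 𝓞 K} (hw : w ^ 2 = w - 6) :
    absNorm (span {w - 2}) = 8 := by
  apply absNorm_span_of_norm_eq
  change Algebra.norm ℚ (algebraMap (𝓞 K) K (w - 2)) = _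
  rw [map_sub, map_ofNat]
  exact_mod_cast norm_sub_two_of_sq_eq_sub_six hK (coe_sq_eq hw)

lemma not_isPrincipal_span_two (hK : finrank ℚ K = 2) {w : 𝓞 K} (hw : w ^ 2 = w - 6) :
    ¬ (span {2, w} : Ideal (𝓞 K)).IsPrincipal := by
  rintro ⟨x, hx⟩
  have hN : (Algebra.norm ℤ x).natAbs = 2 := by
    have h8 := absNorm_span_sub_two_eq_eight hK hw
    rw [← span_two_pow_three hw, hx, map_pow, submodule_span_eq, absNorm_span_singleton,
      show 8 = 2 ^ 3 by norm_num] at h8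
    exact Nat.pow_left_injective (n := 3) (by norm_num) h8
  have hwK := coe_sq_eq hw
  obtain ⟨B, hB⟩ := exists_basis_one_of_finrank_eq_two hK (notMem_range_of_sq_eq_sub_six hwK)
  obtain ⟨a, b, hab⟩ : ∃ a b : ℚ, (x : K) = a + b * w := by
    refine ⟨B.repr x 0, B.repr x 1, ?_⟩
    conv_lhs => rw [← B.sum_repr x]
    simp [hB, Algebra.smul_def]
  have hnorm : (Algebra.norm ℤ x : ℚ) = Algebra.norm ℚ (x : K) := Algebra.coe_norm_int x
  by_cases hb : b = 0
  · have hxa : (x : K) = algebraMap ℚ K a := by rw [hab, hb]; simp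
    rw [hxa, Algebra.norm_algebraMap, hK] at hnorm
    have h2 : Algebra.norm ℤ x = 2 := by
      have : (0 : ℚ) ≤ Algebra.norm ℤ x := by rw [hnorm]; positivity
      have : 0 ≤ Algebra.norm ℤ x := by exact_mod_cast this
      omega
    rw [h2] at hnorm
    have : IsSquare ((2 : ℕ) : ℚ) := ⟨a, by rw [← sq, ← hnorm]; norm_num⟩
    rw [Rat.isSquare_natCast_iff] at this
    norm_num at this
  · have hxr : (x : K) ∉ (algebraMap ℚ K).range := by
      rintro ⟨q, hq⟩
      refine notMem_range_of_sq_eq_sub_six hwK ⟨(q - a) / b, ?_⟩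
      have hb' : (b : K) ≠ 0 := by exact_mod_cast hb
      rw [← hq] at hab
      simp only [map_div₀, map_sub, eq_ratCast] at hab ⊢
      field_simp
      linear_combination hab
    obtain ⟨htr, hno⟩ := trace_norm_of_finrank_eq_two hK hxr (s := 2 * a + b)
      (n := a ^ 2 + a * b + 6 * b ^ 2) (by
        simp only [Algebra.smul_def, eq_ratCast, hab]
        push_cast
        linear_combination (b : K) ^ 2 * hwK)
    have htrace : (Algebra.trace ℤ (𝓞 K) x : ℚ) = Algebra.trace ℚ K (x : K) :=
      Algebra.coe_trace_int x
    rw [hno] at hnorm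
    rw [htr] at htrace
    set t := Algebra.trace ℤ (𝓞 K) x
    have h2 : Algebra.norm ℤ x = 2 := by
      have : (0 : ℚ) ≤ Algebra.norm ℤ x := by
        rw [hnorm]; nlinarith [sq_nonneg (2 * a + b), sq_nonneg b]
      have : 0 ≤ Algebra.norm ℤ x := by exact_mod_cast this
      omega
    rw [h2] at hnorm
    push_cast at hnorm
    have key : (t : ℚ) ^ 2 + 23 * b ^ 2 = 8 := by
      rw [htrace]; linear_combination (-4) * hnorm
    have ht8 : t ^ 2 ≤ 8 := by
      have : (t : ℚ) ^ 2 ≤ 8 := by nlinarith [sq_nonneg b]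
      exact_mod_cast this
    have hsq : IsSquare ((23 * (8 - t ^ 2) : ℤ) : ℚ) :=
      ⟨23 * b, by push_cast; linear_combination (-23) * key⟩
    rw [Rat.isSquare_intCast_iff] at hsq
    have hlo : -2 ≤ t := by nlinarith
    have hhi : t ≤ 2 := by nlinarith
    clear_value t
    interval_cases t <;> norm_num at hsq

lemma abs_discr_le_twentythree (hK : finrank ℚ K = 2) {w : 𝓞 K} (hw : w ^ 2 = w - 6) :
    |discr K| ≤ 23 := by
  have htr (x : 𝓞 K) :
      (Algebra.trace ℤ (𝓞 K) x : ℚ) = Algebra.trace ℚ K (algebraMap (𝓞 K) K x) :=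
    Algebra.coe_trace_int x
  have h1 : Algebra.trace ℤ (𝓞 K) 1 = 2 := by
    have := htr 1
    rw [map_one (algebraMap (𝓞 K) K), ← map_one (algebraMap ℚ K), Algebra.trace_algebraMap,
      hK, nsmul_one] at this
    exact_mod_cast this
  have hw1 : Algebra.trace ℤ (𝓞 K) w = 1 := by
    have := htr w
    rw [(trace_norm_of_sq_eq_sub_six hK (coe_sq_eq hw)).1] at this
    exact_mod_cast this
  have hd : Algebra.discr ℤ ![1, w] = -23 := by
    rw [Algebra.discr_def, Matrix.det_fin_two]
    have hww : Algebra.trace ℤ (𝓞 K) (w * w) = -11 := by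
      rw [← sq, hw, show w - 6 = w - (6 : ℤ) • 1 by simp, map_sub, map_smul, h1, hw1]; norm_num
    simp [Algebra.traceMatrix_apply, Algebra.traceForm_apply, h1, hw1, hww]
  refine (abs_discr_le_abs_discr ![1, w] (by simp [hK]) (by rw [hd]; norm_num)).trans ?_
  rw [hd]; norm_num

open Real in
lemma minkowskiBound_le {m : ℕ} (hF : finrank ℚ K = 2 * m) :
    (4 / π) ^ nrComplexPlaces K * ((finrank ℚ K)! / (finrank ℚ K) ^ (finrank ℚ K) * √|discr K|) ≤
    (4 / 3.14) ^ m * ((2 * m)! / (2 * m : ℝ) ^ (2 * m) * √|discr K|) := by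
  have hr : nrComplexPlaces K ≤ m := by
    have := nrComplexPlaces_mul_two_le (F := K)
    omega
  rw [hF]
  push_cast
  gcongr ?_ * _
  calc (4 / π) ^ nrComplexPlaces K ≤ (4 / π) ^ m :=
        pow_le_pow_right₀ ((one_le_div pi_pos).mpr pi_le_four) hr
    _ ≤ _ := by gcongr; exact pi_gt_d2.le

theorem natCard_classGroup_of_finrank_eq_two (hK : finrank ℚ K = 2) {w : 𝓞 K}
    (hw : w ^ 2 = w - 6) : Nat.card (ClassGroup (𝓞 K)) = 3 := by
  refine natCard_classGroup_eq_three hw (m := 1) hK (absNorm_span_eq_six hK hw)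
    (absNorm_span_sub_two_eq_eight hK hw) (not_isPrincipal_span_two hK hw) _
    exists_ideal_in_class_of_norm_le ?_
  intro P hP h0 hN
  have hlt : (absNorm P : ℝ) < 4 := by
    refine (hN.trans (minkowskiBound_le (m := 1) hK)).trans_lt ?_
    have hs : √(|discr K| : ℝ) ≤ 4.8 := by
      rw [Real.sqrt_le_left (by norm_num)]
      have : ((|discr K| : ℤ) : ℝ) ≤ (23 : ℤ) := by
        exact_mod_cast abs_discr_le_twentythree hK hw
      push_cast at this
      linarith
    norm_num [Nat.factorial]
    linarith
  have hlt' : absNorm P < 4 := by exact_mod_cast hlt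
  obtain ⟨p, k, hp, hk, hpk, hpP⟩ := exists_prime_pow_eq_absNorm P hP h0
  have hle : p ≤ p ^ k := Nat.le_self_pow hk p
  refine ⟨p, ?_, hpP, by rw [pow_one, hpk]; exact hle⟩
  have := hp.two_le
  omega

lemma not_isPrincipal_map_span_two (hK : finrank ℚ K = 2) (hKL : finrank K L = 2) {w : 𝓞 K}
    (hw : w ^ 2 = w - 6) :
    ¬ ((span {2, w} : Ideal (𝓞 K)).map (algebraMap (𝓞 K) (𝓞 L))).IsPrincipal := by
  rintro ⟨x, hx⟩
  have hfin : finrank (𝓞 K) (𝓞 L) = 2 := by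
    rw [← hKL, IsFractionRing.finrank_eq (𝓞 K) K (𝓞 L) L]
  have h := relNorm_algebraMap (𝓞 L) (span {2, w})
  rw [hfin, hx, submodule_span_eq, relNorm_singleton] at h
  apply not_isPrincipal_span_two hK hw
  set I : Ideal (𝓞 K) := span {2, w}
  set y := Algebra.intNorm (𝓞 K) (𝓞 L) x
  -- `I ^ 3` and `I ^ 2` are principal, hence so is `I`.
  have h3 : span {y} * I = span {w - 2} := by
    rw [h, ← pow_succ]; exact span_two_pow_three hw
  have hy : y ≠ 0 := by
    intro hy
    rw [hy, span_singleton_zero, bot_mul, eq_comm, span_singleton_eq_bot, sub_eq_zero] at h3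
    rw [h3] at hw
    have : (2 : 𝓞 K) * 4 = 0 := by linear_combination hw
    norm_num at this
  obtain ⟨z, hz, hyz⟩ := mem_span_singleton_mul.mp
    (h3 ▸ mem_span_singleton_self (w - 2) : w - 2 ∈ span {y} * I)
  refine ⟨z, ?_⟩
  rw [← hyz, ← span_singleton_mul_span_singleton] at h3
  exact (span_singleton_mul_right_inj hy).mp h3

lemma abs_discr_le_of_sq_eq_add_one (hK : finrank ℚ K = 2) (hKL : finrank K L = 2) {w : 𝓞 K}
    (hw : w ^ 2 = w - 6) {u : 𝓞 L} (hu : u ^ 2 = u + 1)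
    (huK : (u : L) ∉ (algebraMap K L).range) : |discr L| ≤ 115 ^ 2 := by
  set v := algebraMap (𝓞 K) (𝓞 L) w with hv
  have hv2 : v ^ 2 = v - 6 := by rw [hv, ← map_pow, hw, map_sub, map_ofNat]
  have htu := trace_of_sq_eq_add_one hKL
    (by have := congrArg (algebraMap (𝓞 L) L) hu
        rwa [map_pow, map_add, map_one] at this) huK
  have htw := (trace_norm_of_sq_eq_sub_six hK (coe_sq_eq hw)).1
  have htr (x : 𝓞 L) : (Algebra.trace ℤ (𝓞 L) x : ℚ) =
      Algebra.trace ℚ K (Algebra.trace K L (algebraMap (𝓞 L) L x)) := by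
    rw [Algebra.trace_trace]
    exact Algebra.coe_trace_int x
  have hvL : algebraMap (𝓞 L) L v = algebraMap K L (w : K) := rfl
  have hone : Algebra.trace ℚ K 1 = 2 := by
    rw [← map_one (algebraMap ℚ K), Algebra.trace_algebraMap, hK, nsmul_one, Nat.cast_ofNat]
  have t1 : Algebra.trace ℤ (𝓞 L) 1 = 4 := by
    have := htr 1
    rw [map_one (algebraMap (𝓞 L) L), ← map_one (algebraMap K L),
      Algebra.trace_algebraMap, hKL, map_nsmul, hone] at this
    norm_num at this
    exact_mod_cast this
  have tv : Algebra.trace ℤ (𝓞 L) v = 2 := by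
    have := htr v
    rw [hvL, Algebra.trace_algebraMap, hKL, map_nsmul, htw]
      at this
    norm_num at this
    exact_mod_cast this
  have tu : Algebra.trace ℤ (𝓞 L) u = 2 := by
    have := htr u
    rw [htu, hone] at this
    exact_mod_cast this
  have tvu : Algebra.trace ℤ (𝓞 L) (v * u) = 1 := by
    have := htr (v * u)
    rw [map_mul (algebraMap (𝓞 L) L), hvL, ← Algebra.smul_def (w : K), map_smul (Algebra.trace K L),
      htu, smul_eq_mul, mul_one, htw] at this
    exact_mod_cast this
  have lin {x : 𝓞 L} {a b c d : ℤ} (hx : x = a • 1 + b • v + c • u + d • (v * u)) :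
      Algebra.trace ℤ (𝓞 L) x = 4 * a + 2 * b + 2 * c + d := by
    rw [hx]
    simp only [map_add, map_smul, t1, tv, tu, tvu, smul_eq_mul]
    ring
  have hd : Algebra.discr ℤ ![1, v, u, v * u] = 115 ^ 2 := by
    have hm : Algebra.traceMatrix ℤ ![1, v, u, v * u] =
        !![4, 2, 2, 1; 2, -22, 1, -11; 2, 1, 6, 3; 1, -11, 3, -33] := by
      ext i j
      rw [Algebra.traceMatrix_apply, Algebra.traceForm_apply]
      have e1 : Algebra.trace ℤ (𝓞 L) (v * v) = -22 :=
        lin (a := -6) (b := 1) (c := 0) (d := 0) (by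
          simp only [zsmul_eq_mul]; push_cast; linear_combination hv2)
      have e2 : Algebra.trace ℤ (𝓞 L) (u * u) = 6 :=
        lin (a := 1) (b := 0) (c := 1) (d := 0) (by
          simp only [zsmul_eq_mul]; push_cast; linear_combination hu)
      have e3 : Algebra.trace ℤ (𝓞 L) (v * (v * u)) = -11 :=
        lin (a := 0) (b := 0) (c := -6) (d := 1) (by
          simp only [zsmul_eq_mul]; push_cast; linear_combination u * hv2)
      have e4 : Algebra.trace ℤ (𝓞 L) (u * (v * u)) = 3 :=
        lin (a := 0) (b := 1) (c := 0) (d := 1) (by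
          simp only [zsmul_eq_mul]; push_cast; linear_combination v * hu)
      have e5 : Algebra.trace ℤ (𝓞 L) (v * u * (v * u)) = -33 :=
        lin (a := -6) (b := 1) (c := -6) (d := 1) (by
          simp only [zsmul_eq_mul]; push_cast
          linear_combination u ^ 2 * hv2 + (v - 6) * hu)
      fin_cases i <;> fin_cases j <;>
        simp [t1, tv, tu, tvu, e1, e2, e3, e4, e5, mul_comm u v, mul_comm (v * u) v,
          mul_comm (v * u) u]
    rw [Algebra.discr_def, hm]
    simp [Matrix.det_succ_row_zero, Fin.sum_univ_succ, Fin.succAbove]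
  refine (abs_discr_le_abs_discr ![1, v, u, v * u] ?_ (by rw [hd]; norm_num)).trans ?_
  · rw [← finrank_mul_finrank ℚ K L, hK, hKL, Fintype.card_fin]
  · rw [hd]; norm_num

theorem natCard_classGroup_of_finrank_eq_two_of_finrank_eq_two (hK : finrank ℚ K = 2)
    (hKL : finrank K L = 2) {w : 𝓞 K} (hw : w ^ 2 = w - 6) {u : 𝓞 L} (hu : u ^ 2 = u + 1)
    (huK : (u : L) ∉ (algebraMap K L).range) : Nat.card (ClassGroup (𝓞 L)) = 3 := by
  have hfin : finrank (𝓞 K) (𝓞 L) = 2 := by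
    rw [← hKL, IsFractionRing.finrank_eq (𝓞 K) K (𝓞 L) L]
  have hL : finrank ℚ L = 2 * 2 := by rw [← finrank_mul_finrank ℚ K L, hK, hKL]
  set v := algebraMap (𝓞 K) (𝓞 L) w with hv
  have hv2 : v ^ 2 = v - 6 := by rw [hv, ← map_pow, hw, map_sub, map_ofNat]
  have hmap (I : Ideal (𝓞 K)) :
      absNorm (I.map (algebraMap (𝓞 K) (𝓞 L))) = absNorm I ^ 2 := by
    rw [absNorm_algebraMap, hfin]
  refine natCard_classGroup_eq_three hv2 hL ?_ ?_ ?_ _ exists_ideal_in_class_of_norm_le ?_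
  · rw [← absNorm_span_eq_six hK hw, ← hmap, map_span, Set.image_singleton]
  · rw [← absNorm_span_sub_two_eq_eight hK hw, ← hmap, map_span, Set.image_singleton, map_sub,
      map_ofNat]
  · have := not_isPrincipal_map_span_two hK hKL hw
    rwa [map_span, Set.image_pair, map_ofNat] at this
  intro P hP h0 hN
  have hlt : (absNorm P : ℝ) < 18 := by
    refine (hN.trans (minkowskiBound_le (m := 2) hL)).trans_lt ?_
    have hs : √(|discr L| : ℝ) ≤ 115 := by
      rw [Real.sqrt_le_left (by norm_num)]
      exact_mod_cast abs_discr_le_of_sq_eq_add_one hK hKL hw hu huK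
    norm_num [Nat.factorial]
    linarith
  have hlt' : absNorm P < 18 := by exact_mod_cast hlt
  obtain ⟨p, k, hp, hk, hpk, hpP⟩ := exists_prime_pow_eq_absNorm P hP h0
  have hk1 : k ≠ 1 := by
    rintro rfl
    rw [pow_one] at hpk
    obtain ⟨a, b, ha, hb⟩ := exists_roots_zmod_of_absNorm_eq_prime hp hpk hv2 hu
    rw [hpk] at hlt'
    clear hpk hpP
    interval_cases p <;> first | (revert a b; decide) | (revert hp; norm_num)
  have hle : p ^ 2 ≤ p ^ k := Nat.pow_le_pow_right hp.pos (by omega)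
  refine ⟨p, ?_, hpP, hpk ▸ hle⟩
  have := hp.two_le
  have : p < 5 := by nlinarith
  interval_cases p <;> simp_all +decide

end Imaginary

lemma finrank_adjoin_simple_eq_two {k A : Type*} [Field k] [Field A] [Algebra k A] {x : A} (c : k)
    (hx : x ^ 2 = algebraMap k A c) (hk : x ∉ (algebraMap k A).range) : finrank k k⟮x⟯ = 2 := by
  have hmon : (Polynomial.X ^ 2 - Polynomial.C c).Monic :=
    Polynomial.monic_X_pow_sub_C c two_ne_zero
  have hint : IsIntegral k x := ⟨_, hmon, by simp [hx]⟩
  rw [adjoin.finrank hint]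
  apply le_antisymm
  · rw [← Polynomial.natDegree_X_pow_sub_C (n := 2) (r := c)]
    exact Polynomial.natDegree_le_of_dvd (minpoly.dvd k x (by simp [hx])) hmon.ne_zero
  · exact (minpoly.two_le_natDegree_iff hint).mpr hk

lemma exists_ringOfIntegers_sq_eq_add {F : Type*} [Field F] [CharZero F] {x : F} (c : ℤ)
    (hx : x ^ 2 = 1 + 4 * c) : ∃ w : 𝓞 F, w ^ 2 = w + c ∧ (w : F) = (1 + x) / 2 := by
  have h : ((1 + x) / 2) ^ 2 = (1 + x) / 2 + c := by linear_combination hx / 4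
  have hint : IsIntegral ℤ ((1 + x) / 2) := by
    refine ⟨Polynomial.X ^ 2 - (Polynomial.X + Polynomial.C c), ?_, ?_⟩
    · apply Polynomial.monic_X_pow_sub
      rw [Polynomial.degree_X_add_C]
      exact_mod_cast one_lt_two
    · rw [Polynomial.eval₂_sub, Polynomial.eval₂_add, Polynomial.eval₂_pow, Polynomial.eval₂_X,
        Polynomial.eval₂_C, h, algebraMap_int_eq, eq_intCast, sub_self]
  obtain ⟨w, hw⟩ : ∃ w : 𝓞 F, (w : F) = (1 + x) / 2 := ⟨⟨_, hint⟩, rfl⟩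
  refine ⟨w, RingOfIntegers.coe_injective ?_, hw⟩
  rw [map_pow, map_add, map_intCast]
  change (w : F) ^ 2 = (w : F) + c
  rw [hw, h]

section Complex

open Complex

lemma I_mul_sqrt_sq : (I * Real.sqrt 23 : ℂ) ^ 2 = algebraMap ℚ ℂ (-23) := by
  rw [mul_pow, I_sq, ← ofReal_pow, Real.sq_sqrt (by norm_num)]
  norm_num

lemma sqrt_five_sq : (Real.sqrt 5 : ℂ) ^ 2 = 5 := by
  rw [← ofReal_pow, Real.sq_sqrt (by norm_num)]
  norm_num

lemma I_mul_sqrt_notMem_range : (I * Real.sqrt 23 : ℂ) ∉ (algebraMap ℚ ℂ).range := by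
  rintro ⟨q, hq⟩
  have h := congrArg Complex.im hq
  simp only [eq_ratCast, ratCast_im, mul_im, I_re, I_im, ofReal_re, ofReal_im, zero_mul, one_mul,
    zero_add] at h
  exact (Real.sqrt_pos.mpr (by norm_num)).ne h

lemma finrank_adjoin_I_mul_sqrt : finrank ℚ ℚ⟮(I * Real.sqrt 23 : ℂ)⟯ = 2 :=
  finrank_adjoin_simple_eq_two (-23) I_mul_sqrt_sq I_mul_sqrt_notMem_range

instance : NumberField ℚ⟮(I * Real.sqrt 23 : ℂ)⟯ where
  to_finiteDimensional := FiniteDimensional.of_finrank_pos (by simp [finrank_adjoin_I_mul_sqrt])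

lemma gen_I_mul_sqrt_sq : (AdjoinSimple.gen ℚ (I * Real.sqrt 23 : ℂ)) ^ 2 = -23 := by
  apply (algebraMap _ ℂ).injective
  rw [map_pow, map_neg, map_ofNat, AdjoinSimple.algebraMap_gen, I_mul_sqrt_sq]
  norm_num

lemma sqrt_five_notMem_range :
    (Real.sqrt 5 : ℂ) ∉ (algebraMap ℚ⟮(I * Real.sqrt 23 : ℂ)⟯ ℂ).range := by
  rintro ⟨y, hy⟩
  obtain ⟨B, hB⟩ := exists_basis_one_of_finrank_eq_two finrank_adjoin_I_mul_sqrt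
    (x := AdjoinSimple.gen ℚ (I * Real.sqrt 23 : ℂ)) (by
      rintro ⟨q, hq⟩
      exact I_mul_sqrt_notMem_range ⟨q, congrArg (algebraMap _ ℂ) hq⟩)
  obtain ⟨a, b, hab⟩ : ∃ a b : ℚ, (Real.sqrt 5 : ℂ) = a + b * (I * Real.sqrt 23) := by
    refine ⟨B.repr y 0, B.repr y 1, ?_⟩
    rw [← hy]
    conv_lhs => rw [← B.sum_repr y]
    simp [hB, Algebra.smul_def]
  have hre := congrArg Complex.re hab
  simp at hre
  have hirr : Irrational (Real.sqrt 5) := by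
    exact_mod_cast Nat.Prime.irrational_sqrt (p := 5) (by norm_num)
  exact hirr ⟨a, hre.symm⟩

lemma finrank_adjoin_sqrt_five :
    finrank ℚ⟮(I * Real.sqrt 23 : ℂ)⟯ ℚ⟮(I * Real.sqrt 23 : ℂ)⟯⟮(Real.sqrt 5 : ℂ)⟯ = 2 :=
  finrank_adjoin_simple_eq_two 5 (by rw [sqrt_five_sq, map_ofNat]) sqrt_five_notMem_range

instance : NumberField ℚ⟮(I * Real.sqrt 23 : ℂ)⟯⟮(Real.sqrt 5 : ℂ)⟯ where
  to_finiteDimensional := by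
    have : FiniteDimensional ℚ⟮(I * Real.sqrt 23 : ℂ)⟯
        ℚ⟮(I * Real.sqrt 23 : ℂ)⟯⟮(Real.sqrt 5 : ℂ)⟯ :=
      FiniteDimensional.of_finrank_pos (by simp [finrank_adjoin_sqrt_five])
    exact Module.Finite.trans ℚ⟮(I * Real.sqrt 23 : ℂ)⟯ _

lemma restrictScalars_adjoin_sqrt_five :
    (ℚ⟮(I * Real.sqrt 23 : ℂ)⟯⟮(Real.sqrt 5 : ℂ)⟯).restrictScalars ℚ =
      IntermediateField.adjoin ℚ {(Real.sqrt 5 : ℂ), I * Real.sqrt 23} := by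
  refine (adjoin_adjoin_left ℚ {(I * Real.sqrt 23 : ℂ)} {(Real.sqrt 5 : ℂ)}).trans ?_
  rw [Set.union_comm, Set.singleton_union]

end Complex

theorem classNumber_sqrtNeg23_and_biquadratic :
    Nat.card (ClassGroup (𝓞 (ℚ⟮(Complex.I * Real.sqrt 23 : ℂ)⟯))) = 3 ∧
    Nat.card (ClassGroup
      (𝓞 (IntermediateField.adjoin ℚ {(Real.sqrt 5 : ℂ), Complex.I * Real.sqrt 23}))) = 3 := by
  obtain ⟨w, hw, -⟩ := exists_ringOfIntegers_sq_eq_add (-6)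
    (gen_I_mul_sqrt_sq.trans (by norm_num))
  have hw' : w ^ 2 = w - 6 := by rw [hw]; push_cast; ring
  refine ⟨natCard_classGroup_of_finrank_eq_two finrank_adjoin_I_mul_sqrt hw', ?_⟩
  rw [← restrictScalars_adjoin_sqrt_five]
  change Nat.card (ClassGroup
    (𝓞 ℚ⟮(Complex.I * Real.sqrt 23 : ℂ)⟯⟮(Real.sqrt 5 : ℂ)⟯)) = 3
  have hgen : (AdjoinSimple.gen ℚ⟮(Complex.I * Real.sqrt 23 : ℂ)⟯ (Real.sqrt 5 : ℂ)) ^ 2 =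
      1 + 4 * (1 : ℤ) := by
    apply (algebraMap _ ℂ).injective
    rw [map_pow, map_add, map_mul, map_one, map_ofNat, map_intCast,
      AdjoinSimple.algebraMap_gen, sqrt_five_sq]
    norm_num
  obtain ⟨u, hu, hu'⟩ := exists_ringOfIntegers_sq_eq_add 1 hgen
  refine natCard_classGroup_of_finrank_eq_two_of_finrank_eq_two finrank_adjoin_I_mul_sqrt
    finrank_adjoin_sqrt_five hw' (u := u) (by rw [hu, Int.cast_one]) ?_
  rintro ⟨y, hy⟩
  refine sqrt_five_notMem_range ⟨2 * y - 1, ?_⟩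
  have hy' := congrArg (algebraMap ℚ⟮(Complex.I * Real.sqrt 23 : ℂ)⟯⟮(Real.sqrt 5 : ℂ)⟯ ℂ)
    (hy.trans hu')
  rw [← IsScalarTower.algebraMap_apply, map_div₀, map_add, map_one, map_ofNat,
    AdjoinSimple.algebraMap_gen] at hy'
  rw [map_sub, map_mul, map_ofNat, map_one, hy']
  ring
end

section
/- The degree-4 CM field ℚ(√(−(5+√5))), generated inside ℂ by a square root of −(5+√5), has class number 2; likewise, the degree-4 CM field ℚ(√(−(65−26√5))), generated inside ℂ by a square root of −(65−26√5), has class number 2. -/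
set_option synthInstance.maxHeartbeats 400000

/-!
Statement 18: the quartic CM fields ℚ(√(−(5+√5))) and ℚ(√(−(65−26√5)))
each have class number 2.
-/

open IntermediateField NumberField

/-- A number field with a `ℚ`-basis `1, φ, η, φη` of algebraic integers, where `φ` is a golden ratio
and `η` is a square root of `-ℓ √5 φ = -ℓ (φ + 2)`. -/
structure GoldenQuartic (K : Type*) [Field K] [NumberField K] (ℓ : ℕ) where
  φ : 𝓞 K
  η : 𝓞 K
  φ_sq : φ ^ 2 = φ + 1
  η_sq : η ^ 2 = -ℓ * (φ + 2)
  basis : Module.Basis (Fin 4) ℚ K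
  basis_apply : ⇑basis = ![1, (φ : K), (η : K), (φ : K) * (η : K)]

namespace GoldenQuartic

variable {K : Type*} [Field K] [NumberField K] {ℓ : ℕ} (G : GoldenQuartic K ℓ)

lemma coe_φ_sq : (G.φ : K) ^ 2 = G.φ + 1 := by
  simpa using congrArg (algebraMap (𝓞 K) K) G.φ_sq

lemma coe_η_sq : (G.η : K) ^ 2 = -ℓ * (G.φ + 2) := by
  have h2 : algebraMap (𝓞 K) K 2 = 2 := map_ofNat _ 2
  simpa [h2] using congrArg (algebraMap (𝓞 K) K) G.η_sq

/-- The element of `K` with the given coordinates. -/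
def elt (x₀ x₁ y₀ y₁ : ℚ) : K :=
  x₀ + x₁ * (G.φ : K) + y₀ * (G.η : K) + y₁ * ((G.φ : K) * (G.η : K))

lemma repr_elt (x₀ x₁ y₀ y₁ : ℚ) (i : Fin 4) :
    G.basis.repr (G.elt x₀ x₁ y₀ y₁) i = ![x₀, x₁, y₀, y₁] i := by
  have : G.elt x₀ x₁ y₀ y₁ = G.basis.equivFun.symm ![x₀, x₁, y₀, y₁] := by
    rw [Module.Basis.equivFun_symm_apply, Fin.sum_univ_four, G.basis_apply]
    simp [elt, Algebra.smul_def]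
  rw [this, ← Module.Basis.equivFun_apply, LinearEquiv.apply_symm_apply]

lemma leftMulMatrix_elt (x₀ x₁ y₀ y₁ : ℚ) :
    Algebra.leftMulMatrix G.basis (G.elt x₀ x₁ y₀ y₁) =
      !![x₀, x₁, -ℓ * (2 * y₀ + y₁), -ℓ * (y₀ + 3 * y₁);
         x₁, x₀ + x₁, -ℓ * (y₀ + 3 * y₁), -ℓ * (3 * y₀ + 4 * y₁);
         y₀, y₁, x₀, x₁;
         y₁, y₀ + y₁, x₁, x₀ + x₁] := by
  have h1 := G.coe_φ_sq
  have h2 := G.coe_η_sq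
  have e0 : G.elt x₀ x₁ y₀ y₁ * 1 = G.elt x₀ x₁ y₀ y₁ := mul_one _
  have e1 : G.elt x₀ x₁ y₀ y₁ * G.φ = G.elt x₁ (x₀ + x₁) y₁ (y₀ + y₁) := by
    simp only [elt]; push_cast
    linear_combination (x₁ + y₁ * (G.η : K)) * h1
  have e2 : G.elt x₀ x₁ y₀ y₁ * G.η =
      G.elt (-ℓ * (2 * y₀ + y₁)) (-ℓ * (y₀ + 3 * y₁)) x₀ x₁ := by
    simp only [elt]; push_cast
    linear_combination (y₀ + y₁ * (G.φ : K)) * h2 - ℓ * y₁ * h1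
  have e3 : G.elt x₀ x₁ y₀ y₁ * (G.φ * G.η) =
      G.elt (-ℓ * (y₀ + 3 * y₁)) (-ℓ * (3 * y₀ + 4 * y₁)) x₁ (x₀ + x₁) := by
    simp only [elt]; push_cast
    linear_combination (y₀ + y₁ * (G.φ : K)) * G.φ * h2 +
      (x₁ * (G.η : K) - ℓ * y₀ - ℓ * y₁ * (G.φ + 3)) * h1
  ext i j
  rw [Algebra.leftMulMatrix_eq_repr_mul, G.basis_apply]
  fin_cases j
  · change G.basis.repr (_ * 1) i = _
    rw [e0, repr_elt]; fin_cases i <;> rfl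
  · change G.basis.repr (_ * (G.φ : K)) i = _
    rw [e1, repr_elt]; fin_cases i <;> rfl
  · change G.basis.repr (_ * (G.η : K)) i = _
    rw [e2, repr_elt]; fin_cases i <;> rfl
  · change G.basis.repr (_ * ((G.φ : K) * (G.η : K))) i = _
    rw [e3, repr_elt]; fin_cases i <;> rfl

/-- The norm of `x + y η` to `ℚ(φ)` is `U + V φ`. -/
lemma norm_elt (x₀ x₁ y₀ y₁ U V : ℚ)
    (hU : U = x₀ ^ 2 + x₁ ^ 2 + ℓ * (2 * (y₀ ^ 2 + y₁ ^ 2) + (2 * y₀ * y₁ + y₁ ^ 2)))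
    (hV : V = 2 * x₀ * x₁ + x₁ ^ 2 + ℓ * ((y₀ ^ 2 + y₁ ^ 2) + 3 * (2 * y₀ * y₁ + y₁ ^ 2))) :
    Algebra.norm ℚ (G.elt x₀ x₁ y₀ y₁) = U ^ 2 + U * V - V ^ 2 := by
  rw [Algebra.norm_eq_matrix_det G.basis, leftMulMatrix_elt, hU, hV, Matrix.det_succ_row_zero]
  simp [Fin.sum_univ_succ, Matrix.det_fin_three, Fin.succAbove]
  ring

lemma finrank_eq (G : GoldenQuartic K ℓ) : Module.finrank ℚ K = 4 := by
  simp [Module.finrank_eq_card_basis G.basis]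

lemma finrank_ringOfIntegers (G : GoldenQuartic K ℓ) : Module.finrank ℤ (𝓞 K) = 4 := by
  rw [RingOfIntegers.rank, G.finrank_eq]

lemma absNorm_span_natCast (G : GoldenQuartic K ℓ) (n : ℕ) :
    Ideal.absNorm (Ideal.span {(n : 𝓞 K)}) = n ^ 4 := by
  rw [Ideal.absNorm_span_natCast, G.finrank_ringOfIntegers]

end GoldenQuartic

lemma NumberField.abs_discr_le_of_algebra_discr {K ι : Type*} [Field K] [NumberField K] [Fintype ι]
    [DecidableEq ι] (hι : Fintype.card ι = Module.finrank ℚ K) (v : ι → 𝓞 K) (d : ℤ) (hd : d ≠ 0)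
    (hv : Algebra.discr ℚ (fun i ↦ (v i : K)) = d) : |discr K| ≤ |d| := by
  classical
  let e : Module.Free.ChooseBasisIndex ℤ (𝓞 K) ≃ ι := Fintype.equivOfCardEq (by
    rw [hι, ← Module.finrank_eq_card_chooseBasisIndex, RingOfIntegers.rank])
  let B := (RingOfIntegers.basis K).reindex e
  have hB : Algebra.discr ℤ B = discr K := by
    rw [discr_eq_discr]
  have h1 : Algebra.discr ℤ v = d := by
    have : ((Algebra.discr ℤ v : ℤ) : ℚ) = d := by
      rw [← hv, Algebra.discr_def, Algebra.discr_def, Int.cast_det]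
      congr 1
      ext i j
      simp [Algebra.traceMatrix_apply, Algebra.traceForm_apply, Algebra.coe_trace_int]
    exact_mod_cast this
  have h2 : Algebra.discr ℤ v = (B.toMatrix v).det ^ 2 * discr K := by
    rw [← hB, ← Algebra.discr_of_matrix_vecMul, Module.Basis.toMatrix_map_vecMul]
  rw [← h1, h2, abs_mul]
  refine le_mul_of_one_le_left (abs_nonneg _) (Int.one_le_abs fun h ↦ hd ?_)
  rw [← h1, h2, h, zero_mul]

lemma Ideal.mem_of_eq_mul_add_mul {R : Type*} [CommRing R] {I : Ideal R} {x y z : R} (hx : x ∈ I)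
    (hy : y ∈ I) (a b : R) (h : z = a * x + b * y) : z ∈ I :=
  h ▸ I.add_mem (I.mul_mem_left a hx) (I.mul_mem_left b hy)

lemma Ideal.eq_of_le_of_absNorm_eq {R : Type*} [CommRing R] [IsDedekindDomain R]
    [Module.Free ℤ R] [Module.Finite ℤ R] {I J : Ideal R} (h : I ≤ J) (h0 : Ideal.absNorm J ≠ 0)
    (hn : Ideal.absNorm I = Ideal.absNorm J) : I = J := by
  obtain ⟨Q, rfl⟩ := Ideal.dvd_iff_le.mpr h
  rw [map_mul, Nat.mul_eq_left h0, Ideal.absNorm_eq_one_iff] at hn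
  rw [hn, Ideal.mul_top]

lemma ZMod.eq_zero_or_one_of_pow_five :
    ∀ x y : ZMod 5, x ^ 5 = (y ^ 5) ^ 4 → x = 0 ∨ x = 1 := by
  decide

lemma exists_natCast_eq_of_card_prime {R : Type*} [CommRing R] {p : ℕ} [Fact p.Prime]
    (h : Nat.card R = p) (x : R) : ∃ n : ℕ, (n : R) = x := by
  have : Finite R := Nat.finite_of_card_ne_zero (h ▸ (Fact.out : p.Prime).ne_zero)
  have := Fintype.ofFinite R
  let e := ZMod.ringEquivOfPrime R Fact.out (Nat.card_eq_fintype_card.symm.trans h)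
  refine ⟨(e.symm x).val, e.symm.injective ?_⟩
  rw [map_natCast, ZMod.natCast_zmod_val]

lemma Algebra.norm_intCast_add_natCast_mul {R : Type*} [CommRing R] [Module.Free ℤ R]
    [Module.Finite ℤ R] (p : ℕ) (n : ℤ) (r : R) :
    ((Algebra.norm ℤ (n + p * r : R) : ℤ) : ZMod p) = (n : ZMod p) ^ Module.finrank ℤ R := by
  classical
  let B := Module.Free.chooseBasis ℤ R
  have h : (Algebra.leftMulMatrix B (n + p * r)).map (Int.castRingHom (ZMod p)) =
      (n : ZMod p) • 1 := by
    have : (n + p * r : R) = algebraMap ℤ R n + (p : ℤ) • r := by simp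
    rw [this, map_add, AlgHom.commutes, map_smul]
    ext i j
    simp only [Matrix.map_apply, Matrix.add_apply, Matrix.smul_apply,
      Matrix.algebraMap_matrix_apply]
    by_cases hij : i = j
    · subst hij; simp
    · simp [hij]
  rw [Algebra.norm_eq_matrix_det B, Int.cast_det, ← Int.coe_castRingHom]
  rw [h, Matrix.det_smul, Matrix.det_one, mul_one, Module.finrank_eq_card_chooseBasisIndex]

namespace GoldenQuartic

variable {K : Type*} [Field K] [NumberField K] {ℓ : ℕ} (G : GoldenQuartic K ℓ)

/-- The square root `2φ - 1` of `5`. -/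
def s : 𝓞 K := 2 * G.φ - 1

lemma s_sq : G.s ^ 2 = 5 := by
  rw [s]; linear_combination 4 * G.φ_sq

lemma η_pow_four : G.η ^ 4 = 5 * (ℓ ^ 2 * G.φ ^ 2) := by
  linear_combination (G.η ^ 2 - ℓ * (G.φ + 2)) * G.η_sq - 4 * ℓ ^ 2 * G.φ_sq

lemma η_sq_mul : G.η ^ 2 * (G.φ - 1) = -ℓ * G.s := by
  rw [s]; linear_combination (G.φ - 1) * G.η_sq - ℓ * G.φ_sq

/-- The ideal `(ℓ, η)`. -/
def idealℓ : Ideal (𝓞 K) := Ideal.span {(ℓ : 𝓞 K), G.η}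

/-- The ideal `(√5, η)`. -/
def ideal₅ : Ideal (𝓞 K) := Ideal.span {G.s, G.η}

lemma idealℓ_mul_self (h : ℓ.Coprime 5) : G.idealℓ * G.idealℓ = Ideal.span {(ℓ : 𝓞 K)} := by
  obtain ⟨u, v, huv⟩ := Nat.isCoprime_iff_coprime.mpr h
  have huv' : (u : 𝓞 K) * ℓ + v * 5 = 1 := by exact_mod_cast congrArg (Int.cast : ℤ → 𝓞 K) huv
  rw [idealℓ, Ideal.span_pair_mul_span_pair]
  apply le_antisymm
  · rw [Ideal.span_le]
    rintro x (rfl | rfl | rfl | rfl) <;> rw [SetLike.mem_coe, Ideal.mem_span_singleton]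
    · exact dvd_mul_left _ _
    · exact dvd_mul_right _ _
    · exact dvd_mul_left _ _
    · exact ⟨-(G.φ + 2), by linear_combination G.η_sq⟩
  · rw [Ideal.span_singleton_le_iff_mem]
    exact Ideal.mem_of_eq_mul_add_mul (x := (ℓ * ℓ : 𝓞 K)) (y := G.η * G.η)
      (Ideal.subset_span (by simp))
      (Ideal.subset_span (by simp)) u (-v * (3 - G.φ)) (by
        linear_combination -ℓ * huv' + v * (3 - G.φ) * G.η_sq + v * ℓ * G.φ_sq)

lemma ideal₅_mul_self (h : ℓ.Coprime 5) : G.ideal₅ * G.ideal₅ = Ideal.span {G.s} := by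
  obtain ⟨u, v, huv⟩ := Nat.isCoprime_iff_coprime.mpr h
  have huv' : (u : 𝓞 K) * ℓ + v * 5 = 1 := by exact_mod_cast congrArg (Int.cast : ℤ → 𝓞 K) huv
  rw [ideal₅, Ideal.span_pair_mul_span_pair]
  apply le_antisymm
  · rw [Ideal.span_le]
    rintro x (rfl | rfl | rfl | rfl) <;> rw [SetLike.mem_coe, Ideal.mem_span_singleton]
    · exact dvd_mul_left _ _
    · exact dvd_mul_right _ _
    · exact dvd_mul_left _ _
    · exact ⟨-ℓ * G.φ, by linear_combination G.φ * G.η_sq_mul - G.η ^ 2 * G.φ_sq⟩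
  · rw [Ideal.span_singleton_le_iff_mem]
    exact Ideal.mem_of_eq_mul_add_mul (x := G.s * G.s) (y := G.η * G.η)
      (Ideal.subset_span (by simp))
      (Ideal.subset_span (by simp)) (v * G.s) (-u * (G.φ - 1)) (by
        linear_combination -G.s * huv' + u * G.η_sq_mul - v * G.s * G.s_sq)

lemma idealℓ_mul_ideal₅ (h : ℓ.Coprime 5) : G.idealℓ * G.ideal₅ = Ideal.span {G.η} := by
  obtain ⟨u, v, huv⟩ := Nat.isCoprime_iff_coprime.mpr h
  have huv' : (u : 𝓞 K) * ℓ + v * 5 = 1 := by exact_mod_cast congrArg (Int.cast : ℤ → 𝓞 K) huv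
  rw [idealℓ, ideal₅, Ideal.span_pair_mul_span_pair]
  apply le_antisymm
  · rw [Ideal.span_le]
    rintro x (rfl | rfl | rfl | rfl) <;> rw [SetLike.mem_coe, Ideal.mem_span_singleton]
    · exact ⟨-G.η * (G.φ - 1), by linear_combination G.η_sq_mul⟩
    · exact dvd_mul_left _ _
    · exact dvd_mul_right _ _
    · exact dvd_mul_left _ _
  · rw [Ideal.span_singleton_le_iff_mem]
    exact Ideal.mem_of_eq_mul_add_mul (x := ℓ * G.η) (y := G.η * G.s)
      (Ideal.subset_span (by simp))
      (Ideal.subset_span (by simp)) u (v * G.s) (by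
        linear_combination -G.η * huv' - v * G.η * G.s_sq)

lemma absNorm_idealℓ (h : ℓ.Coprime 5) : Ideal.absNorm G.idealℓ = ℓ ^ 2 := by
  have := congrArg Ideal.absNorm (G.idealℓ_mul_self h)
  rw [map_mul, G.absNorm_span_natCast] at this
  exact Nat.pow_left_injective two_ne_zero (by simp only; linarith)

lemma absNorm_ideal₅ (h : ℓ.Coprime 5) : Ideal.absNorm G.ideal₅ = 5 := by
  have h1 := congrArg Ideal.absNorm (G.ideal₅_mul_self h)
  have h2 : Ideal.span {G.s} * Ideal.span {G.s} = Ideal.span {((5 : ℕ) : 𝓞 K)} := by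
    rw [Ideal.span_singleton_mul_span_singleton, ← sq, s_sq, Nat.cast_ofNat]
  have h3 := congrArg Ideal.absNorm h2
  rw [map_mul, G.absNorm_span_natCast] at h3
  rw [map_mul] at h1
  rw [← h1] at h3
  exact Nat.pow_left_injective (n := 4) (by norm_num) (by simp only; linarith)

lemma ideal₅_le {P : Ideal (𝓞 K)} [P.IsPrime] (h : 5 ∈ P) : G.ideal₅ ≤ P := by
  rw [ideal₅, Ideal.span_le]
  rintro x (rfl | rfl)
  · exact ‹P.IsPrime›.mem_of_pow_mem 2 (G.s_sq ▸ h)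
  · exact ‹P.IsPrime›.mem_of_pow_mem 4 (G.η_pow_four ▸ P.mul_mem_right _ h)

lemma eq_ideal₅ (hℓ : ℓ.Coprime 5) {P : Ideal (𝓞 K)} [P.IsPrime] (h : Ideal.absNorm P = 5) :
    P = G.ideal₅ := by
  refine (Ideal.eq_of_le_of_absNorm_eq (G.ideal₅_le ?_) (by simp [h])
    (by rw [h, G.absNorm_ideal₅ hℓ])).symm
  simpa [h] using P.absNorm_mem

lemma norm_mod_five (G : GoldenQuartic K ℓ) (hℓ : ℓ.Coprime 5) (a : 𝓞 K) :
    ((Algebra.norm ℤ a : ℤ) : ZMod 5) = 0 ∨ ((Algebra.norm ℤ a : ℤ) : ZMod 5) = 1 := by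
  have : Fact (Nat.Prime 5) := ⟨by norm_num⟩
  obtain ⟨n, hn⟩ := exists_natCast_eq_of_card_prime (p := 5)
    ((Submodule.cardQuot_apply _).symm.trans (G.absNorm_ideal₅ hℓ))
    (Ideal.Quotient.mk G.ideal₅ a)
  rw [← map_natCast (Ideal.Quotient.mk G.ideal₅), eq_comm, Ideal.Quotient.eq, ideal₅,
    Ideal.mem_span_pair] at hn
  obtain ⟨u, v, huv⟩ := hn
  have hfrob (x y : 𝓞 K) : ∃ r, (x + y) ^ 5 = x ^ 5 + y ^ 5 + 5 * r :=
    ⟨x ^ 4 * y + 2 * x ^ 3 * y ^ 2 + 2 * x ^ 2 * y ^ 3 + x * y ^ 4, by ring⟩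
  obtain ⟨r₁, h₁⟩ := hfrob n (u * G.s + v * G.η)
  obtain ⟨r₂, h₂⟩ := hfrob (u * G.s) (v * G.η)
  have key : ∃ r, a ^ 5 = ((n ^ 5 : ℤ) : 𝓞 K) + (5 : ℕ) * r := by
    refine ⟨r₁ + r₂ + u ^ 5 * G.s ^ 3 + v ^ 5 * G.η * (ℓ ^ 2 * G.φ ^ 2), ?_⟩
    have : a = n + (u * G.s + v * G.η) := by rw [huv]; ring
    rw [this, h₁, h₂]
    push_cast
    linear_combination u ^ 5 * G.s ^ 3 * G.s_sq + v ^ 5 * G.η * G.η_pow_four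
  obtain ⟨r, hr⟩ := key
  have := congrArg (fun x ↦ ((Algebra.norm ℤ x : ℤ) : ZMod 5)) hr
  simp only [Algebra.norm_intCast_add_natCast_mul, map_pow, G.finrank_ringOfIntegers] at this
  push_cast at this
  exact ZMod.eq_zero_or_one_of_pow_five _ _ this

lemma exists_eq_elt (a : K) : ∃ x₀ x₁ y₀ y₁ : ℚ, a = G.elt x₀ x₁ y₀ y₁ := by
  refine ⟨G.basis.repr a 0, G.basis.repr a 1, G.basis.repr a 2, G.basis.repr a 3,
    (G.basis.sum_repr a).symm.trans ?_⟩
  rw [Fin.sum_univ_four, G.basis_apply]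
  simp [elt, Algebra.smul_def]

lemma norm_nonneg (G : GoldenQuartic K ℓ) (a : 𝓞 K) : 0 ≤ Algebra.norm ℤ a := by
  obtain ⟨x₀, x₁, y₀, y₁, h⟩ := G.exists_eq_elt (a : K)
  have : (Algebra.norm ℤ a : ℚ) = Algebra.norm ℚ (a : K) := Algebra.coe_norm_int a
  rw [h, G.norm_elt _ _ _ _ _ _ rfl rfl] at this
  rw [← Int.cast_nonneg_iff (R := ℝ)]
  have key : ((Algebra.norm ℤ a : ℤ) : ℝ) =
      ((x₀ + x₁ * Real.goldenRatio) ^ 2 +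
        ℓ * (Real.goldenRatio + 2) * (y₀ + y₁ * Real.goldenRatio) ^ 2) *
      ((x₀ + x₁ * Real.goldenConj) ^ 2 +
        ℓ * (Real.goldenConj + 2) * (y₀ + y₁ * Real.goldenConj) ^ 2) := by
    rw [← Rat.cast_intCast, this]
    have h1 : Real.goldenConj = 1 - Real.goldenRatio := by
      linarith [Real.goldenRatio_add_goldenConj]
    have h2 := Real.goldenRatio_sq
    push_cast
    rw [h1]
    generalize Real.goldenRatio = g at *
    have h3 : g ^ 3 = 2 * g + 1 := by linear_combination (g + 1) * h2
    have h4 : g ^ 4 = 3 * g + 2 := by linear_combination g * h3 + 2 * h2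
    have h5 : g ^ 5 = 5 * g + 3 := by linear_combination g * h4 + 3 * h2
    have h6 : g ^ 6 = 8 * g + 5 := by linear_combination g * h5 + 5 * h2
    ring_nf
    simp only [h2, h3, h4, h5, h6]
    ring
  rw [key]
  have := Real.goldenRatio_pos
  have := Real.neg_one_lt_goldenConj
  have : 0 < Real.goldenConj + 2 := by linarith
  positivity

lemma idealℓ_not_isPrincipal (hℓ : ℓ % 5 = 2 ∨ ℓ % 5 = 3) : ¬ G.idealℓ.IsPrincipal := by
  rintro ⟨a, ha⟩
  have hc : ℓ.Coprime 5 := by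
    rw [Nat.coprime_comm, Nat.Prime.coprime_iff_not_dvd (by norm_num)]; omega
  have h := G.absNorm_idealℓ hc
  rw [ha, Ideal.submodule_span_eq, Ideal.absNorm_span_singleton] at h
  have h2 : Algebra.norm ℤ a = (ℓ : ℤ) ^ 2 := by
    rw [← Int.natAbs_of_nonneg (G.norm_nonneg a), h]; push_cast; rfl
  have h3 := G.norm_mod_five hc a
  rw [h2] at h3
  push_cast at h3
  rw [← ZMod.natCast_mod ℓ 5] at h3
  rcases hℓ with hℓ | hℓ <;> rw [hℓ] at h3 <;> revert h3 <;> decide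

end GoldenQuartic

lemma Ideal.exists_ringHom_zmod {R : Type*} [CommRing R] [IsDedekindDomain R]
    [Module.Free ℤ R] [Module.Finite ℤ R] {p : ℕ} [Fact p.Prime] {P : Ideal R}
    (h : Ideal.absNorm P = p) : ∃ f : R →+* ZMod p, ∀ x, f x = 0 → x ∈ P := by
  have hc : Nat.card (R ⧸ P) = p := (Submodule.cardQuot_apply _).symm.trans h
  have : Finite (R ⧸ P) := Nat.finite_of_card_ne_zero (hc ▸ (Fact.out : p.Prime).ne_zero)
  have := Fintype.ofFinite (R ⧸ P)
  let e := (ZMod.ringEquivOfPrime (R ⧸ P) Fact.out (Nat.card_eq_fintype_card.symm.trans hc)).symm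
  exact ⟨e.toRingHom.comp (Ideal.Quotient.mk P), fun x hx ↦
    Ideal.Quotient.eq_zero_iff_mem.mp (e.injective (by simpa using hx))⟩

lemma Ideal.natCast_mem_of_absNorm_eq_pow {R : Type*} [CommRing R] [IsDedekindDomain R]
    [Module.Free ℤ R] [Module.Finite ℤ R] {P : Ideal R} [P.IsMaximal] {p k : ℕ}
    (h : Ideal.absNorm P = p ^ k) : (p : R) ∈ P := by
  refine ‹P.IsMaximal›.isPrime.mem_of_pow_mem k ?_
  rw [← Nat.cast_pow, ← h]
  exact P.absNorm_mem

lemma Nat.not_isPrimePow_of_dvd {p q n : ℕ} (hp : p.Prime) (hq : q.Prime) (hpq : p ≠ q)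
    (hpn : p ∣ n) (hqn : q ∣ n) : ¬ IsPrimePow n := fun h ↦
  hpq ((isPrimePow_iff_unique_prime_dvd.mp h).unique ⟨hp, hpn⟩ ⟨hq, hqn⟩)

lemma Ideal.pow_absNorm_quotient {R : Type*} [CommRing R] [IsDedekindDomain R]
    [Module.Free ℤ R] [Module.Finite ℤ R] {P : Ideal R} [P.IsMaximal] {q : ℕ}
    (h : Ideal.absNorm P = q) (hq : q ≠ 0) (x : R ⧸ P) : x ^ q = x := by
  have hc : Nat.card (R ⧸ P) = q := (Submodule.cardQuot_apply _).symm.trans h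
  have : Finite (R ⧸ P) := Nat.finite_of_card_ne_zero (hc ▸ hq)
  have := Fintype.ofFinite (R ⧸ P)
  let _ := Ideal.Quotient.field P
  rw [← hc, Nat.card_eq_fintype_card]
  exact FiniteField.pow_card x

open scoped nonZeroDivisors

/-- The class of an ideal lies in a subgroup as soon as those of its prime factors do. -/
lemma ClassGroup.mk0_mem_of_forall_prime {R : Type*} [CommRing R] [IsDedekindDomain R]
    (H : Subgroup (ClassGroup R)) (I : (Ideal R)⁰)
    (hI : ∀ P : (Ideal R)⁰, (P : Ideal R).IsPrime → (I : Ideal R) ≤ P → ClassGroup.mk0 P ∈ H) :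
    ClassGroup.mk0 I ∈ H := by
  obtain ⟨I, h0⟩ := I
  induction I using UniqueFactorizationMonoid.induction_on_prime with
  | h₁ => exact absurd rfl (nonZeroDivisors.ne_zero h0)
  | h₂ I hu =>
    obtain rfl := Ideal.isUnit_iff.mp hu
    convert H.one_mem
    exact (ClassGroup.mk0_eq_one_iff h0).mpr top_isPrincipal
  | h₃ I P hI0 hP ih =>
    have hP0 : P ∈ (Ideal R)⁰ := mem_nonZeroDivisors_of_ne_zero hP.ne_zero
    have hI1 : I ∈ (Ideal R)⁰ := mem_nonZeroDivisors_of_ne_zero hI0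
    have : (⟨P * I, h0⟩ : (Ideal R)⁰) = ⟨P, hP0⟩ * ⟨I, hI1⟩ := rfl
    rw [this, map_mul]
    exact H.mul_mem (hI ⟨P, hP0⟩ (Ideal.isPrime_of_prime hP) Ideal.mul_le_left)
      (ih hI1 fun Q hQ hle ↦ hI Q hQ (Ideal.mul_le_right.trans hle))

lemma ClassGroup.card_eq_two {R : Type*} [CommRing R] [IsDedekindDomain R] {J : Ideal R}
    (hJ0 : J ≠ 0) (hJ : ¬ J.IsPrincipal) (hJ2 : (J * J).IsPrincipal) (S : Set (Ideal R))
    (hS : ∀ C : ClassGroup R, ∃ I : (Ideal R)⁰, ClassGroup.mk0 I = C ∧ (I : Ideal R) ∈ S)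
    (hP : ∀ P : Ideal R, P.IsPrime → P ≠ 0 → (∃ I ∈ S, I ≠ 0 ∧ I ≤ P) →
      P.IsPrincipal ∨ (P * J).IsPrincipal) : Nat.card (ClassGroup R) = 2 := by
  have hJm : J ∈ (Ideal R)⁰ := mem_nonZeroDivisors_of_ne_zero hJ0
  let c := ClassGroup.mk0 ⟨J, hJm⟩
  have hc1 : c ≠ 1 := fun h ↦ hJ ((ClassGroup.mk0_eq_one_iff hJm).mp h)
  have hc2 : c ^ 2 = 1 := by
    rw [sq, ← map_mul]
    exact (ClassGroup.mk0_eq_one_iff _).mpr hJ2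
  have htop : Subgroup.zpowers c = ⊤ := by
    rw [eq_top_iff]
    rintro C -
    obtain ⟨I, rfl, hI⟩ := hS C
    refine ClassGroup.mk0_mem_of_forall_prime _ _ fun P hPp hle ↦ ?_
    rcases hP P hPp (nonZeroDivisors.coe_ne_zero P)
      ⟨I, hI, nonZeroDivisors.coe_ne_zero I, hle⟩ with h | h
    · rw [(ClassGroup.mk0_eq_one_iff P.2).mpr h]
      exact Subgroup.one_mem _
    · have : ClassGroup.mk0 P * c = 1 := by
        rw [← map_mul]
        exact (ClassGroup.mk0_eq_one_iff _).mpr h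
      rw [eq_inv_of_mul_eq_one_left this]
      exact Subgroup.inv_mem _ (Subgroup.mem_zpowers c)
  have : Fact (Nat.Prime 2) := ⟨Nat.prime_two⟩
  rw [← Subgroup.card_top (G := ClassGroup R), ← htop, Nat.card_zpowers,
    orderOf_eq_prime hc2 hc1]

lemma Ideal.isPrimePow_absNorm {R : Type*} [CommRing R] [IsDedekindDomain R]
    [Module.Free ℤ R] [Module.Finite ℤ R] {P : Ideal R} [P.IsMaximal] (h : Ideal.absNorm P ≠ 0) :
    IsPrimePow (Ideal.absNorm P) := by
  have hc : Nat.card (R ⧸ P) = Ideal.absNorm P := (Submodule.cardQuot_apply _).symm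
  have : Finite (R ⧸ P) := Nat.finite_of_card_ne_zero (hc ▸ h)
  have := Fintype.ofFinite (R ⧸ P)
  let _ := Ideal.Quotient.field P
  rw [← hc, Nat.card_eq_fintype_card]
  exact FiniteField.isPrimePow_card _

namespace GoldenQuartic

variable {K : Type*} [Field K] [NumberField K] {ℓ : ℕ} (G : GoldenQuartic K ℓ)

lemma exists_absNorm_le (G : GoldenQuartic K ℓ) (d N : ℕ) (hd : |discr K| ≤ d)
    (hN : ((4 / 3.14) ^ 2 * (24 / 256)) ^ 2 * d < ((N + 1 : ℕ) : ℝ) ^ 2) (C : ClassGroup (𝓞 K)) :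
    ∃ I : (Ideal (𝓞 K))⁰, ClassGroup.mk0 I = C ∧ Ideal.absNorm (I : Ideal (𝓞 K)) ≤ N := by
  obtain ⟨I, hI, hle⟩ := exists_ideal_in_class_of_norm_le C
  refine ⟨I, hI, Nat.lt_succ_iff.mp (Nat.cast_lt (α := ℝ).mp (hle.trans_lt ?_))⟩
  rw [G.finrank_eq]
  have hr : InfinitePlace.nrComplexPlaces K ≤ 2 := by
    have := InfinitePlace.card_add_two_mul_card_eq_rank K
    rw [G.finrank_eq] at this
    omega
  have hπ := Real.pi_gt_d2
  have hπ4 := Real.pi_le_four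
  have h1 : (4 / Real.pi) ^ InfinitePlace.nrComplexPlaces K ≤ (4 / 3.14) ^ 2 :=
    (pow_le_pow_right₀ ((one_le_div Real.pi_pos).mpr hπ4) hr).trans (by gcongr)
  have h2 : √|(discr K : ℝ)| ≤ √d := Real.sqrt_le_sqrt (by exact_mod_cast hd)
  have h3 : (4 / 3.14) ^ 2 * (24 / 256) * √d < ((N + 1 : ℕ) : ℝ) := by
    refine lt_of_pow_lt_pow_left₀ 2 (by positivity) ?_
    rwa [mul_pow, Real.sq_sqrt (Nat.cast_nonneg d)]
  refine lt_of_le_of_lt ?_ h3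
  rw [mul_assoc]
  refine mul_le_mul h1 ?_ (by positivity) (by positivity)
  have : ((Nat.factorial 4 : ℕ) : ℝ) / ((4 : ℕ) : ℝ) ^ 4 = 24 / 256 := by norm_num [Nat.factorial]
  rw [this]
  gcongr

lemma false_of_absNorm_eq_prime (G : GoldenQuartic K ℓ) {p : ℕ} (hpr : p.Prime)
    {P : Ideal (𝓞 K)} (h : Ideal.absNorm P = p)
    (hp : ∀ x y : ZMod p, x ^ 2 = x + 1 → y ^ 2 = -ℓ * (x + 2) → False) : False := by
  have := Fact.mk hpr
  obtain ⟨f, -⟩ := Ideal.exists_ringHom_zmod h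
  refine hp (f G.φ) (f G.η) ?_ ?_
  · simpa using congrArg f G.φ_sq
  · simpa [map_ofNat f 2] using congrArg f G.η_sq

variable {P : Ideal (𝓞 K)} [P.IsMaximal]

lemma absNorm_ne_eight (G : GoldenQuartic K ℓ) : Ideal.absNorm P ≠ 8 := by
  intro h
  have h2 : (Ideal.Quotient.mk P 2) = 0 := by
    rw [Ideal.Quotient.eq_zero_iff_mem]
    exact_mod_cast Ideal.natCast_mem_of_absNorm_eq_pow (k := 3) h
  have h3 := Ideal.pow_absNorm_quotient h (by norm_num) (Ideal.Quotient.mk P G.φ)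
  have h4 := congrArg (Ideal.Quotient.mk P) G.φ_sq
  simp only [map_pow, map_add, map_one, map_ofNat] at h2 h4
  generalize Ideal.Quotient.mk P G.φ = g at *
  have h5 : g ^ 4 = 3 * g + 2 := by linear_combination (g ^ 2 + g + 2) * h4
  refine one_ne_zero (α := 𝓞 K ⧸ P) ?_
  linear_combination h3 - (g ^ 4 + 3 * g + 2) * h5 - 9 * h4 - (10 * g + 6) * h2

lemma absNorm_ne_nine (G : GoldenQuartic K ℓ) (hℓ : ℓ % 3 ≠ 0) : Ideal.absNorm P ≠ 9 := by
  intro h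
  have h2 : (Ideal.Quotient.mk P 3) = 0 := by
    rw [Ideal.Quotient.eq_zero_iff_mem]
    exact_mod_cast Ideal.natCast_mem_of_absNorm_eq_pow (k := 2) h
  have h3 := Ideal.pow_absNorm_quotient h (by norm_num) (Ideal.Quotient.mk P G.η)
  have h4 := congrArg (Ideal.Quotient.mk P) G.φ_sq
  have h6 := congrArg (Ideal.Quotient.mk P) G.η_pow_four
  have hl : ((ℓ : 𝓞 K ⧸ P)) ^ 2 = 1 := by
    have h1 : ℓ ^ 2 % 3 = 1 := by
      have : ℓ % 3 = 1 ∨ ℓ % 3 = 2 := by omega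
      rcases this with h | h <;> simp [Nat.pow_mod, h]
    have := congrArg (Nat.cast : ℕ → 𝓞 K ⧸ P) (Nat.div_add_mod (ℓ ^ 2) 3)
    rw [h1] at this
    push_cast at this
    simp only [map_ofNat] at h2
    linear_combination -this + ((ℓ ^ 2 / 3 : ℕ) : 𝓞 K ⧸ P) * h2
  simp only [map_pow, map_add, map_one, map_ofNat, map_mul, map_natCast] at h2 h4 h6
  generalize Ideal.Quotient.mk P G.φ = g at *
  generalize Ideal.Quotient.mk P G.η = e at *
  rw [hl, h4] at h6
  have h8 : e ^ 8 = -1 := by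
    linear_combination (e ^ 4 + 5 * (1 * (g + 1))) * h6 + 25 * h4 + (25 * g + 17) * h2
  have he : e = 0 := by
    linear_combination h3 - e * h8 + e * h2
  rw [he] at h8
  exact one_ne_zero (α := 𝓞 K ⧸ P) (by linear_combination h8)

end GoldenQuartic

lemma Ideal.isPrincipal_of_mul_span_singleton {R : Type*} [CommRing R] [IsDomain R] {I : Ideal R}
    {s : R} (hs : s ≠ 0) (h : (I * Ideal.span {s}).IsPrincipal) : I.IsPrincipal := by
  obtain ⟨a, ha⟩ := h
  rw [Ideal.submodule_span_eq] at ha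
  have hm : a ∈ Ideal.span {s} := by
    refine Ideal.mul_le_right (I := I) ?_
    rw [ha]
    exact Ideal.mem_span_singleton_self a
  obtain ⟨b, rfl⟩ := Ideal.mem_span_singleton.mp hm
  rw [mul_comm I, ← Ideal.span_singleton_mul_span_singleton,
    Ideal.span_singleton_mul_right_inj hs] at ha
  exact ⟨b, ha⟩

namespace GoldenQuartic

variable {K : Type*} [Field K] [NumberField K] {ℓ : ℕ}

lemma trace_elt_mul_elt (G : GoldenQuartic K ℓ) (x₀ x₁ y₀ y₁ z₀ z₁ w₀ w₁ : ℚ) :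
    Algebra.trace ℚ K (G.elt x₀ x₁ y₀ y₁ * G.elt z₀ z₁ w₀ w₁) =
      4 * (x₀ * z₀ + x₁ * z₁) + 2 * (x₀ * z₁ + x₁ * z₀ + x₁ * z₁) -
        10 * ℓ * (y₀ * w₀ + 2 * (y₁ * w₁) + y₀ * w₁ + y₁ * w₀) := by
  rw [Algebra.trace_eq_matrix_trace G.basis, map_mul, leftMulMatrix_elt, leftMulMatrix_elt,
    Matrix.trace, Fin.sum_univ_four]
  simp
  ring

/-- The determinant of the trace form on four vectors whose coordinates are known. -/
lemma discr_eq_det (G : GoldenQuartic K ℓ) (v : Fin 4 → 𝓞 K) (M : Matrix (Fin 4) (Fin 4) ℚ)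
    (hv : ∀ i, (v i : K) = G.elt (M i 0) (M i 1) (M i 2) (M i 3)) :
    Algebra.discr ℚ (fun i ↦ (v i : K)) = 2000 * ℓ ^ 2 * M.det ^ 2 := by
  have h : Algebra.traceMatrix ℚ (fun i ↦ (v i : K)) =
      M * (!![4, 2, 0, 0; 2, 6, 0, 0; 0, 0, -10 * ℓ, -10 * ℓ; 0, 0, -10 * ℓ, -20 * ℓ] :
        Matrix (Fin 4) (Fin 4) ℚ) * M.transpose := by
    ext i j
    rw [Algebra.traceMatrix_apply, Algebra.traceForm_apply, hv, hv, trace_elt_mul_elt]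
    simp [Matrix.mul_apply, Fin.sum_univ_four]
    ring
  rw [Algebra.discr_def, h, Matrix.det_mul, Matrix.det_mul, Matrix.det_transpose,
    Matrix.det_succ_row_zero !![(4 : ℚ), 2, 0, 0; _, _, _, _; _, _, _, _; _, _, _, _]]
  simp [Fin.sum_univ_succ, Matrix.det_fin_three, Fin.succAbove]
  ring

/-- A criterion for class number two, in terms of the prime ideals of norm at most `N`. -/
lemma card_classGroup_eq_two (G : GoldenQuartic K ℓ) (hℓ : ℓ % 5 = 2 ∨ ℓ % 5 = 3) (d N : ℕ)
    (hd : |discr K| ≤ d) (hN : ((4 / 3.14) ^ 2 * (24 / 256)) ^ 2 * d < ((N + 1 : ℕ) : ℝ) ^ 2)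
    (hP : ∀ P : Ideal (𝓞 K), P.IsMaximal → ∀ q ≤ N, IsPrimePow q → Ideal.absNorm P = q →
      P.IsPrincipal ∨ (P * G.idealℓ).IsPrincipal) : Nat.card (ClassGroup (𝓞 K)) = 2 := by
  have hc : ℓ.Coprime 5 := by
    rw [Nat.coprime_comm, Nat.Prime.coprime_iff_not_dvd (by norm_num)]; omega
  refine ClassGroup.card_eq_two (J := G.idealℓ) ?_ (G.idealℓ_not_isPrincipal hℓ)
    ⟨_, G.idealℓ_mul_self hc⟩ {I | Ideal.absNorm I ≤ N} (G.exists_absNorm_le d N hd hN) ?_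
  · rintro h
    have := G.absNorm_idealℓ hc
    rw [h, Ideal.zero_eq_bot, Ideal.absNorm_bot] at this
    have : ℓ = 0 := by simpa using this.symm
    omega
  · rintro P hPp hP0 ⟨I, hIN, hI0, hle⟩
    have hm : P.IsMaximal := hPp.isMaximal hP0
    refine hP P hm _ ((Nat.le_of_dvd ?_ (Ideal.absNorm_dvd_absNorm_of_le hle)).trans hIN)
      (Ideal.isPrimePow_absNorm (by rwa [Ne, Ideal.absNorm_eq_zero_iff])) rfl
    rwa [Nat.pos_iff_ne_zero, Ne, Ideal.absNorm_eq_zero_iff]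

lemma card_classGroup_of_two (G : GoldenQuartic K 2) : Nat.card (ClassGroup (𝓞 K)) = 2 := by
  have hd : |discr K| ≤ |(8000 : ℤ)| := by
    refine abs_discr_le_of_algebra_discr (ι := Fin 4) (by simp [G.finrank_eq])
      ![1, G.φ, G.η, G.φ * G.η] _ (by norm_num) ?_
    rw [G.discr_eq_det _ !![1, 0, 0, 0; 0, 1, 0, 0; 0, 0, 1, 0; 0, 0, 0, 1],
      Matrix.det_succ_row_zero]
    · simp [Fin.sum_univ_succ, Matrix.det_fin_three, Fin.succAbove]
      norm_num
    · intro i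
      fin_cases i <;> simp [elt]
  refine G.card_classGroup_eq_two (Or.inl rfl) 8000 13 (by simpa using hd) (by norm_num) ?_
  intro P hP q hq hpp h
  interval_cases q <;> try exact absurd hpp (by decide)
  · exact (G.false_of_absNorm_eq_prime Nat.prime_two h (by decide)).elim
  · exact (G.false_of_absNorm_eq_prime Nat.prime_three h (by decide)).elim
  · have h2 : (2 : 𝓞 K) ∈ P := by
      exact_mod_cast Ideal.natCast_mem_of_absNorm_eq_pow (p := 2) (k := 2) h
    have hle : G.idealℓ ≤ P := by
      rw [idealℓ, Ideal.span_le]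
      rintro x (rfl | rfl)
      · exact h2
      · refine hP.isPrime.mem_of_pow_mem 2 (G.η_sq ▸ ?_)
        exact P.mul_mem_right _ (P.neg_mem h2)
    obtain rfl := Ideal.eq_of_le_of_absNorm_eq hle (by simp [h])
      (by rw [h, G.absNorm_idealℓ (by norm_num)]; norm_num)
    exact Or.inr ⟨_, G.idealℓ_mul_self (by norm_num)⟩
  · obtain rfl := G.eq_ideal₅ (by norm_num) h
    rw [mul_comm]
    exact Or.inr ⟨_, G.idealℓ_mul_ideal₅ (by norm_num)⟩
  · exact (G.false_of_absNorm_eq_prime Nat.prime_seven h (by decide)).elim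
  · exact (G.absNorm_ne_eight h).elim
  · exact (G.absNorm_ne_nine (by norm_num) h).elim
  · exact (G.false_of_absNorm_eq_prime Nat.prime_eleven h (by decide)).elim
  · exact (G.false_of_absNorm_eq_prime (by norm_num) h (by decide)).elim

end GoldenQuartic

namespace GoldenQuartic

variable {K : Type*} [Field K] [NumberField K] {ℓ : ℕ}

lemma exists_half (G : GoldenQuartic K 13) : ∃ β : 𝓞 K, 2 * β = G.φ + 1 + G.η ∧
    β ^ 2 = (G.φ + 1) * β - (4 * G.φ + 7) := by
  have h1 := G.coe_φ_sq
  have h2 := G.coe_η_sq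
  have hint : IsIntegral (𝓞 K) ((G.φ + 1 + G.η) / 2 : K) := by
    refine ⟨.X ^ 2 - (.C (G.φ + 1) * .X - .C (4 * G.φ + 7)), ?_, ?_⟩
    · monicity!
    · have h4 : algebraMap (𝓞 K) K 4 = 4 := map_ofNat _ 4
      have h7 : algebraMap (𝓞 K) K 7 = 7 := map_ofNat _ 7
      simp [h4, h7]
      push_cast at h2
      linear_combination (1 / 4 : K) * h2 - (1 / 4 : K) * h1
  obtain ⟨β, hβ⟩ := IsIntegrallyClosed.isIntegral_iff.mp hint
  have hβ1 : 2 * β = G.φ + 1 + G.η := by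
    apply RingOfIntegers.coe_injective
    have h2 : algebraMap (𝓞 K) K 2 = 2 := map_ofNat _ 2
    simp only [map_mul, map_add, map_one, hβ, h2]
    ring
  refine ⟨β, hβ1, mul_left_cancel₀ (by norm_num : (4 : 𝓞 K) ≠ 0) ?_⟩
  have h3 := G.η_sq
  push_cast at h3
  linear_combination (2 * β - (G.φ + 1) + G.η) * hβ1 + h3 - G.φ_sq

lemma coe_half (G : GoldenQuartic K 13) {β : 𝓞 K} (h : 2 * β = G.φ + 1 + G.η) :
    (β : K) = G.elt (1 / 2) (1 / 2) (1 / 2) 0 := by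
  have h := congrArg (algebraMap (𝓞 K) K) h
  have h2 : algebraMap (𝓞 K) K 2 = 2 := map_ofNat _ 2
  simp only [map_mul, map_add, map_one, h2] at h
  simp only [elt]
  push_cast
  linear_combination (1 / 2 : K) * h

lemma absNorm_ne_four (G : GoldenQuartic K 13) {P : Ideal (𝓞 K)} [P.IsMaximal] :
    Ideal.absNorm P ≠ 4 := by
  intro h
  obtain ⟨β, -, hβ⟩ := G.exists_half
  have h2 : (Ideal.Quotient.mk P 2) = 0 := by
    rw [Ideal.Quotient.eq_zero_iff_mem]
    exact_mod_cast Ideal.natCast_mem_of_absNorm_eq_pow (k := 2) h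
  have h3 := Ideal.pow_absNorm_quotient h (by norm_num) (Ideal.Quotient.mk P β)
  have h4 := congrArg (Ideal.Quotient.mk P) G.φ_sq
  have h5 := congrArg (Ideal.Quotient.mk P) hβ
  simp only [map_pow, map_add, map_one, map_ofNat, map_mul, map_sub] at h2 h4 h5
  generalize Ideal.Quotient.mk P G.φ = g at *
  generalize Ideal.Quotient.mk P β = b at *
  have h6 : b ^ 2 = (g + 1) * b + 1 := by linear_combination h5 - (2 * g + 4) * h2
  have h7 : b ^ 4 = b + g + 1 := by
    linear_combination (b ^ 2 + (g + 1) * b + 1 + (g + 1) ^ 2) * h6 +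
      ((g + 4) * b + 1) * h4 + (4 * g * b + 3 * b + g + 1 + b * g) * h2
  have h8 : g = 1 := by linear_combination h3 - h7 - h2
  rw [h8] at h4
  exact one_ne_zero (α := 𝓞 K ⧸ P) (by linear_combination -h4)

/-- Residues modulo `19` at which one of four elements of norm `95` vanishes. -/
lemma zmod_nineteen_cases : ∀ x y : ZMod 19, x ^ 2 = x + 1 → y ^ 2 = (x + 1) * y - (4 * x + 7) →
    x + y = 0 ∨ y - 2 = 0 ∨ 1 - x * y = 0 ∨ 2 * x + 1 - y = 0 := by
  decide

lemma absNorm_span_eq (G : GoldenQuartic K ℓ) {α : 𝓞 K} {x₀ x₁ y₀ y₁ : ℚ}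
    (h : (α : K) = G.elt x₀ x₁ y₀ y₁) {n : ℕ}
    (hn : Algebra.norm ℚ (G.elt x₀ x₁ y₀ y₁) = n) :
    Ideal.absNorm (Ideal.span {α}) = n := by
  have := Algebra.coe_norm_int α
  rw [h, hn] at this
  rw [Ideal.absNorm_span_singleton,
    Int.cast_injective (α := ℚ) (this.trans (Int.cast_natCast n).symm), Int.natAbs_natCast]

lemma exists_mem_absNorm_eq (G : GoldenQuartic K 13) {P : Ideal (𝓞 K)}
    (h : Ideal.absNorm P = 19) : ∃ α ∈ P, Ideal.absNorm (Ideal.span {α}) = 95 := by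
  have : Fact (Nat.Prime 19) := ⟨by norm_num⟩
  obtain ⟨β, hβ, hβ2⟩ := G.exists_half
  obtain ⟨f, hf⟩ := Ideal.exists_ringHom_zmod h
  have h1 : f G.φ ^ 2 = f G.φ + 1 := by simpa using congrArg f G.φ_sq
  have h2 : f β ^ 2 = (f G.φ + 1) * f β - (4 * f G.φ + 7) := by
    simpa [map_ofNat f] using congrArg f hβ2
  have e : algebraMap (𝓞 K) K β = _ := G.coe_half hβ
  have hφ := G.coe_φ_sq
  rcases zmod_nineteen_cases _ _ h1 h2 with h | h | h | h
  · refine ⟨G.φ + β, hf _ (by simpa using h), G.absNorm_span_eq (x₀ := 1 / 2) (x₁ := 3 / 2)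
      (y₀ := 1 / 2) (y₁ := 0) ?_ ?_⟩
    · rw [RingOfIntegers.coe_eq_algebraMap, map_add, e]; simp only [elt]; push_cast; ring
    · rw [G.norm_elt _ _ _ _ _ _ rfl rfl]; norm_num
  · refine ⟨β - 2, hf _ (by simpa [map_ofNat f] using h), G.absNorm_span_eq (x₀ := -3 / 2)
      (x₁ := 1 / 2) (y₀ := 1 / 2) (y₁ := 0) ?_ ?_⟩
    · rw [RingOfIntegers.coe_eq_algebraMap, map_sub, e, map_ofNat]; simp only [elt]; push_cast; ring
    · rw [G.norm_elt _ _ _ _ _ _ rfl rfl]; norm_num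
  · refine ⟨1 - G.φ * β, hf _ (by simpa using h), G.absNorm_span_eq (x₀ := 1 / 2)
      (x₁ := -1) (y₀ := 0) (y₁ := -1 / 2) ?_ ?_⟩
    · rw [RingOfIntegers.coe_eq_algebraMap, map_sub, map_mul, e, map_one]
      simp only [elt]; push_cast
      linear_combination (-1 / 2 : K) * hφ
    · rw [G.norm_elt _ _ _ _ _ _ rfl rfl]; norm_num
  · refine ⟨2 * G.φ + 1 - β, hf _ (by simpa [map_ofNat f] using h), G.absNorm_span_eq
      (x₀ := 1 / 2) (x₁ := 3 / 2) (y₀ := -1 / 2) (y₁ := 0) ?_ ?_⟩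
    · rw [RingOfIntegers.coe_eq_algebraMap, map_sub, map_add, map_mul, e, map_one, map_ofNat]
      simp only [elt]; push_cast; ring
    · rw [G.norm_elt _ _ _ _ _ _ rfl rfl]; norm_num

lemma isPrincipal_mul_idealℓ (G : GoldenQuartic K 13) {P : Ideal (𝓞 K)}
    (h : Ideal.absNorm P = 19) : (P * G.idealℓ).IsPrincipal := by
  obtain ⟨α, hα, hn⟩ := G.exists_mem_absNorm_eq h
  obtain ⟨Q, hQ⟩ := Ideal.dvd_iff_le.mpr ((Ideal.span_singleton_le_iff_mem P).mpr hα)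
  rw [hQ, map_mul, h] at hn
  have hQ5 : Ideal.absNorm Q = 5 := by omega
  have : Q.IsPrime := Ideal.isPrime_of_irreducible_absNorm (by rw [hQ5]; exact Nat.prime_five)
  obtain rfl := G.eq_ideal₅ (by norm_num) hQ5
  have hs : G.s ≠ 0 := fun h ↦ by simpa [h] using G.s_sq
  refine Ideal.isPrincipal_of_mul_span_singleton hs ⟨α * G.η, ?_⟩
  rw [Ideal.submodule_span_eq, ← Ideal.span_singleton_mul_span_singleton, hQ,
    ← G.idealℓ_mul_ideal₅ (by norm_num), ← G.ideal₅_mul_self (by norm_num)]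
  ring

lemma card_classGroup_of_thirteen (G : GoldenQuartic K 13) : Nat.card (ClassGroup (𝓞 K)) = 2 := by
  have hd : |discr K| ≤ |(21125 : ℤ)| := by
    obtain ⟨β, hβ, -⟩ := G.exists_half
    have e := G.coe_half hβ
    have hφ := G.coe_φ_sq
    refine abs_discr_le_of_algebra_discr (ι := Fin 4) (by simp [G.finrank_eq])
      ![1, G.φ, β, G.φ * β] _ (by norm_num) ?_
    rw [G.discr_eq_det _ !![1, 0, 0, 0; 0, 1, 0, 0; 1 / 2, 1 / 2, 1 / 2, 0; 1 / 2, 1, 0, 1 / 2],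
      Matrix.det_succ_row_zero]
    · simp [Fin.sum_univ_succ, Matrix.det_fin_three, Fin.succAbove]
      norm_num
    · intro i
      fin_cases i
      · simp [elt]
      · simp [elt]
      · simp [e]
      · simp [e]
        simp [elt]
        linear_combination (1 / 2 : K) * hφ
  refine G.card_classGroup_eq_two (Or.inr rfl) 21125 22 (by simpa using hd) (by norm_num) ?_
  intro P hP q hq hpp h
  interval_cases q <;> try exact absurd hpp (by decide)
  · exact (G.false_of_absNorm_eq_prime Nat.prime_two h (by decide)).elim
  · exact (G.false_of_absNorm_eq_prime Nat.prime_three h (by decide)).elim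
  · exact (G.absNorm_ne_four h).elim
  · obtain rfl := G.eq_ideal₅ (by norm_num) h
    rw [mul_comm]
    exact Or.inr ⟨_, G.idealℓ_mul_ideal₅ (by norm_num)⟩
  · exact (G.false_of_absNorm_eq_prime Nat.prime_seven h (by decide)).elim
  · exact (G.absNorm_ne_eight h).elim
  · exact (G.absNorm_ne_nine (by norm_num) h).elim
  · exact (G.false_of_absNorm_eq_prime Nat.prime_eleven h (by decide)).elim
  · exact (G.false_of_absNorm_eq_prime (by norm_num) h (by decide)).elim
  · exact absurd hpp (Nat.not_isPrimePow_of_dvd Nat.prime_three Nat.prime_five (by norm_num)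
      (by norm_num) (by norm_num))
  · have h2 : (2 : 𝓞 K) ∈ P := by
      exact_mod_cast Ideal.natCast_mem_of_absNorm_eq_pow (p := 2) (k := 4) h
    refine Or.inl ⟨((2 : ℕ) : 𝓞 K), (Ideal.eq_of_le_of_absNorm_eq ?_ (by simp [h]) ?_).symm⟩
    · exact (Ideal.span_singleton_le_iff_mem P).mpr (by exact_mod_cast h2)
    · rw [h, Ideal.submodule_span_eq, G.absNorm_span_natCast]
      norm_num
  · exact (G.false_of_absNorm_eq_prime (by norm_num) h (by decide)).elim
  · exact Or.inr (G.isPrincipal_mul_idealℓ h)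
  · exact absurd hpp (Nat.not_isPrimePow_of_dvd Nat.prime_three Nat.prime_seven (by norm_num)
      (by norm_num) (by norm_num))

end GoldenQuartic

lemma nonempty_goldenQuartic {K : Type*} [Field K] [NumberField K] {ℓ : ℕ} {φ η : K}
    (hφ : φ ^ 2 = φ + 1) (hη : η ^ 2 = -ℓ * (φ + 2))
    (hli : LinearIndependent ℚ ![1, φ, η, φ * η]) (hfin : Module.finrank ℚ K ≤ 4) :
    Nonempty (GoldenQuartic K ℓ) := by
  have hφi : IsIntegral ℤ φ := by
    refine ⟨.X ^ 2 - (.X + 1), by monicity!, ?_⟩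
    simp [hφ]
  have hηi : IsIntegral ℤ η := by
    refine IsIntegral.of_pow two_pos ?_
    rw [hη]
    have h (n : ℕ) : IsIntegral ℤ (n : K) := by
      simpa using isIntegral_algebraMap (R := ℤ) (A := K) (x := n)
    exact (h ℓ).neg.mul (hφi.add (h 2))
  have hcard : Fintype.card (Fin 4) = Module.finrank ℚ K :=
    le_antisymm hli.fintype_card_le_finrank (by simpa using hfin)
  let φ' : 𝓞 K := ⟨φ, hφi⟩
  let η' : 𝓞 K := ⟨η, hηi⟩
  exact ⟨{
    φ := φ'
    η := η'
    φ_sq := RingOfIntegers.coe_injective hφ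
    η_sq := by
      apply RingOfIntegers.coe_injective
      have h2 : algebraMap (𝓞 K) K 2 = 2 := map_ofNat _ 2
      rw [map_pow, map_mul, map_neg, map_natCast, map_add, h2]
      exact hη
    basis := basisOfLinearIndependentOfCardEqFinrank hli hcard
    basis_apply := coe_basisOfLinearIndependentOfCardEqFinrank hli hcard }⟩

/-- If `φ` is the golden ratio and `η ≠ 0` is purely imaginary, then `1, φ, η, φη` are linearly
independent over `ℚ`. -/
lemma linearIndependent_goldenRatio {t : ℝ} (ht : t ≠ 0) :
    LinearIndependent ℚ ![1, (Real.goldenRatio : ℂ), Complex.I * t,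
      (Real.goldenRatio : ℂ) * (Complex.I * t)] := by
  rw [Fintype.linearIndependent_iff]
  intro g hg
  have key : ∀ a b : ℚ, (a : ℝ) + b * Real.goldenRatio = 0 → a = 0 ∧ b = 0 := by
    intro a b h
    by_cases hb : b = 0
    · simpa [hb] using h
    · refine absurd ⟨-a / b, ?_⟩ Real.goldenRatio_irrational
      have : (b : ℝ) ≠ 0 := by exact_mod_cast hb
      push_cast
      exact (div_eq_iff this).mpr (by linear_combination -h)
  simp only [Fin.sum_univ_four, Algebra.smul_def, eq_ratCast] at hg
  have hr := congrArg Complex.re hg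
  have hi := congrArg Complex.im hg
  simp at hr hi
  have h1 := key _ _ hr
  have h2 := key (g 2) (g 3) (by
    refine (mul_eq_zero.mp (?_ : t * _ = 0)).resolve_left ht
    linear_combination hi)
  intro i
  fin_cases i
  exacts [h1.1, h1.2, h2.1, h2.2]

/-- A subfield of `ℂ` generated by a root `θ` of a rational monic quartic, which contains the golden
ratio and a purely imaginary `√(-ℓ(φ + 2))`, has a golden basis. -/
lemma exists_goldenQuartic {θ : ℂ} (a b : ℤ) (hθ : θ ^ 4 + a * θ ^ 2 + b = 0) {ℓ : ℕ} {t : ℝ}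
    (ht : t ≠ 0) (ht2 : t ^ 2 = ℓ * (Real.goldenRatio + 2))
    (hφ : (Real.goldenRatio : ℂ) ∈ ℚ⟮θ⟯) (hη : Complex.I * t ∈ ℚ⟮θ⟯) :
    ∃ _ : NumberField ℚ⟮θ⟯, Nonempty (GoldenQuartic ℚ⟮θ⟯ ℓ) := by
  let f : Polynomial ℚ := .X ^ 4 + .C (a : ℚ) * .X ^ 2 + .C (b : ℚ)
  have hdeg : f.natDegree = 4 := by simp only [f]; compute_degree!
  have hf : f.Monic := by simp only [f]; monicity!
  have hroot : Polynomial.aeval θ f = 0 := by simpa [f] using hθ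
  have hint : IsIntegral ℚ θ := ⟨f, hf, hroot⟩
  have : FiniteDimensional ℚ ℚ⟮θ⟯ := IntermediateField.adjoin.finiteDimensional hint
  have hK : NumberField ℚ⟮θ⟯ := ⟨⟩
  refine ⟨hK, ?_⟩
  have hfin : Module.finrank ℚ ℚ⟮θ⟯ ≤ 4 := by
    rw [IntermediateField.adjoin.finrank hint, ← hdeg]
    exact Polynomial.natDegree_le_of_dvd (minpoly.dvd ℚ θ hroot) hf.ne_zero
  let φ : ℚ⟮θ⟯ := ⟨_, hφ⟩
  let η : ℚ⟮θ⟯ := ⟨_, hη⟩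
  have hφ2 : φ ^ 2 = φ + 1 := by
    apply Subtype.ext
    change (Real.goldenRatio : ℂ) ^ 2 = Real.goldenRatio + 1
    rw [← Complex.ofReal_pow, Real.goldenRatio_sq, Complex.ofReal_add, Complex.ofReal_one]
  have hη2 : η ^ 2 = -ℓ * (φ + 2) := by
    apply Subtype.ext
    have : (t : ℂ) ^ 2 = ℓ * (Real.goldenRatio + 2) := by exact_mod_cast ht2
    change (Complex.I * t) ^ 2 = -ℓ * ((Real.goldenRatio : ℂ) + 2)
    rw [mul_pow, Complex.I_sq, this]
    ring
  have hli : LinearIndependent ℚ ![1, φ, η, φ * η] := by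
    refine LinearIndependent.of_comp (ℚ⟮θ⟯.val.toLinearMap) ?_
    have : ⇑(ℚ⟮θ⟯.val.toLinearMap) ∘ ![1, φ, η, φ * η] =
        ![1, (Real.goldenRatio : ℂ), Complex.I * t, (Real.goldenRatio : ℂ) * (Complex.I * t)] := by
      ext i
      fin_cases i <;> rfl
    rw [this]
    exact linearIndependent_goldenRatio ht
  exact nonempty_goldenQuartic hφ2 hη2 hli hfin

theorem classNumber_two_for_two_quartic_CM_fields :
    Nat.card (ClassGroup
      (𝓞 (ℚ⟮(Complex.I * Real.sqrt (5 + Real.sqrt 5) : ℂ)⟯))) = 2 ∧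
    Nat.card (ClassGroup
      (𝓞 (ℚ⟮(Complex.I * Real.sqrt (65 - 26 * Real.sqrt 5) : ℂ)⟯))) = 2 := by
  have h5 : (√5 : ℝ) ^ 2 = 5 := Real.sq_sqrt (by norm_num)
  have h50 : 0 ≤ √(5 : ℝ) := Real.sqrt_nonneg 5
  have hg : Real.goldenRatio = (1 + √5) / 2 := rfl
  have h5' : ((√5 : ℝ) : ℂ) ^ 2 = 5 := by exact_mod_cast h5
  constructor
  · set t := √(5 + √5) with ht
    have ht2 : t ^ 2 = 5 + √5 := Real.sq_sqrt (by positivity)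
    have ht0 : t ≠ 0 := (Real.sqrt_pos.mpr (by positivity)).ne'
    have ht2' : (t : ℂ) ^ 2 = 5 + (√5 : ℝ) := by exact_mod_cast ht2
    have hθ : (Complex.I * t) ^ 2 = -(5 + (√5 : ℝ)) := by rw [mul_pow, Complex.I_sq, ht2']; ring
    have hmem := IntermediateField.mem_adjoin_simple_self ℚ (Complex.I * t)
    have hφ : (Real.goldenRatio : ℂ) = -((Complex.I * t) ^ 2 + 4) * ((2 : ℕ) : ℂ)⁻¹ := by
      rw [hθ, hg]; push_cast; ring
    obtain ⟨_, ⟨G⟩⟩ := exists_goldenQuartic (θ := Complex.I * t) 10 20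
      (by push_cast; linear_combination ((Complex.I * t) ^ 2 + 5 - (√5 : ℝ)) * hθ + h5') (ℓ := 2)
      ht0 (by rw [ht2, hg]; push_cast; ring)
      (hφ ▸ mul_mem (neg_mem (add_mem (pow_mem hmem 2) (ofNat_mem _ 4)))
        (inv_mem (_root_.natCast_mem _ 2))) hmem
    exact G.card_classGroup_of_two
  · set t := √(65 - 26 * √5) with ht
    have hpos : 0 < 65 - 26 * √5 := by nlinarith
    have ht2 : t ^ 2 = 65 - 26 * √5 := Real.sq_sqrt hpos.le
    have ht0 : t ≠ 0 := (Real.sqrt_pos.mpr hpos).ne'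
    have ht2' : (t : ℂ) ^ 2 = 65 - 26 * (√5 : ℝ) := by exact_mod_cast ht2
    have hθ : (Complex.I * t) ^ 2 = -(65 - 26 * (√5 : ℝ)) := by
      rw [mul_pow, Complex.I_sq, ht2']; ring
    have hmem := IntermediateField.mem_adjoin_simple_self ℚ (Complex.I * t)
    have hφ : (Real.goldenRatio : ℂ) =
        ((Complex.I * t) ^ 2 + ((91 : ℕ) : ℂ)) * ((52 : ℕ) : ℂ)⁻¹ := by
      rw [hθ, hg]; push_cast; ring
    have hφm : (Real.goldenRatio : ℂ) ∈ ℚ⟮Complex.I * t⟯ :=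
      hφ ▸ mul_mem (add_mem (pow_mem hmem 2) (_root_.natCast_mem _ 91))
        (inv_mem (_root_.natCast_mem _ 52))
    have hη : Complex.I * (t * Real.goldenRatio ^ 2 : ℝ) =
        Complex.I * t * (Real.goldenRatio : ℂ) ^ 2 := by push_cast; ring
    obtain ⟨_, ⟨G⟩⟩ := exists_goldenQuartic (θ := Complex.I * t) 130 845
      (by push_cast; linear_combination ((Complex.I * t) ^ 2 + 65 + 26 * (√5 : ℝ)) * hθ + 676 * h5')
      (ℓ := 13) (mul_ne_zero ht0 (pow_ne_zero 2 Real.goldenRatio_pos.ne'))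
      (by
        have h1 : ((1 + √5) / 2) ^ 2 = (3 + √5) / 2 := by linear_combination h5 / 4
        have h2 : ((3 + √5) / 2) ^ 2 = (7 + 3 * √5) / 2 := by linear_combination h5 / 4
        rw [mul_pow, ht2, hg, h1, h2]
        push_cast
        linear_combination -39 * h5) hφm (hη ▸ mul_mem hmem (pow_mem hφm 2))
    exact G.card_classGroup_of_thirteen
end
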